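/- Every cyclically 5-edge-connected cubic graph of order n has at least 3n/4 − 3/2 perfect matchings. -/

import Mathlib

open scoped Classical

noncomputable section

/-- A finite multigraph: finitely many vertices and edges, each edge has an
unordered pair of endpoints (parallel edges and loops are allowed). -/
structure Multigraph where
  V : Type
  E : Type
  fintypeV : Fintype V := by infer_instance
  fintypeE : Fintype E := by infer_instance
  ends : E → Sym2 V

namespace Multigraph

instance (G : Multigraph) : Fintype G.V := G.fintypeV
instance (G : Multigraph) : Fintype G.E := G.fintypeE

/-- The number of endpoints of the edge `e` that are equal to `v`
(a loop at `v` counts twice). -/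
def inc (G : Multigraph) (v : G.V) (e : G.E) : ℕ :=
  if G.ends e = Sym2.diag v then 2 else if v ∈ G.ends e then 1 else 0

/-- The degree of a vertex: the number of edge-ends at it (loops count twice). -/
def degree (G : Multigraph) (v : G.V) : ℕ := ∑ e : G.E, G.inc v e

/-- A graph is cubic if every vertex has degree three. -/
def IsCubic (G : Multigraph) : Prop := ∀ v : G.V, G.degree v = 3

/-- A perfect matching: a set of (non-loop) edges such that every vertex is
incident with exactly one edge of the set. -/
def IsPerfectMatching (G : Multigraph) (M : Finset G.E) : Prop :=
  (∀ e ∈ M, ¬ (G.ends e).IsDiag) ∧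
  ∀ v : G.V, ∃! e, e ∈ M ∧ v ∈ G.ends e

/-- The number of perfect matchings of `G`. -/
def pmCount (G : Multigraph) : ℕ :=
  Nat.card {M : Finset G.E // G.IsPerfectMatching M}

/-- Every edge lies in some perfect matching. -/
def MatchingCovered (G : Multigraph) : Prop :=
  ∀ e : G.E, ∃ M, G.IsPerfectMatching M ∧ e ∈ M

/-- Every edge lies in at least two perfect matchings. -/
def MatchingDoubleCovered (G : Multigraph) : Prop :=
  ∀ e : G.E, 2 ≤ Nat.card {M : Finset G.E // G.IsPerfectMatching M ∧ e ∈ M}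

/-- Adjacency via some edge. -/
def Adj (G : Multigraph) (u v : G.V) : Prop := ∃ e : G.E, G.ends e = s(u, v)

/-- The graph is connected. -/
def Connected (G : Multigraph) : Prop :=
  Nonempty G.V ∧ ∀ u v : G.V, Relation.ReflTransGen G.Adj u v

/-- The edge-cut `E(A, Aᶜ)`: edges with one end in `A` and the other outside. -/
def cutEdges (G : Multigraph) (A : Set G.V) : Set G.E :=
  {e | ∃ u v, G.ends e = s(u, v) ∧ u ∈ A ∧ v ∉ A}

/-- `G` is `k`-edge-connected: no edge-cut has fewer than `k` edges. -/
def EdgeConnected (G : Multigraph) (k : ℕ) : Prop :=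
  ∀ A : Set G.V, A.Nonempty → A ≠ Set.univ → k ≤ (G.cutEdges A).ncard

/-- Bridgeless = 2-edge-connected: connected with no edge-cut of size `< 2`. -/
def Bridgeless (G : Multigraph) : Prop := G.Connected ∧ G.EdgeConnected 2

/-- The subgraph induced on `A` contains a cycle (two parallel edges count as a
cycle of length two): there is a nonempty set of edges inside `A` in which every
vertex is incident with zero or at least two edge-ends. -/
def HasCycleWithin (G : Multigraph) (A : Set G.V) : Prop :=
  ∃ F : Finset G.E, F.Nonempty ∧ (∀ e ∈ F, ∀ v ∈ G.ends e, v ∈ A) ∧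
    ∀ v : G.V, (∑ e ∈ F, G.inc v e) ≠ 1

/-- The edge-cut `E(A, Aᶜ)` is cyclic: both sides contain a cycle. -/
def IsCyclicCut (G : Multigraph) (A : Set G.V) : Prop :=
  G.HasCycleWithin A ∧ G.HasCycleWithin Aᶜ

/-- `G` is cyclically `k`-edge-connected: no cyclic edge-cut has fewer than `k` edges. -/
def CyclicallyEdgeConnected (G : Multigraph) (k : ℕ) : Prop :=
  ∀ A : Set G.V, G.IsCyclicCut A → k ≤ (G.cutEdges A).ncard

/-- A cut is tight: every perfect matching contains exactly one of its edges. -/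
def IsTightCut (G : Multigraph) (A : Set G.V) : Prop :=
  ∀ M : Finset G.E, G.IsPerfectMatching M →
    (M.filter (fun e => e ∈ G.cutEdges A)).card = 1

/-- Adjacency within a set `A` of vertices. -/
def AdjOn (G : Multigraph) (A : Set G.V) (u v : G.V) : Prop :=
  u ∈ A ∧ v ∈ A ∧ G.Adj u v

/-- The subgraph induced on `A` is connected (any two of its vertices are joined
by a walk inside `A`). -/
def ConnectedOn (G : Multigraph) (A : Set G.V) : Prop :=
  ∀ u ∈ A, ∀ v ∈ A, Relation.ReflTransGen (G.AdjOn A) u v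

/-- `G` is `k`-vertex-connected: it has at least `k+1` vertices and removing any
set of at most `k-1` vertices leaves it connected. -/
def VertexConnected (G : Multigraph) (k : ℕ) : Prop :=
  k + 1 ≤ Fintype.card G.V ∧
  ∀ T : Set G.V, T.ncard ≤ k - 1 → G.ConnectedOn Tᶜ

/-- `{x, y}` is a 2-vertex-cut: removing both vertices disconnects the graph. -/
def IsVertexCutPair (G : Multigraph) (x y : G.V) : Prop :=
  x ≠ y ∧ ¬ G.ConnectedOn ({x, y}ᶜ)

/-- `G` is bipartite: the vertices split into two classes so that each edge
joins the two classes. -/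
def Bipartite (G : Multigraph) : Prop :=
  ∃ X : Set G.V, ∀ e : G.E, ∃ u v, G.ends e = s(u, v) ∧ u ∈ X ∧ v ∉ X

/-- Delete a set of edges (keeping all vertices). -/
def deleteEdges (G : Multigraph) (F : Set G.E) : Multigraph where
  V := G.V
  E := {e : G.E // e ∉ F}
  ends e := G.ends e.1

/-- Contract the vertex set `A` to a single vertex (`none`), deleting the arising
loops and keeping parallel edges. -/
def contract (G : Multigraph) (A : Set G.V) : Multigraph where
  V := Option {x : G.V // x ∉ A}
  E := {e : G.E // ¬ ∀ v ∈ G.ends e, v ∈ A}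
  ends e := (G.ends e.1).map fun x => if h : x ∈ A then none else some ⟨x, h⟩

/-- Isomorphism of multigraphs. -/
def Iso (G₁ G₂ : Multigraph) : Prop :=
  ∃ (f : G₁.V ≃ G₂.V) (g : G₁.E ≃ G₂.E), ∀ e, G₂.ends (g e) = (G₁.ends e).map f

/-- The complete graph on four vertices. -/
def K4 : Multigraph where
  V := Fin 4
  E := {p : Fin 4 × Fin 4 // p.1 < p.2}
  ends p := s(p.1.1, p.1.2)

/-- The result of simultaneously replacing every vertex of `S` by a triangle;
`σ e v` records to which of the three triangle vertices at `v` the edge `e`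
(formerly ending at `v`) is attached. -/
def expandTriangles (H : Multigraph) (S : Set H.V) (σ : H.E → H.V → Fin 3) :
    Multigraph where
  V := {x : H.V // x ∉ S} ⊕ (S × Fin 3)
  E := H.E ⊕ (S × Fin 3)
  ends e :=
    match e with
    | Sum.inl e => (H.ends e).map fun x =>
        if h : x ∈ S then Sum.inr (⟨x, h⟩, σ e x) else Sum.inl ⟨x, h⟩
    | Sum.inr (w, i) => s(Sum.inr (w, i + 1), Sum.inr (w, i + 2))

/-- `G` is obtained from `H` by replacing each vertex of `S` with a triangle:
the three edges formerly incident with a vertex of `S` get attached to the three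
distinct new triangle vertices. -/
def IsTriangleExpansion (H : Multigraph) (S : Set H.V) (G : Multigraph) : Prop :=
  ∃ σ : H.E → H.V → Fin 3,
    (∀ v ∈ S, ∀ e : H.E, H.ends e ≠ Sym2.diag v) ∧
    (∀ v ∈ S, Set.InjOn (fun e => σ e v) {e : H.E | v ∈ H.ends e}) ∧
    Iso (expandTriangles H S σ) G

/-- Klee-graphs: `K₄` together with everything obtainable by repeatedly replacing
a vertex with a triangle. -/
inductive IsKlee : Multigraph → Prop
  | k4 (G : Multigraph) : Iso K4 G → IsKlee G
  | expand (G : Multigraph) (v : G.V) (H : Multigraph) :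
      IsKlee G → IsTriangleExpansion G {v} H → IsKlee H

/-- A nice 3-edge-cut (of a cubic graph). -/
def IsNiceCut (G : Multigraph) (A : Set G.V) : Prop :=
  A.Nonempty ∧ A ≠ Set.univ ∧ (G.cutEdges A).ncard = 3 ∧
  ¬ IsKlee (G.contract A) ∧
  (¬ IsKlee (G.contract Aᶜ) ∨
   9 ≤ A.ncard ∨
   (5 ≤ A.ncard ∧ ¬ G.IsTightCut A) ∨
   (A.ncard = 3 ∧
     2 ≤ Nat.card {M : Finset G.E // G.IsPerfectMatching M ∧
       ∀ e ∈ G.cutEdges A, e ∈ M}))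

/-- A brace: a bipartite matching covered graph without nontrivial tight edge-cuts. -/
def IsBrace (H : Multigraph) : Prop :=
  H.Bipartite ∧ H.MatchingCovered ∧
  ∀ A : Set H.V, 2 ≤ A.ncard → 2 ≤ Aᶜ.ncard → ¬ H.IsTightCut A

/-- Data describing a simultaneous gluing of graphs `K w` (through their vertices
`z w`) onto the vertices `w ∈ W` of `H`: the edge `e` of `H` incident with `w`
is identified with the edge `ε w e` of `K w` incident with `z w`, whose other
end is `y w e`. -/
structure GlueData (H : Multigraph) (W : Set H.V) where
  K : W → Multigraph
  z : (w : W) → (K w).V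
  d : (w : W) → {x : (K w).V // x ≠ z w}
  ε : (w : W) → H.E → (K w).E
  y : (w : W) → H.E → {x : (K w).V // x ≠ z w}
  noloop : ∀ (w : W) (e : H.E), H.ends e ≠ Sym2.diag (w : H.V)
  noloopK : ∀ (w : W) (k : (K w).E), (K w).ends k ≠ Sym2.diag (z w)
  ends_eq : ∀ (w : W) (e : H.E), (w : H.V) ∈ H.ends e →
      (K w).ends (ε w e) = s(z w, (y w e : (K w).V))
  inj : ∀ w : W, Set.InjOn (ε w) {e : H.E | (w : H.V) ∈ H.ends e}
  surj : ∀ (w : W) (k : (K w).E), z w ∈ (K w).ends k →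
      ∃ e : H.E, (w : H.V) ∈ H.ends e ∧ ε w e = k

/-- The graph obtained by gluing each `D.K w` through `D.z w` onto the vertex
`w ∈ W` of `H`. -/
def glue (H : Multigraph) (W : Set H.V) (D : GlueData H W) : Multigraph where
  V := {x : H.V // x ∉ W} ⊕ (Σ w : W, {x : (D.K w).V // x ≠ D.z w})
  E := H.E ⊕ (Σ w : W, {k : (D.K w).E // D.z w ∉ (D.K w).ends k})
  ends e :=
    match e with
    | Sum.inl e => (H.ends e).map fun x =>
        if h : x ∈ W then Sum.inr ⟨⟨x, h⟩, D.y ⟨x, h⟩ e⟩ else Sum.inl ⟨x, h⟩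
    | Sum.inr ⟨w, k⟩ => ((D.K w).ends k.1).map fun x =>
        if h : x = D.z w then Sum.inr ⟨w, D.d w⟩ else Sum.inr ⟨w, ⟨x, h⟩⟩

/-- The multiset of vertex degrees different from three. -/
def nonCubicDegrees (G : Multigraph) : Multiset ℕ :=
  ((Finset.univ : Finset G.V).val.map G.degree).filter (· ≠ 3)

/-- `H` is an odd minor of `G`: it is obtained by contracting pairwise disjoint
connected subgraphs, each with an odd number of vertices (deleting arising loops
and keeping parallel edges). -/
def IsOddMinor (G H : Multigraph) : Prop :=
  ∃ π : G.V → H.V, Function.Surjective π ∧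
    (∀ w : H.V, G.ConnectedOn (π ⁻¹' {w}) ∧ Odd (π ⁻¹' {w}).ncard) ∧
    ∃ g : {e : G.E // ∃ u v, G.ends e = s(u, v) ∧ π u ≠ π v} ≃ H.E,
      ∀ e, H.ends (g e) = (G.ends e.1).map π

/-- The 6-vertex graph consisting of two nonadjacent vertices `x = 0`, `y = 1`
and four vertices `a = 2`, `b = 3`, `c = 4`, `d = 5`, with edges `ab`, `cd` and
an edge from each of `a`, `b`, `c`, `d` to each of `x` and `y`. -/
def specialGraph : Multigraph where
  V := Fin 6
  E := Fin 10
  ends := ![s(2, 3), s(4, 5), s(2, 0), s(2, 1), s(3, 0), s(3, 1),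
            s(4, 0), s(4, 1), s(5, 0), s(5, 1)]

/-- The perfect matching polytope: the convex hull of the characteristic vectors
of the perfect matchings. -/
def pmPolytope (G : Multigraph) : Set (G.E → ℝ) :=
  convexHull ℝ {w | ∃ M : Finset G.E, G.IsPerfectMatching M ∧
    w = fun e => if e ∈ M then (1 : ℝ) else 0}

end Multigraph

set_option linter.unusedSectionVars false
set_option linter.unreachableTactic false
set_option linter.unusedTactic false

namespace EdgeWeight

section Basic

variable {V E : Type} [Fintype V] [Fintype E] (s t : E → V)

/-- The total weight of the edges with exactly one end in `U`. -/
def cutL (U : Finset V) : (E → ℝ) →ₗ[ℝ] ℝ :=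
  ∑ e, (if (s e ∈ U ↔ t e ∈ U) then (0 : ℝ) else 1) • LinearMap.proj e

/-- The total weight of the edges at `w`, loops counting twice. -/
def degL (w : V) : (E → ℝ) →ₗ[ℝ] ℝ :=
  ∑ e, ((if s e = w then (1 : ℝ) else 0) + (if t e = w then 1 else 0)) • LinearMap.proj e

/-- The total weight of the edge-ends in `A` whose other end is in `B`. -/
def btwL (A B : Finset V) : (E → ℝ) →ₗ[ℝ] ℝ :=
  ∑ e, ((if s e ∈ A ∧ t e ∈ B then (1 : ℝ) else 0) + (if s e ∈ B ∧ t e ∈ A then 1 else 0)) •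
    LinearMap.proj e

/-- The characteristic vector of an edge set. -/
def ind (M : Finset E) : E → ℝ := fun e => if e ∈ M then 1 else 0

theorem cutL_apply (U : Finset V) (x : E → ℝ) :
    cutL s t U x = ∑ e, (if (s e ∈ U ↔ t e ∈ U) then (0 : ℝ) else 1) * x e := by
  simp only [cutL, LinearMap.sum_apply, LinearMap.smul_apply, LinearMap.proj_apply, smul_eq_mul]

theorem degL_apply (w : V) (x : E → ℝ) :
    degL s t w x =
      ∑ e, ((if s e = w then (1 : ℝ) else 0) + (if t e = w then 1 else 0)) * x e := by
  simp [degL]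

theorem btwL_apply (A B : Finset V) (x : E → ℝ) :
    btwL s t A B x = ∑ e, ((if s e ∈ A ∧ t e ∈ B then (1 : ℝ) else 0) +
      (if s e ∈ B ∧ t e ∈ A then 1 else 0)) * x e := by
  simp [btwL]

theorem cutL_compl (U : Finset V) : cutL s t Uᶜ = cutL s t U := by
  unfold cutL
  refine Finset.sum_congr rfl fun e _ => ?_
  by_cases h1 : s e ∈ U <;> by_cases h2 : t e ∈ U <;> simp [h1, h2]

theorem cutL_univ : cutL s t Finset.univ = 0 := by simp [cutL]

theorem cutL_eq_btwL (U : Finset V) : cutL s t U = btwL s t U Uᶜ := by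
  unfold cutL btwL
  refine Finset.sum_congr rfl fun e _ => ?_
  by_cases h1 : s e ∈ U <;> by_cases h2 : t e ∈ U <;> simp [h1, h2]

theorem btwL_union {A B C : Finset V} (h : Disjoint A B) (x : E → ℝ) :
    btwL s t (A ∪ B) C x = btwL s t A C x + btwL s t B C x := by
  simp only [btwL_apply, ← Finset.sum_add_distrib]
  refine Finset.sum_congr rfl fun e _ => ?_
  have h1 : s e ∈ A → s e ∉ B := fun h' => Finset.disjoint_left.1 h h'
  have h2 : t e ∈ A → t e ∉ B := fun h' => Finset.disjoint_left.1 h h'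
  by_cases a1 : s e ∈ A <;> by_cases a2 : t e ∈ A <;> by_cases a3 : s e ∈ B <;>
    by_cases a4 : t e ∈ B <;> simp_all <;> try (split_ifs <;> ring)

theorem sum_degL (A : Finset V) (x : E → ℝ) :
    ∑ w ∈ A, degL s t w x = btwL s t A A x + cutL s t A x := by
  simp only [degL_apply, btwL_apply, cutL_apply]
  rw [Finset.sum_comm, ← Finset.sum_add_distrib]
  refine Finset.sum_congr rfl fun e _ => ?_
  rw [← Finset.sum_mul, Finset.sum_add_distrib, Finset.sum_ite_eq, Finset.sum_ite_eq]
  by_cases h1 : s e ∈ A <;> by_cases h2 : t e ∈ A <;> simp [h1, h2] <;> ring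

theorem sum_degL_univ (x : E → ℝ) : ∑ w, degL s t w x = 2 * ∑ e, x e := by
  rw [sum_degL, cutL_univ, btwL_apply, Finset.mul_sum]
  simp only [LinearMap.zero_apply, add_zero]
  exact Finset.sum_congr rfl fun e _ => by simp; norm_num

theorem cutL_inter_add_union (U W : Finset V) (x : E → ℝ) :
    cutL s t U x + cutL s t W x =
      cutL s t (U ∩ W) x + cutL s t (U ∪ W) x + 2 * btwL s t (U \ W) (W \ U) x := by
  simp only [cutL_apply, btwL_apply, Finset.mul_sum, ← Finset.sum_add_distrib]
  refine Finset.sum_congr rfl fun e _ => ?_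
  by_cases a1 : s e ∈ U <;> by_cases a2 : t e ∈ U <;> by_cases a3 : s e ∈ W <;>
    by_cases a4 : t e ∈ W <;> simp [a1, a2, a3, a4] <;> ring

theorem cutL_sdiff_add_sdiff (U W : Finset V) (x : E → ℝ) :
    cutL s t U x + cutL s t W x =
      cutL s t (U \ W) x + cutL s t (W \ U) x + 2 * btwL s t (U ∩ W) (U ∪ W)ᶜ x := by
  simp only [cutL_apply, btwL_apply, Finset.mul_sum, ← Finset.sum_add_distrib]
  refine Finset.sum_congr rfl fun e _ => ?_
  by_cases a1 : s e ∈ U <;> by_cases a2 : t e ∈ U <;> by_cases a3 : s e ∈ W <;>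
    by_cases a4 : t e ∈ W <;> simp [a1, a2, a3, a4] <;> ring

theorem cutL_union {A B : Finset V} (h : Disjoint A B) (x : E → ℝ) :
    cutL s t (A ∪ B) x + 2 * btwL s t A B x = cutL s t A x + cutL s t B x := by
  simp only [cutL_apply, btwL_apply, Finset.mul_sum, ← Finset.sum_add_distrib]
  refine Finset.sum_congr rfl fun e _ => ?_
  have h1 : s e ∈ A → s e ∉ B := fun h' => Finset.disjoint_left.1 h h'
  have h2 : t e ∈ A → t e ∉ B := fun h' => Finset.disjoint_left.1 h h'
  by_cases a1 : s e ∈ A <;> by_cases a2 : t e ∈ A <;> by_cases a3 : s e ∈ B <;>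
    by_cases a4 : t e ∈ B <;> simp_all <;> ring

variable {s t}

theorem cutL_nonneg {x : E → ℝ} (hx : ∀ e, 0 ≤ x e) (U : Finset V) : 0 ≤ cutL s t U x := by
  rw [cutL_apply]
  exact Finset.sum_nonneg fun e _ => mul_nonneg (by split_ifs <;> norm_num) (hx e)

theorem cutL_mono {x y : E → ℝ} (h : ∀ e, x e ≤ y e) (U : Finset V) :
    cutL s t U x ≤ cutL s t U y := by
  simp only [cutL_apply]
  exact Finset.sum_le_sum fun e _ =>
    mul_le_mul_of_nonneg_left (h e) (by split_ifs <;> norm_num)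

theorem btwL_nonneg {x : E → ℝ} (hx : ∀ e, 0 ≤ x e) (A B : Finset V) :
    0 ≤ btwL s t A B x := by
  rw [btwL_apply]
  exact Finset.sum_nonneg fun e _ =>
    mul_nonneg (by split_ifs <;> norm_num) (hx e)

theorem btwL_mono {x y : E → ℝ} (h : ∀ e, x e ≤ y e) (A B : Finset V) :
    btwL s t A B x ≤ btwL s t A B y := by
  simp only [btwL_apply]
  exact Finset.sum_le_sum fun e _ =>
    mul_le_mul_of_nonneg_left (h e) (by split_ifs <;> norm_num)

theorem degL_nonneg {x : E → ℝ} (hx : ∀ e, 0 ≤ x e) (w : V) : 0 ≤ degL s t w x := by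
  rw [degL_apply]
  exact Finset.sum_nonneg fun e _ =>
    mul_nonneg (by split_ifs <;> norm_num) (hx e)

theorem cutL_congr {x y : E → ℝ} {U : Finset V}
    (h : ∀ e, ¬ (s e ∈ U ↔ t e ∈ U) → x e = y e) : cutL s t U x = cutL s t U y := by
  simp only [cutL_apply]
  refine Finset.sum_congr rfl fun e _ => ?_
  by_cases hc : (s e ∈ U ↔ t e ∈ U)
  · simp [hc]
  · rw [h e hc]

theorem degL_congr {x y : E → ℝ} {w : V}
    (h : ∀ e, s e = w ∨ t e = w → x e = y e) : degL s t w x = degL s t w y := by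
  simp only [degL_apply]
  refine Finset.sum_congr rfl fun e _ => ?_
  by_cases h1 : s e = w
  · rw [h e (.inl h1)]
  · by_cases h2 : t e = w
    · rw [h e (.inr h2)]
    · simp [h1, h2]

theorem btwL_eq_zero {x : E → ℝ} {A B : Finset V}
    (h : ∀ e, (s e ∈ A ∧ t e ∈ B) ∨ (s e ∈ B ∧ t e ∈ A) → x e = 0) : btwL s t A B x = 0 := by
  rw [btwL_apply]
  refine Finset.sum_eq_zero fun e _ => ?_
  by_cases h1 : (s e ∈ A ∧ t e ∈ B) ∨ (s e ∈ B ∧ t e ∈ A)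
  · simp [h e h1]
  · rw [not_or] at h1
    simp [h1.1, h1.2]

theorem eq_zero_of_btwL_eq_zero {x : E → ℝ} (hx : ∀ e, 0 ≤ x e) {A B : Finset V}
    (h : btwL s t A B x = 0) (e : E) (he : (s e ∈ A ∧ t e ∈ B) ∨ (s e ∈ B ∧ t e ∈ A)) :
    x e = 0 := by
  rw [btwL_apply, Finset.sum_eq_zero_iff_of_nonneg
    fun e _ => mul_nonneg (by split_ifs <;> norm_num) (hx e)] at h
  have := h e (Finset.mem_univ _)
  rcases mul_eq_zero.1 this with h0 | h0
  · exfalso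
    rcases he with he | he
    · rw [if_pos he] at h0
      split_ifs at h0 <;> linarith
    · rw [if_pos he] at h0
      split_ifs at h0 <;> linarith
  · exact h0

theorem le_degL {x : E → ℝ} (hx : ∀ e, 0 ≤ x e) {w : V} {e : E} (he : s e = w ∨ t e = w) :
    x e ≤ degL s t w x := by
  rw [degL_apply]
  refine le_trans ?_ (Finset.single_le_sum
    (f := fun e => ((if s e = w then (1 : ℝ) else 0) + (if t e = w then 1 else 0)) * x e)
    (fun e _ => mul_nonneg (by split_ifs <;> norm_num) (hx e)) (Finset.mem_univ e))
  have := hx e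
  rcases he with he | he <;> simp only [he, if_true] <;> split_ifs <;> linarith

theorem cutL_singleton_le {x : E → ℝ} (hx : ∀ e, 0 ≤ x e) (w : V) :
    cutL s t {w} x ≤ degL s t w x := by
  have h := sum_degL s t {w} x
  have h1 := btwL_nonneg (s := s) (t := t) hx {w} {w}
  rw [Finset.sum_singleton] at h
  linarith

theorem cutL_singleton (hl : ∀ e, s e ≠ t e) (w : V) (x : E → ℝ) :
    cutL s t {w} x = degL s t w x := by
  have h := sum_degL s t {w} x
  rw [Finset.sum_singleton, btwL_eq_zero (A := {w}) (B := {w}), zero_add] at h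
  · exact h.symm
  · intro e he
    simp only [Finset.mem_singleton] at he
    exact absurd (by aesop) (hl e)

variable (s t)

/-- `M` is a perfect matching. -/
def IsPM (M : Finset E) : Prop := ∀ w, degL s t w (ind M) = 1

/-- Membership in Edmonds' description of the perfect matching polytope. -/
structure InQ (x : E → ℝ) : Prop where
  nonneg : ∀ e, 0 ≤ x e
  deg : ∀ w, degL s t w x = 1
  cut : ∀ U : Finset V, Odd U.card → 1 ≤ cutL s t U x

variable {s t}

theorem ind_nonneg (M : Finset E) (e : E) : 0 ≤ ind M e := by
  unfold ind; split_ifs <;> norm_num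

theorem sum_mul_ind (M : Finset E) (w : E → ℝ) : ∑ e, w e * ind M e = ∑ e ∈ M, w e := by
  simp [ind]

theorem InQ.even_card {x : E → ℝ} (hx : InQ s t x) : Even (Fintype.card V) := by
  by_contra h
  have := hx.cut Finset.univ (by rwa [Finset.card_univ, ← Nat.not_even_iff_odd])
  rw [cutL_univ] at this
  norm_num at this

theorem InQ.odd_compl {x : E → ℝ} (hx : InQ s t x) {U : Finset V} (hU : Odd U.card) :
    Odd Uᶜ.card := by
  have h := hx.even_card
  have h1 := Finset.card_add_card_compl U
  rcases h with ⟨a, ha⟩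
  rcases hU with ⟨b, hb⟩
  exact ⟨a - b - 1, by omega⟩

end Basic

section Contraction

variable {V W E : Type} [Fintype V] [Fintype W] [Fintype E] {s t : E → V} {π : V → W}

/-- `π` identifies the vertices of `C` with each other and nothing else. -/
structure Collapses (π : V → W) (C : Finset V) : Prop where
  surj : Function.Surjective π
  eq_iff : ∀ a b, π a = π b ↔ a = b ∨ (a ∈ C ∧ b ∈ C)

theorem exists_collapses (C : Finset V) :
    ∃ (W : Type) (_ : Fintype W) (π : V → W), Collapses π C := by
  let r : Setoid V :=
    { r := fun a b => a = b ∨ (a ∈ C ∧ b ∈ C)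
      iseqv :=
        { refl := fun a => .inl rfl
          symm := by aesop
          trans := by aesop } }
  exact ⟨Quotient r, inferInstance, Quotient.mk r, Quotient.mk_surjective, fun a b => Quotient.eq⟩

theorem Collapses.mem_iff {C : Finset V} (h : Collapses π C) {c : V} (hc : c ∈ C) (a : V) :
    π a = π c ↔ a ∈ C := by
  rw [h.eq_iff]
  constructor
  · rintro (rfl | h)
    exacts [hc, h.1]
  · exact fun h => .inr ⟨h, hc⟩

theorem Collapses.eq_iff_of_notMem {C : Finset V} (h : Collapses π C) {c : V} (hc : c ∉ C)
    (a : V) : π a = π c ↔ a = c := by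
  rw [h.eq_iff]
  simp [hc]

theorem Collapses.card_lt {C : Finset V} (h : Collapses π C) (hC : 1 < C.card) :
    Fintype.card W < Fintype.card V := by
  apply Fintype.card_lt_of_surjective_not_injective π h.surj
  obtain ⟨a, ha, b, hb, hab⟩ := Finset.one_lt_card.1 hC
  exact fun hi => hab (hi ((h.eq_iff a b).2 (.inr ⟨ha, hb⟩)))

theorem Collapses.odd_card {C : Finset V} (h : Collapses π C) (hC : Odd C.card)
    {U : Finset W} (hU : Odd U.card) : Odd (Finset.univ.filter (fun a => π a ∈ U)).card := by
  rw [Finset.card_eq_sum_card_fiberwise (f := π) (t := U) (fun a ha => by simpa using ha),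
    Finset.odd_sum_iff_odd_card_odd]
  convert hU using 2
  rw [Finset.filter_eq_self]
  intro w hw
  obtain ⟨c, rfl⟩ := h.surj w
  by_cases hc : c ∈ C
  · convert hC using 2
    ext a
    simp only [Finset.mem_filter, Finset.mem_univ, true_and, h.mem_iff hc]
    exact ⟨fun h => h.2, fun ha => ⟨by rwa [(h.mem_iff hc a).2 ha], ha⟩⟩
  · convert odd_one
    rw [Finset.card_eq_one]
    refine ⟨c, ?_⟩
    ext a
    simp only [Finset.mem_filter, Finset.mem_univ, true_and, h.eq_iff_of_notMem hc,
      Finset.mem_singleton]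
    exact ⟨fun h => h.2, fun ha => ⟨by rwa [ha], ha⟩⟩

/-- The weight `x` with the edges inside `C` removed. -/
def outside (s t : E → V) (C : Finset V) (x : E → ℝ) : E → ℝ :=
  fun e => if s e ∈ C ∧ t e ∈ C then 0 else x e

theorem Collapses.degL_mem {C : Finset V} (h : Collapses π C) {c : V} (hc : c ∈ C)
    (x : E → ℝ) : degL (π ∘ s) (π ∘ t) (π c) (outside s t C x) = cutL s t C x := by
  simp only [degL_apply, cutL_apply, outside, Function.comp, h.mem_iff hc]
  refine Finset.sum_congr rfl fun e _ => ?_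
  by_cases h1 : s e ∈ C <;> by_cases h2 : t e ∈ C <;> simp [h1, h2]

theorem Collapses.degL_notMem {C : Finset V} (h : Collapses π C) {c : V} (hc : c ∉ C)
    (x : E → ℝ) : degL (π ∘ s) (π ∘ t) (π c) (outside s t C x) = degL s t c x := by
  simp only [degL_apply, outside, Function.comp, h.eq_iff_of_notMem hc]
  refine Finset.sum_congr rfl fun e _ => ?_
  by_cases h1 : s e ∈ C ∧ t e ∈ C
  · have h2 : s e ≠ c := fun h => hc (h ▸ h1.1)
    have h3 : t e ≠ c := fun h => hc (h ▸ h1.2)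
    simp [h2, h3]
  · simp [h1]

theorem Collapses.cutL_eq {C : Finset V} (h : Collapses π C) (U : Finset W)
    (x : E → ℝ) : cutL (π ∘ s) (π ∘ t) U (outside s t C x) =
      cutL s t (Finset.univ.filter (fun a => π a ∈ U)) x := by
  simp only [cutL_apply, outside, Function.comp, Finset.mem_filter, Finset.mem_univ, true_and]
  refine Finset.sum_congr rfl fun e _ => ?_
  by_cases h1 : s e ∈ C ∧ t e ∈ C
  · have := (h.eq_iff (s e) (t e)).2 (.inr h1)
    simp [this]
  · simp [h1]

theorem Collapses.inQ {C : Finset V} (h : Collapses π C) (hC : Odd C.card) {x : E → ℝ}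
    (hx : InQ s t x) (hcut : cutL s t C x = 1) : InQ (π ∘ s) (π ∘ t) (outside s t C x) where
  nonneg e := by
    unfold outside
    split_ifs
    exacts [le_rfl, hx.nonneg e]
  deg w := by
    obtain ⟨c, rfl⟩ := h.surj w
    by_cases hc : c ∈ C
    · rw [h.degL_mem hc, hcut]
    · rw [h.degL_notMem hc, hx.deg]
  cut U hU := by
    rw [h.cutL_eq]
    exact hx.cut _ (h.odd_card hC hU)

theorem cutL_ind (M : Finset E) (U : Finset V) :
    cutL s t U (ind M) = ((M.filter fun e => ¬ (s e ∈ U ↔ t e ∈ U)).card : ℝ) := by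
  rw [cutL_apply, Finset.card_eq_sum_ones, Nat.cast_sum, Finset.sum_filter]
  simp only [ind, mul_ite, mul_one, mul_zero, Finset.sum_ite_mem, Finset.univ_inter]
  refine Finset.sum_congr rfl fun e _ => ?_
  by_cases h : (s e ∈ U ↔ t e ∈ U) <;> simp [h]

theorem Collapses.isPM {C : Finset V} (h : Collapses π C) (hC : C.Nonempty) {x : E → ℝ}
    {M : Finset E} (hM : IsPM (π ∘ s) (π ∘ t) M) (hs : ∀ e ∈ M, outside s t C x e ≠ 0) :
    (∃ f, (M.filter fun e => ¬ (s e ∈ C ↔ t e ∈ C)) = {f}) ∧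
      (∀ a ∉ C, degL s t a (ind M) = 1) ∧
      ∀ e ∈ M, ¬ (s e ∈ C ∧ t e ∈ C) ∧ x e ≠ 0 := by
  have h1 : ∀ e ∈ M, ¬ (s e ∈ C ∧ t e ∈ C) ∧ x e ≠ 0 := by
    intro e he
    have := hs e he
    unfold outside at this
    split_ifs at this with h2
    · exact absurd rfl this
    · exact ⟨h2, this⟩
  have h2 : outside s t C (ind M) = ind M := by
    ext e
    unfold outside ind
    by_cases he : e ∈ M
    · simp [(h1 e he).1]
    · simp [he]
  refine ⟨?_, ?_, h1⟩
  · obtain ⟨c, hc⟩ := hC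
    have := hM (π c)
    rw [← h2, h.degL_mem hc, cutL_ind] at this
    exact Finset.card_eq_one.1 (by exact_mod_cast this)
  · intro a ha
    rw [← h.degL_notMem ha, h2]
    exact hM _

end Contraction

section Spans

variable {V V₁ V₂ E : Type} [Fintype V] [Fintype V₁] [Fintype V₂] [Fintype E]

/-- The perfect matchings in the support of `x` span `x`, in dual form. -/
def Spans (s t : E → V) (x : E → ℝ) : Prop :=
  ∀ w : E → ℝ, (∀ M, IsPM s t M → (∀ e ∈ M, x e ≠ 0) → ∑ e ∈ M, w e = 0) →
    ∑ e, w e * x e = 0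

variable {s t : E → V}

theorem Spans.exists_mem {x : E → ℝ} (h : Spans s t x) {f : E} (hf : x f ≠ 0) :
    ∃ M, IsPM s t M ∧ (∀ e ∈ M, x e ≠ 0) ∧ f ∈ M := by
  by_contra! hc
  have := h (fun e => if e = f then 1 else 0) fun M hM hs => by
    rw [Finset.sum_ite_eq', if_neg (hc M hM hs)]
  simp at this
  exact hf this

theorem isPM_union {U : Finset V} {M₁ M₂ : Finset E} {f : E}
    (hd₁ : ∀ a ∈ U, degL s t a (ind M₁) = 1) (hd₂ : ∀ a ∉ U, degL s t a (ind M₂) = 1)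
    (h₁ : ∀ e ∈ M₁, ¬ (s e ∉ U ∧ t e ∉ U)) (h₂ : ∀ e ∈ M₂, ¬ (s e ∈ U ∧ t e ∈ U))
    (hf₁ : (M₁.filter fun e => ¬ (s e ∈ U ↔ t e ∈ U)) = {f})
    (hf₂ : (M₂.filter fun e => ¬ (s e ∈ U ↔ t e ∈ U)) = {f}) :
    IsPM s t (M₁ ∪ M₂) ∧ M₁ ∩ M₂ = {f} := by
  have g₁ : ∀ e, (e ∈ M₁ ∧ ¬ (s e ∈ U ↔ t e ∈ U)) ↔ e = f := fun e => by
    rw [← Finset.mem_filter (p := fun e => ¬ (s e ∈ U ↔ t e ∈ U)), hf₁, Finset.mem_singleton]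
  have g₂ : ∀ e, (e ∈ M₂ ∧ ¬ (s e ∈ U ↔ t e ∈ U)) ↔ e = f := fun e => by
    rw [← Finset.mem_filter (p := fun e => ¬ (s e ∈ U ↔ t e ∈ U)), hf₂, Finset.mem_singleton]
  have f₁ := (g₁ f).2 rfl
  have f₂ := (g₂ f).2 rfl
  constructor
  · intro a
    by_cases ha : a ∈ U
    · rw [← hd₁ a ha]
      refine degL_congr fun e he => ?_
      have : e ∈ M₁ ∪ M₂ ↔ e ∈ M₁ := by
        rw [Finset.mem_union, or_iff_left_iff_imp]
        intro h2
        have := h₂ e h2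
        have hc : ¬ (s e ∈ U ↔ t e ∈ U) := by
          rcases he with he | he <;> rw [he] at this ⊢ <;> tauto
        rw [(g₂ e).1 ⟨h2, hc⟩]
        exact f₁.1
      simp only [ind, this]
    · rw [← hd₂ a ha]
      refine degL_congr fun e he => ?_
      have : e ∈ M₁ ∪ M₂ ↔ e ∈ M₂ := by
        rw [Finset.mem_union, or_iff_right_iff_imp]
        intro h2
        have := h₁ e h2
        have hc : ¬ (s e ∈ U ↔ t e ∈ U) := by
          rcases he with he | he <;> rw [he] at this ⊢ <;> tauto
        rw [(g₁ e).1 ⟨h2, hc⟩]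
        exact f₂.1
      simp only [ind, this]
  · ext e
    rw [Finset.mem_inter, Finset.mem_singleton]
    constructor
    · rintro ⟨h1, h2⟩
      have := h₁ e h1
      have := h₂ e h2
      exact (g₁ e).1 ⟨h1, by tauto⟩
    · rintro rfl
      exact ⟨f₁.1, f₂.1⟩

theorem Spans.of_collapses {x : E → ℝ} {U : Finset V} (hU : U.Nonempty) (hU' : Uᶜ.Nonempty)
    {π₁ : V → V₁} {π₂ : V → V₂} (h₁ : Collapses π₁ Uᶜ) (h₂ : Collapses π₂ U)
    (hs₁ : Spans (π₁ ∘ s) (π₁ ∘ t) (outside s t Uᶜ x))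
    (hs₂ : Spans (π₂ ∘ s) (π₂ ∘ t) (outside s t U x)) : Spans s t x := by
  intro w hw
  set P₁ : Finset E → Prop := fun M => IsPM (π₁ ∘ s) (π₁ ∘ t) M ∧ ∀ e ∈ M, outside s t Uᶜ x e ≠ 0
    with hP₁
  set P₂ : Finset E → Prop := fun M => IsPM (π₂ ∘ s) (π₂ ∘ t) M ∧ ∀ e ∈ M, outside s t U x e ≠ 0
    with hP₂
  have hout : ∀ f, x f ≠ 0 → ¬ (s f ∈ U ↔ t f ∈ U) →
      outside s t Uᶜ x f ≠ 0 ∧ outside s t U x f ≠ 0 := by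
    intro f hf hc
    constructor <;> unfold outside <;> rw [if_neg] <;> (try simp only [Finset.mem_compl]) <;> tauto
  have key : ∀ f M₁ M₂, ¬ (s f ∈ U ↔ t f ∈ U) → P₁ M₁ → P₂ M₂ → f ∈ M₁ → f ∈ M₂ →
      ∑ e ∈ M₁, w e + ∑ e ∈ M₂, w e = w f := by
    intro f M₁ M₂ hc hM₁ hM₂ hf₁ hf₂
    obtain ⟨⟨f₁, a₁⟩, b₁, c₁⟩ := h₁.isPM hU' hM₁.1 hM₁.2
    obtain ⟨⟨f₂, a₂⟩, b₂, c₂⟩ := h₂.isPM hU hM₂.1 hM₂.2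
    simp only [Finset.mem_compl, not_iff_not, not_not] at a₁ b₁ c₁
    have e₁ : f = f₁ := by
      rw [← Finset.mem_singleton, ← a₁, Finset.mem_filter]; exact ⟨hf₁, hc⟩
    have e₂ : f = f₂ := by
      rw [← Finset.mem_singleton, ← a₂, Finset.mem_filter]; exact ⟨hf₂, hc⟩
    rw [← e₁] at a₁
    rw [← e₂] at a₂
    obtain ⟨hM, hi⟩ := isPM_union b₁ b₂ (fun e he => (c₁ e he).1) (fun e he => (c₂ e he).1) a₁ a₂
    have h0 := hw _ hM fun e he => by
      rcases Finset.mem_union.1 he with he | he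
      exacts [(c₁ e he).2, (c₂ e he).2]
    rw [← Finset.sum_union_inter, hi, h0]
    simp
  have ex₁ : ∀ f, ∃ b : ℝ, x f ≠ 0 → ¬ (s f ∈ U ↔ t f ∈ U) →
      (∀ M, P₁ M → f ∈ M → ∑ e ∈ M, w e = b) ∧ (∀ M, P₂ M → f ∈ M → ∑ e ∈ M, w e = w f - b) := by
    intro f
    by_cases hf : x f ≠ 0 ∧ ¬ (s f ∈ U ↔ t f ∈ U)
    · obtain ⟨o₁, o₂⟩ := hout f hf.1 hf.2
      obtain ⟨M₁, p₁, q₁, r₁⟩ := hs₁.exists_mem o₁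
      obtain ⟨M₂, p₂, q₂, r₂⟩ := hs₂.exists_mem o₂
      have k := key f M₁ M₂ hf.2 ⟨p₁, q₁⟩ ⟨p₂, q₂⟩ r₁ r₂
      refine ⟨∑ e ∈ M₁, w e, fun _ _ => ⟨fun M hM hm => ?_, fun M hM hm => ?_⟩⟩
      · have := key f M M₂ hf.2 hM ⟨p₂, q₂⟩ hm r₂
        linarith
      · have := key f M₁ M hf.2 ⟨p₁, q₁⟩ hM r₁ hm
        linarith
    · exact ⟨0, fun h1 h2 => absurd ⟨h1, h2⟩ hf⟩
  choose β hβ using ex₁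
  have r₁ := hs₁ (fun e => if s e ∈ U ∧ t e ∈ U then w e else
      if s e ∉ U ∧ t e ∉ U then 0 else w e - β e) fun M hM hs => by
    obtain ⟨⟨f, a⟩, -, c⟩ := h₁.isPM hU' hM hs
    simp only [Finset.mem_compl, not_iff_not] at a c
    have g : ∀ e, (e ∈ M ∧ ¬ (s e ∈ U ↔ t e ∈ U)) ↔ e = f := fun e => by
      rw [← Finset.mem_filter (p := fun e => ¬ (s e ∈ U ↔ t e ∈ U)), a, Finset.mem_singleton]
    have hf := (g f).2 rfl
    have hb := (hβ f (c f hf.1).2 hf.2).1 M ⟨hM, hs⟩ hf.1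
    have : ∑ e ∈ M, (if s e ∈ U ∧ t e ∈ U then w e else
        if s e ∉ U ∧ t e ∉ U then 0 else w e - β e) =
        ∑ e ∈ M, (w e - if e = f then β e else 0) := by
      refine Finset.sum_congr rfl fun e he => ?_
      have h1 := (c e he).1
      have h2 := g e
      by_cases h3 : s e ∈ U ∧ t e ∈ U
      · rw [if_pos h3, if_neg, sub_zero]
        rw [← h2]
        tauto
      · rw [if_neg h3, if_neg h1, if_pos]
        rw [← h2]
        exact ⟨he, by tauto⟩
    rw [this, Finset.sum_sub_distrib, Finset.sum_ite_eq', if_pos hf.1, hb, sub_self]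
  have r₂ := hs₂ (fun e => if s e ∈ U ∧ t e ∈ U then 0 else
      if s e ∉ U ∧ t e ∉ U then w e else β e) fun M hM hs => by
    obtain ⟨⟨f, a⟩, -, c⟩ := h₂.isPM hU hM hs
    have g : ∀ e, (e ∈ M ∧ ¬ (s e ∈ U ↔ t e ∈ U)) ↔ e = f := fun e => by
      rw [← Finset.mem_filter (p := fun e => ¬ (s e ∈ U ↔ t e ∈ U)), a, Finset.mem_singleton]
    have hf := (g f).2 rfl
    have hb := (hβ f (c f hf.1).2 hf.2).2 M ⟨hM, hs⟩ hf.1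
    have : ∑ e ∈ M, (if s e ∈ U ∧ t e ∈ U then 0 else
        if s e ∉ U ∧ t e ∉ U then w e else β e) =
        ∑ e ∈ M, (w e - if e = f then w e - β e else 0) := by
      refine Finset.sum_congr rfl fun e he => ?_
      have h1 := (c e he).1
      have h2 := g e
      rw [if_neg h1]
      by_cases h3 : s e ∉ U ∧ t e ∉ U
      · rw [if_pos h3, if_neg, sub_zero]
        rw [← h2]
        tauto
      · rw [if_neg h3, if_pos, sub_sub_cancel]
        rw [← h2]
        exact ⟨he, by tauto⟩
    rw [this, Finset.sum_sub_distrib, Finset.sum_ite_eq', if_pos hf.1, hb, sub_self]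
  have hsum := congrArg₂ (· + ·) r₁ r₂
  simp only [add_zero, ← Finset.sum_add_distrib] at hsum
  rw [← hsum]
  refine Finset.sum_congr rfl fun e _ => ?_
  simp only [outside, Finset.mem_compl]
  by_cases a₁ : s e ∈ U <;> by_cases a₂ : t e ∈ U <;> simp [a₁, a₂] <;> ring

end Spans

section Tutte

variable {V E : Type} [Fintype V] [Fintype E] {s t : E → V}

/-- The simple graph formed by the non-loop edges of nonzero weight. -/
def supportGraph (s t : E → V) (x : E → ℝ) : SimpleGraph V where
  Adj a b := a ≠ b ∧ ∃ e, x e ≠ 0 ∧ ((s e = a ∧ t e = b) ∨ (s e = b ∧ t e = a))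
  symm := ⟨fun a b h => ⟨h.1.symm, by
    obtain ⟨e, h1, h2⟩ := h.2
    exact ⟨e, h1, h2.symm⟩⟩⟩
  loopless := ⟨fun a h => h.1 rfl⟩

theorem InQ.not_isTutteViolator {x : E → ℝ} (hx : InQ s t x) (u : Set V) :
    ¬ (supportGraph s t x).IsTutteViolator u := by
  intro hv
  unfold SimpleGraph.IsTutteViolator at hv
  set K := ((⊤ : (supportGraph s t x).Subgraph).deleteVerts u).coe with hK
  let comp : K.ConnectedComponent → Finset V := fun c =>
    Finset.univ.filter fun a => ∃ h, K.connectedComponentMk ⟨a, h⟩ = c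
  have hcomp : ∀ a c, a ∈ comp c ↔ ∃ h, K.connectedComponentMk ⟨a, h⟩ = c := by
    intro a c
    simp [comp]
  have hcard : ∀ c, (comp c).card = c.supp.ncard := by
    intro c
    rw [← Set.ncard_image_of_injective c.supp Subtype.val_injective, ← Set.ncard_coe_finset]
    congr 1
    ext a
    simp only [Finset.mem_coe, hcomp, Set.mem_image, SimpleGraph.ConnectedComponent.mem_supp_iff,
      Subtype.exists, exists_and_right, exists_eq_right]
  have hnot : ∀ a c, a ∈ comp c → a ∉ u := by
    intro a c h
    obtain ⟨h, -⟩ := (hcomp a c).1 h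
    simpa using h
  have huniq : ∀ a c c', a ∈ comp c → a ∈ comp c' → c = c' := by
    intro a c c' h h'
    obtain ⟨_, h⟩ := (hcomp a c).1 h
    obtain ⟨_, h'⟩ := (hcomp a c').1 h'
    rw [← h, ← h']
  have hadj : ∀ e, x e ≠ 0 → s e ∉ u → t e ∉ u → ∀ c, s e ∈ comp c ↔ t e ∈ comp c := by
    intro e he h1 h2 c
    by_cases hst : s e = t e
    · rw [hst]
    have m1 : s e ∈ ((⊤ : (supportGraph s t x).Subgraph).deleteVerts u).verts := by simpa using h1
    have m2 : t e ∈ ((⊤ : (supportGraph s t x).Subgraph).deleteVerts u).verts := by simpa using h2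
    have : K.Adj ⟨s e, m1⟩ ⟨t e, m2⟩ := by
      simp only [hK, SimpleGraph.Subgraph.coe_adj, SimpleGraph.Subgraph.deleteVerts_adj]
      exact ⟨trivial, h1, trivial, h2, hst, e, he, .inl ⟨rfl, rfl⟩⟩
    have := SimpleGraph.ConnectedComponent.connectedComponentMk_eq_of_adj this
    rw [hcomp, hcomp]
    exact ⟨fun ⟨_, h⟩ => ⟨m2, by rw [← this, h]⟩, fun ⟨_, h⟩ => ⟨m1, by rw [this, h]⟩⟩
  have hone : ∀ (O : Finset K.ConnectedComponent) a,
      ∑ c ∈ O, (if a ∈ comp c then (1 : ℝ) else 0) ≤ 1 := by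
    intro O a
    rw [Finset.sum_boole]
    have : (O.filter fun c => a ∈ comp c).card ≤ 1 := by
      rw [Finset.card_le_one]
      intro c hc c' hc'
      exact huniq a c c' (Finset.mem_filter.1 hc).2 (Finset.mem_filter.1 hc').2
    exact_mod_cast this
  set O : Finset K.ConnectedComponent := K.oddComponents.toFinset with hO
  have h1 : (O.card : ℝ) ≤ ∑ c ∈ O, cutL s t (comp c) x := by
    rw [Finset.card_eq_sum_ones, Nat.cast_sum]
    refine Finset.sum_le_sum fun c hc => ?_
    rw [Nat.cast_one]
    apply hx.cut
    rw [hcard]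
    simpa [hO, SimpleGraph.oddComponents] using hc
  have h2 : ∑ c ∈ O, cutL s t (comp c) x ≤ ∑ w ∈ u.toFinset, degL s t w x := by
    simp only [cutL_apply, degL_apply]
    rw [Finset.sum_comm, Finset.sum_comm (s := u.toFinset)]
    refine Finset.sum_le_sum fun e _ => ?_
    rw [← Finset.sum_mul, ← Finset.sum_mul]
    by_cases he : x e = 0
    · simp [he]
    refine mul_le_mul_of_nonneg_right ?_ (hx.nonneg e)
    rw [Finset.sum_add_distrib, Finset.sum_ite_eq, Finset.sum_ite_eq]
    simp only [Set.mem_toFinset]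
    by_cases hs : s e ∈ u
    · refine le_trans (le_trans (Finset.sum_le_sum fun c _ => ?_) (hone O (t e))) ?_
      · have : s e ∉ comp c := fun h => hnot _ _ h hs
        by_cases h : t e ∈ comp c <;> simp [this, h]
      · rw [if_pos hs]; split_ifs <;> norm_num
    · by_cases ht : t e ∈ u
      · refine le_trans (le_trans (Finset.sum_le_sum fun c _ => ?_) (hone O (s e))) ?_
        · have : t e ∉ comp c := fun h => hnot _ _ h ht
          by_cases h : s e ∈ comp c <;> simp [this, h]
        · rw [if_pos ht, if_neg hs]; norm_num
      · rw [if_neg hs, if_neg ht, Finset.sum_eq_zero]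
        · norm_num
        · intro c _
          rw [if_pos (hadj e he hs ht c)]
  have h3 : ∑ w ∈ u.toFinset, degL s t w x = u.ncard := by
    rw [Finset.sum_congr rfl fun w _ => hx.deg w, Finset.sum_const, nsmul_one,
      Set.ncard_eq_toFinset_card']
  rw [Set.ncard_eq_toFinset_card' (s := K.oddComponents)] at hv
  rw [h3] at h2
  have : O.card ≤ u.ncard := by exact_mod_cast h1.trans h2
  exact absurd hv (not_lt.2 this)

theorem InQ.exists_isPM {x : E → ℝ} (hx : InQ s t x) :
    ∃ M, IsPM s t M ∧ ∀ e ∈ M, x e ≠ 0 := by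
  obtain ⟨N, hN⟩ := SimpleGraph.tutte.2 hx.not_isTutteViolator
  rw [SimpleGraph.Subgraph.isPerfectMatching_iff] at hN
  have hadj : ∀ a b, N.Adj a b → a ≠ b ∧ ∃ e, x e ≠ 0 ∧
      ((s e = a ∧ t e = b) ∨ (s e = b ∧ t e = a)) := fun a b h => h.adj_sub
  have hg : ∀ z : Sym2 V, ∃ f : E, z ∈ N.edgeSet → x f ≠ 0 ∧ s(s f, t f) = z := by
    intro z
    by_cases hz : z ∈ N.edgeSet
    · induction z with
      | h a b =>
        obtain ⟨-, e, h1, h2⟩ := hadj a b hz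
        refine ⟨e, fun _ => ⟨h1, ?_⟩⟩
        rcases h2 with ⟨rfl, rfl⟩ | ⟨rfl, rfl⟩
        exacts [rfl, Sym2.eq_swap]
    · have : Nonempty E := by
        by_contra hE
        rw [not_nonempty_iff] at hE
        induction z with
        | h a b =>
          have := hx.deg a
          rw [degL_apply] at this
          simp at this
      exact ⟨Classical.arbitrary E, fun h => absurd h hz⟩
  choose g hg using hg
  refine ⟨Finset.univ.filter fun e => s(s e, t e) ∈ N.edgeSet ∧ g s(s e, t e) = e, fun a => ?_,
    fun e he => ?_⟩
  · obtain ⟨b, hab, hb⟩ := hN a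
    have hne := (hadj a b hab).1
    have hf := hg s(a, b) hab
    set f := g s(a, b) with hf'
    have hfM : s(s f, t f) ∈ N.edgeSet ∧ g s(s f, t f) = f := by
      rw [hf.2]
      exact ⟨hab, rfl⟩
    rw [degL_apply, Finset.sum_eq_single f]
    · simp only [ind, Finset.mem_filter, Finset.mem_univ, hfM, and_self, if_true, mul_one]
      have h2 := hf.2
      rw [Sym2.eq_iff] at h2
      rcases h2 with ⟨h1, h2⟩ | ⟨h1, h2⟩ <;> simp [h1, h2, hne.symm]
    · intro e _ hef
      by_cases he : s(s e, t e) ∈ N.edgeSet ∧ g s(s e, t e) = e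
      · have h1 : s e ≠ a := by
          intro h
          have h2 := he.1
          rw [h, SimpleGraph.Subgraph.mem_edgeSet] at h2
          have := hb _ h2
          apply hef
          rw [← he.2, h, this]
        have h2 : t e ≠ a := by
          intro h
          have h2 := he.1
          rw [h, SimpleGraph.Subgraph.mem_edgeSet] at h2
          have := hb _ h2.symm
          apply hef
          rw [← he.2, h, this, Sym2.eq_swap]
        simp [h1, h2]
      · refine mul_eq_zero_of_right _ (if_neg ?_)
        rw [Finset.mem_filter]
        exact fun h => he h.2
    · simp
  · rw [Finset.mem_filter] at he
    rw [← he.2.2]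
    exact (hg _ he.2.1).1

theorem exists_max_step {ι : Type} [Fintype ι] (a b : ι → ℝ) (ha : ∀ i, 0 ≤ a i) :
    ∃ ε : ℝ, 0 ≤ ε ∧ ε ≤ 1 ∧ (∀ i, 0 ≤ a i - ε * b i) ∧
      (ε = 1 ∨ ∃ i, a i - ε * b i = 0 ∧ 0 < b i) := by
  by_cases h : ∃ i, a i < b i
  · obtain ⟨j, hj, hmin⟩ := Finset.exists_min_image (Finset.univ.filter fun i => a i < b i)
      (fun i => a i / b i) (by simpa [Finset.Nonempty] using h)
    rw [Finset.mem_filter] at hj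
    have hbj : 0 < b j := (ha j).trans_lt hj.2
    have hle : a j / b j ≤ 1 := (div_le_one hbj).2 hj.2.le
    have h0 : 0 ≤ a j / b j := div_nonneg (ha j) hbj.le
    refine ⟨a j / b j, h0, hle, fun i => ?_, .inr ⟨j, ?_, hbj⟩⟩
    · by_cases hi : a i < b i
      · have hbi : 0 < b i := (ha i).trans_lt hi
        have := hmin i (by simpa using hi)
        rw [le_div_iff₀ hbi] at this
        linarith
      · rcases le_total (b i) 0 with hb | hb
        · nlinarith [ha i]
        · nlinarith [ha i]
    · rw [div_mul_cancel₀ _ hbj.ne', sub_self]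
  · push Not at h
    exact ⟨1, zero_le_one, le_rfl, fun i => by linarith [h i], .inl rfl⟩

/-- Subtracting a multiple of a perfect matching until a constraint becomes tight. -/
theorem InQ.peel {x : E → ℝ} (hx : InQ s t x) :
    Spans s t x ∨ ∃ x', InQ s t x' ∧ (∀ e, x e = 0 → x' e = 0) ∧
      (Spans s t x' → Spans s t x) ∧
      ((∃ e, x e ≠ 0 ∧ x' e = 0) ∨
        ∃ U : Finset V, Odd U.card ∧ cutL s t U x' = 1 ∧ 1 < U.card ∧ 1 < Uᶜ.card) := by
  obtain ⟨M, hM, hMx⟩ := hx.exists_isPM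
  obtain ⟨ε, h0, h1, hc, ht⟩ := exists_max_step (ι := E ⊕ Finset V)
    (Sum.elim x fun U => if Odd U.card then cutL s t U x - 1 else 0)
    (Sum.elim (ind M) fun U => if Odd U.card then cutL s t U (ind M) - 1 else 0) (by
      rintro (e | U)
      · exact hx.nonneg e
      · simp only [Sum.elim_inr]
        split_ifs with h
        · linarith [hx.cut U h]
        · exact le_rfl)
  have hce : ∀ e, 0 ≤ x e - ε * ind M e := fun e => hc (.inl e)
  have hcU : ∀ U : Finset V, Odd U.card →
      0 ≤ cutL s t U x - 1 - ε * (cutL s t U (ind M) - 1) := by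
    intro U hU
    have := hc (.inr U)
    simpa only [Sum.elim_inr, if_pos hU] using this
  have hsupp : ∀ e, x e = 0 → ind M e = 0 := by
    intro e he
    unfold ind
    rw [if_neg fun h => hMx e h he]
  by_cases hε : ε = 1
  · left
    have heq : ∀ e, x e = ind M e := by
      intro e
      have hn : ∀ e, 0 ≤ (x - ind M) e := fun e => by
        have := hce e
        rw [hε, one_mul] at this
        simpa using this
      have := le_degL (s := s) (t := t) hn (w := s e) (e := e) (.inl rfl)
      rw [map_sub, hx.deg, hM, sub_self] at this
      have h2 := hn e
      simp only [Pi.sub_apply] at this h2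
      linarith
    intro w hw
    rw [Finset.sum_congr rfl fun e _ => by rw [heq e], sum_mul_ind]
    exact hw M hM hMx
  · right
    have hpos : 0 < 1 - ε := sub_pos.2 (lt_of_le_of_ne h1 hε)
    have hlin : ∀ L : (E → ℝ) →ₗ[ℝ] ℝ, L ((1 - ε)⁻¹ • (x - ε • ind M)) =
        (1 - ε)⁻¹ * (L x - ε * L (ind M)) := by
      intro L
      simp
    refine ⟨(1 - ε)⁻¹ • (x - ε • ind M), ⟨fun e => ?_, fun w => ?_, fun U hU => ?_⟩, ?_, ?_, ?_⟩
    · simpa using mul_nonneg (inv_nonneg.2 hpos.le) (hce e)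
    · rw [hlin, hx.deg, hM, mul_one, inv_mul_cancel₀ hpos.ne']
    · rw [hlin, le_inv_mul_iff₀ hpos]
      linarith [hcU U hU]
    · intro e he
      simp [he, hsupp e he]
    · intro h w hw
      have h2 := h w fun M' hM' hs => hw M' hM' fun e he hxe => hs e he (by simp [hxe, hsupp e hxe])
      have h3 : ∑ e, w e * ((1 - ε)⁻¹ • (x - ε • ind M)) e =
          (1 - ε)⁻¹ * (∑ e, w e * x e - ε * ∑ e, w e * ind M e) := by
        rw [Finset.mul_sum, ← Finset.sum_sub_distrib, Finset.mul_sum]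
        refine Finset.sum_congr rfl fun e _ => ?_
        simp
        ring
      rw [h3, sum_mul_ind, hw M hM hMx, mul_zero, sub_zero] at h2
      rcases mul_eq_zero.1 h2 with h2 | h2
      · exact absurd (inv_eq_zero.1 h2) hpos.ne'
      · exact h2
    · rcases ht with ht | ⟨e | U, h2, h3⟩
      · exact absurd ht hε
      · left
        simp only [Sum.elim_inl] at h2 h3
        refine ⟨e, fun h => ?_, ?_⟩
        · rw [hsupp e h] at h3
          exact lt_irrefl _ h3
        · simp [h2]
      · right
        simp only [Sum.elim_inr] at h2 h3
        split_ifs at h2 h3 with hU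
        · refine ⟨U, hU, ?_, ?_, ?_⟩
          · rw [hlin, inv_mul_eq_iff_eq_mul₀ hpos.ne']
            linarith
          · by_contra hle
            have : U.card = 1 := by
              have := hU.pos
              omega
            obtain ⟨w, rfl⟩ := Finset.card_eq_one.1 this
            have := cutL_singleton_le (s := s) (t := t) (ind_nonneg M) w
            rw [hM] at this
            linarith
          · by_contra hle
            have : Uᶜ.card = 1 := by
              have := (hx.odd_compl hU).pos
              omega
            obtain ⟨w, hw⟩ := Finset.card_eq_one.1 this
            have := cutL_singleton_le (s := s) (t := t) (ind_nonneg M) w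
            rw [hM, ← hw, cutL_compl] at this
            linarith
        · exact absurd h3 (lt_irrefl _)

end Tutte

/-- Edmonds' theorem, in the form that a point of the polytope lies in the linear span of
the perfect matchings contained in its support. -/
theorem InQ.spans {E : Type} [Fintype E] : ∀ (n : ℕ) {V : Type} [Fintype V] {s t : E → V}
    {x : E → ℝ}, Fintype.card V = n → InQ s t x → Spans s t x := by
  intro n
  induction n using Nat.strong_induction_on with
  | _ n ihn =>
    intro V _ s t x hV
    obtain ⟨k, hk⟩ : ∃ k, (Finset.univ.filter fun e => x e ≠ 0).card = k := ⟨_, rfl⟩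
    induction k using Nat.strong_induction_on generalizing x with
    | _ k ihk =>
      intro hx
      rcases hx.peel with h | ⟨x', hx', hz, hs, h | ⟨U, hU, hcut, hU1, hU2⟩⟩
      · exact h
      · obtain ⟨e, he, he'⟩ := h
        refine hs (ihk _ ?_ rfl hx')
        rw [← hk]
        apply Finset.card_lt_card
        rw [Finset.ssubset_iff_of_subset]
        · exact ⟨e, by simpa using he, by simpa using he'⟩
        · intro f
          simp only [Finset.mem_filter, Finset.mem_univ, true_and]
          exact mt (hz f)
      · obtain ⟨V₁, i₁, π₁, h₁⟩ := exists_collapses Uᶜ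
        obtain ⟨V₂, i₂, π₂, h₂⟩ := exists_collapses U
        refine hs (Spans.of_collapses (Finset.card_pos.1 (by omega)) (Finset.card_pos.1 (by omega))
          h₁ h₂ ?_ ?_)
        · refine ihn _ (hV ▸ h₁.card_lt hU2) rfl (h₁.inQ (hx'.odd_compl hU) hx' ?_)
          rw [cutL_compl, hcut]
        · exact ihn _ (hV ▸ h₂.card_lt hU1) rfl (h₂.inQ hU hx' hcut)

section Dimension

variable {V E : Type} [Fintype V] [Fintype E] {s t : E → V}

theorem exists_pos_step {ι : Type} [Fintype ι] (a b : ι → ℝ)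
    (h : ∀ i, 0 < a i ∨ (a i = 0 ∧ 0 ≤ b i)) :
    ∃ ε : ℝ, 0 < ε ∧ ε < 1 ∧ ∀ i, 0 ≤ a i + ε * b i ∧ (0 < a i → 0 < a i + ε * b i) := by
  have ha : ∀ i, 0 ≤ a i := fun i => by rcases h i with h | h <;> linarith [h]
  obtain ⟨ε, h0, h1, hc, ht⟩ := exists_max_step a (fun i => - b i) ha
  have hpos : 0 < ε := by
    rcases ht with rfl | ⟨i, h2, h3⟩
    · exact one_pos
    · rcases h i with h4 | h4
      · rcases h0.lt_or_eq with h5 | h5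
        · exact h5
        · rw [← h5] at h2
          linarith
      · linarith
  refine ⟨ε / 2, by linarith, by linarith, fun i => ⟨?_, fun hi => ?_⟩⟩ <;>
    linarith [hc i, ha i]

/-- The characteristic vectors of the perfect matchings avoiding `e₀` span every point
of the polytope that vanishes at `e₀`. -/
theorem InQ.mem_span {y : E → ℝ} (hy : InQ s t y) {e₀ : E} (h0 : y e₀ = 0) :
    y ∈ Submodule.span ℝ
      (Set.range fun M : {M : Finset E // IsPM s t M ∧ e₀ ∉ M} => ind M.1) := by
  by_contra hn
  obtain ⟨f, hf, hS⟩ := Submodule.exists_dual_map_eq_bot_of_notMem hn inferInstance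
  apply hf
  have hsum : ∀ z, f z = ∑ e, f (Pi.single e 1) * z e := by
    intro z
    rw [LinearMap.pi_apply_eq_sum_univ f z]
    refine Finset.sum_congr rfl fun e _ => ?_
    rw [smul_eq_mul, mul_comm]
    congr 2
    ext i
    simp [Pi.single_apply, eq_comm]
  rw [hsum]
  refine hy.spans _ rfl _ fun M hM hs => ?_
  rw [← sum_mul_ind, ← hsum]
  have hmem : f (ind M) ∈ Submodule.map f (Submodule.span ℝ
      (Set.range fun M : {M : Finset E // IsPM s t M ∧ e₀ ∉ M} => ind M.1)) :=
    Submodule.mem_map_of_mem (Submodule.subset_span ⟨⟨M, hM, fun h => hs _ h h0⟩, rfl⟩)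
  rw [hS] at hmem
  simpa using hmem

/-- If the tangent directions at a point of the polytope are cut out by the degree
constraints, the vanishing at `e₀` and one more functional, then there are many perfect
matchings avoiding `e₀`. -/
theorem InQ.card_le [Nonempty V] {x : E → ℝ} (hx : InQ s t x) {e₀ : E} (h0 : x e₀ = 0)
    (l : (E → ℝ) →ₗ[ℝ] ℝ)
    (hl : ∀ d : E → ℝ, (∀ w, degL s t w d = 0) → d e₀ = 0 → l d = 0 →
      (∀ e, x e = 0 → d e = 0) ∧
      ∀ U : Finset V, Odd U.card → cutL s t U x = 1 → cutL s t U d = 0) :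
    Fintype.card E ≤ Nat.card {M : Finset E // IsPM s t M ∧ e₀ ∉ M} + Fintype.card V + 1 := by
  set S := Submodule.span ℝ
    (Set.range fun M : {M : Finset E // IsPM s t M ∧ e₀ ∉ M} => ind M.1) with hS
  let Φ : (E → ℝ) →ₗ[ℝ] (Option (Option V) → ℝ) := LinearMap.pi fun o =>
    match o with
    | none => l
    | some none => LinearMap.proj e₀
    | some (some w) => degL s t w
  have hker : ∀ d, d ∈ LinearMap.ker Φ ↔ (∀ w, degL s t w d = 0) ∧ d e₀ = 0 ∧ l d = 0 := by
    intro d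
    rw [LinearMap.mem_ker]
    constructor
    · intro h
      exact ⟨fun w => congrFun h (some (some w)), congrFun h (some none), congrFun h none⟩
    · rintro ⟨h1, h2, h3⟩
      ext (_ | _ | w)
      exacts [h3, h2, h1 w]
  have hxS : x ∈ S := hx.mem_span h0
  have hle : LinearMap.ker Φ ≤ S := by
    intro d hd
    obtain ⟨hd1, hd2, hd3⟩ := (hker d).1 hd
    obtain ⟨hz, hU⟩ := hl d hd1 hd2 hd3
    obtain ⟨ε, he, -, hc⟩ := exists_pos_step (ι := E ⊕ Finset V)
      (Sum.elim x fun U => if Odd U.card then cutL s t U x - 1 else 0)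
      (Sum.elim d fun U => if Odd U.card then cutL s t U d else 0) (by
        rintro (e | U)
        · rcases (hx.nonneg e).lt_or_eq with h | h
          · exact .inl h
          · exact .inr ⟨h.symm, (hz e h.symm).ge⟩
        · simp only [Sum.elim_inr]
          split_ifs with h
          · rcases (hx.cut U h).lt_or_eq with h1 | h1
            · exact .inl (by linarith)
            · exact .inr ⟨by linarith, (hU U h h1.symm).ge⟩
          · exact .inr ⟨rfl, le_rfl⟩)
    have hy : InQ s t (x + ε • d) :=
      { nonneg := fun e => (hc (.inl e)).1
        deg := fun w => by rw [map_add, map_smul, hx.deg, hd1, smul_zero, add_zero]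
        cut := fun U h => by
          have := (hc (.inr U)).1
          simp only [Sum.elim_inr, if_pos h] at this
          rw [map_add, map_smul, smul_eq_mul]
          linarith }
    have hyS : x + ε • d ∈ S := hy.mem_span (e₀ := e₀) (by simp [h0, hd2])
    have := S.smul_mem ε⁻¹ (S.sub_mem hyS hxS)
    rwa [add_sub_cancel_left, smul_smul, inv_mul_cancel₀ he.ne', one_smul] at this
  have hlt : LinearMap.ker Φ < S := by
    refine lt_of_le_of_ne hle fun h => ?_
    rw [← h, hker] at hxS
    have := hxS.1 (Classical.arbitrary V)
    rw [hx.deg] at this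
    exact one_ne_zero this
  have h1 := Submodule.finrank_lt_finrank_of_lt hlt
  have h2 := LinearMap.finrank_range_add_finrank_ker Φ
  have h3 := Submodule.finrank_le (LinearMap.range Φ)
  have h4 : Module.finrank ℝ S ≤ _ := finrank_range_le_card _
  rw [Module.finrank_fintype_fun_eq_card] at h2 h3
  rw [← Nat.card_eq_fintype_card] at h4
  simp only [Fintype.card_option] at h3
  omega

end Dimension

section Hall

variable {V E : Type} [Fintype V] [Fintype E] (s t : E → V)

/-- The vertices joined to `I` by an edge of `F`. -/
def nbr (F : Finset E) (I : Finset V) : Finset V :=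
  Finset.univ.filter fun w => ∃ e ∈ F, (s e = w ∧ t e ∈ I) ∨ (t e = w ∧ s e ∈ I)

variable {s t}

theorem mem_nbr {F : Finset E} {I : Finset V} {w : V} :
    w ∈ nbr s t F I ↔ ∃ e ∈ F, (s e = w ∧ t e ∈ I) ∨ (t e = w ∧ s e ∈ I) := by
  simp [nbr]

theorem nbr_mono {F : Finset E} {I I' : Finset V} (h : I ⊆ I') :
    nbr s t F I ⊆ nbr s t F I' := by
  intro w hw
  obtain ⟨e, he, h1⟩ := mem_nbr.1 hw
  exact mem_nbr.2 ⟨e, he, h1.imp (fun h1 => ⟨h1.1, h h1.2⟩) (fun h1 => ⟨h1.1, h h1.2⟩)⟩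

theorem mem_nbr_singleton_comm {F : Finset E} {a b : V} (h : a ∈ nbr s t F {b}) :
    b ∈ nbr s t F {a} := by
  obtain ⟨e, he, h1⟩ := mem_nbr.1 h
  simp only [Finset.mem_singleton] at h1
  exact mem_nbr.2 ⟨e, he, by simp only [Finset.mem_singleton]; tauto⟩

theorem mem_nbr_iff_singleton {F : Finset E} {I : Finset V} {w : V} :
    w ∈ nbr s t F I ↔ ∃ a ∈ I, w ∈ nbr s t F {a} := by
  constructor
  · intro h
    obtain ⟨e, he, h1 | h1⟩ := mem_nbr.1 h
    · exact ⟨t e, h1.2, mem_nbr.2 ⟨e, he, .inl ⟨h1.1, by simp⟩⟩⟩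
    · exact ⟨s e, h1.2, mem_nbr.2 ⟨e, he, .inr ⟨h1.1, by simp⟩⟩⟩
  · rintro ⟨a, ha, h⟩
    exact nbr_mono (Finset.singleton_subset_iff.2 ha) h

theorem exists_fractional_matching_aux (F : Finset E) (b : V → ℕ)
    (h : ∀ I : Finset V, ∑ w ∈ I, b w ≤ ∑ w ∈ nbr s t F I, b w) :
    ∃ τ : E → ℝ, (∀ e, 0 ≤ τ e) ∧ (∀ e ∉ F, τ e = 0) ∧ ∀ w, degL s t w τ = b w := by
  have hall := (Finset.all_card_le_biUnion_card_iff_exists_injective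
    (fun p : (Σ w, Fin (b w)) => Finset.univ.filter fun q : (Σ w, Fin (b w)) =>
      q.1 ∈ nbr s t F {p.1})).1 (by
    intro A
    set I := A.image Sigma.fst with hI
    have h1 : A.card ≤ ∑ w ∈ I, b w := by
      calc A.card ≤ (I.sigma fun w => (Finset.univ : Finset (Fin (b w)))).card := by
            apply Finset.card_le_card
            intro p hp
            exact Finset.mem_sigma.2 ⟨Finset.mem_image_of_mem _ hp, Finset.mem_univ _⟩
        _ = _ := by rw [Finset.card_sigma]; simp
    refine h1.trans ((h I).trans ?_)
    calc ∑ w ∈ nbr s t F I, b w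
        = ((nbr s t F I).sigma fun w => (Finset.univ : Finset (Fin (b w)))).card := by
          rw [Finset.card_sigma]; simp
      _ ≤ _ := by
          apply Finset.card_le_card
          intro q hq
          obtain ⟨a, ha, hq⟩ := mem_nbr_iff_singleton.1 (Finset.mem_sigma.1 hq).1
          obtain ⟨p, hp, rfl⟩ := Finset.mem_image.1 ha
          exact Finset.mem_biUnion.2 ⟨p, hp, by simpa using hq⟩)
  obtain ⟨f, hinj, hf⟩ := hall
  have hbij : Function.Bijective f := Finite.injective_iff_bijective.1 hinj
  have hg : ∀ p, ∃ e ∈ F, (s e = (f p).1 ∧ t e = p.1) ∨ (t e = (f p).1 ∧ s e = p.1) := by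
    intro p
    have := (Finset.mem_filter.1 (hf p)).2
    simpa [mem_nbr] using this
  choose g hgF hg using hg
  refine ⟨fun e => (1 / 2) * ((Finset.univ.filter fun p => g p = e).card : ℝ), fun e => by positivity,
    fun e he => ?_, fun w => ?_⟩
  · beta_reduce
    rw [Finset.filter_false_of_mem]
    · simp
    · rintro p - rfl
      exact he (hgF p)
  · have hcount : ∀ e, ((Finset.univ.filter fun p => g p = e).card : ℝ) =
        ∑ p, if g p = e then (1 : ℝ) else 0 := fun e => by rw [Finset.sum_boole]
    have hfib : ∑ p : (Σ w, Fin (b w)), (if p.1 = w then (1 : ℝ) else 0) = b w := by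
      rw [Fintype.sum_sigma, Finset.sum_eq_single w (fun v _ hv => by simp [hv]) (by simp)]
      simp
    have hfib' : ∑ p : (Σ w, Fin (b w)), (if (f p).1 = w then (1 : ℝ) else 0) = b w := by
      rw [← hfib]
      exact hbij.sum_comp fun p : (Σ w, Fin (b w)) => if p.1 = w then (1 : ℝ) else 0
    rw [degL_apply]
    calc ∑ e, ((if s e = w then (1 : ℝ) else 0) + (if t e = w then 1 else 0)) *
          (1 / 2 * ((Finset.univ.filter fun p => g p = e).card : ℝ))
        = ∑ e, ∑ p, (1 / 2) * (if g p = e then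
            ((if s e = w then (1 : ℝ) else 0) + (if t e = w then 1 else 0)) else 0) := by
          refine Finset.sum_congr rfl fun e _ => ?_
          rw [hcount, Finset.mul_sum, Finset.mul_sum]
          refine Finset.sum_congr rfl fun p _ => ?_
          split_ifs <;> ring
      _ = ∑ p, (1 / 2) * ((if s (g p) = w then (1 : ℝ) else 0) +
            (if t (g p) = w then 1 else 0)) := by
          rw [Finset.sum_comm]
          refine Finset.sum_congr rfl fun p _ => ?_
          rw [← Finset.mul_sum, Finset.sum_ite_eq, if_pos (Finset.mem_univ _)]
      _ = ∑ p : (Σ w, Fin (b w)), (1 / 2) * ((if (f p).1 = w then (1 : ℝ) else 0) +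
            (if p.1 = w then 1 else 0)) := by
          refine Finset.sum_congr rfl fun p _ => ?_
          rcases hg p with ⟨h1, h2⟩ | ⟨h1, h2⟩
          · rw [h1, h2]
          · rw [h1, h2, add_comm]
      _ = b w := by
          rw [← Finset.mul_sum, Finset.sum_add_distrib, hfib, hfib']
          ring

theorem exists_fractional_matching (F : Finset E) (b : V → ℕ)
    (h : ∀ I : Finset V, Disjoint I (nbr s t F I) → ∑ w ∈ I, b w ≤ ∑ w ∈ nbr s t F I, b w) :
    ∃ τ : E → ℝ, (∀ e, 0 ≤ τ e) ∧ (∀ e ∉ F, τ e = 0) ∧ ∀ w, degL s t w τ = b w := by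
  refine exists_fractional_matching_aux F b fun I => ?_
  set N := nbr s t F I with hN
  have hsub : nbr s t F (I \ N) ⊆ N \ I := by
    intro w hw
    obtain ⟨a, ha, hw⟩ := mem_nbr_iff_singleton.1 hw
    rw [Finset.mem_sdiff] at ha ⊢
    refine ⟨mem_nbr_iff_singleton.2 ⟨a, ha.1, hw⟩, fun hwI => ha.2 ?_⟩
    exact mem_nbr_iff_singleton.2 ⟨w, hwI, mem_nbr_singleton_comm hw⟩
  have h1 := h (I \ N) (Finset.disjoint_left.2 fun w hw hw' =>
    (Finset.mem_sdiff.1 (hsub hw')).2 (Finset.mem_sdiff.1 hw).1)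
  have h2 : ∑ w ∈ nbr s t F (I \ N), b w ≤ ∑ w ∈ N \ I, b w :=
    Finset.sum_le_sum_of_subset hsub
  have h3 := Finset.sum_inter_add_sum_sdiff I N b
  have h4 := Finset.sum_inter_add_sum_sdiff N I b
  rw [Finset.inter_comm] at h4
  omega

theorem exists_fractional_matching_bipartite (F : Finset E) (b : V → ℕ) {J S : Finset V}
    (hd : Disjoint J S) (hF : ∀ e ∈ F, (s e ∈ J ∧ t e ∈ S) ∨ (s e ∈ S ∧ t e ∈ J))
    (hb : ∀ w, w ∉ J → w ∉ S → b w = 0) (hJS : ∑ w ∈ J, b w = ∑ w ∈ S, b w)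
    (h : ∀ I ⊆ J, ∑ w ∈ I, b w ≤ ∑ w ∈ nbr s t F I, b w) :
    ∃ τ : E → ℝ, (∀ e, 0 ≤ τ e) ∧ (∀ e ∉ F, τ e = 0) ∧ ∀ w, degL s t w τ = b w := by
  refine exists_fractional_matching_aux F b fun I => ?_
  have hd' : ∀ w, w ∈ J → w ∉ S := fun w h1 h2 => Finset.disjoint_left.1 hd h1 h2
  have hNJ : ∀ I ⊆ J, nbr s t F I ⊆ S := by
    intro I hI w hw
    obtain ⟨e, he, ⟨rfl, h2⟩ | ⟨rfl, h2⟩⟩ := mem_nbr.1 hw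
    · have := hd' _ (hI h2)
      have := hF e he
      tauto
    · have := hd' _ (hI h2)
      have := hF e he
      tauto
  have hNS : ∀ I ⊆ S, nbr s t F I ⊆ J := by
    intro I hI w hw
    obtain ⟨e, he, ⟨rfl, h2⟩ | ⟨rfl, h2⟩⟩ := mem_nbr.1 hw
    · have : t e ∉ J := fun h => hd' _ h (hI h2)
      have := hF e he
      tauto
    · have : s e ∉ J := fun h => hd' _ h (hI h2)
      have := hF e he
      tauto
  have hS : ∑ w ∈ I ∩ S, b w ≤ ∑ w ∈ nbr s t F (I ∩ S), b w := by
    set N := nbr s t F (I ∩ S) with hN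
    have hN' : N ⊆ J := hNS _ Finset.inter_subset_right
    have h1 := h (J \ N) Finset.sdiff_subset
    have hsub : nbr s t F (J \ N) ⊆ S \ (I ∩ S) := by
      intro w hw
      refine Finset.mem_sdiff.2 ⟨hNJ _ Finset.sdiff_subset hw, fun hwI => ?_⟩
      obtain ⟨a, ha, hw⟩ := mem_nbr_iff_singleton.1 hw
      exact (Finset.mem_sdiff.1 ha).2
        (mem_nbr_iff_singleton.2 ⟨w, hwI, mem_nbr_singleton_comm hw⟩)
    have h2 : ∑ w ∈ nbr s t F (J \ N), b w ≤ ∑ w ∈ S \ (I ∩ S), b w :=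
      Finset.sum_le_sum_of_subset hsub
    have h3 := Finset.sum_sdiff (f := b) hN'
    have h4 := Finset.sum_sdiff (f := b) (Finset.inter_subset_right (s₁ := I) (s₂ := S))
    omega
  have hJ := h (I ∩ J) Finset.inter_subset_right
  calc ∑ w ∈ I, b w = ∑ w ∈ I ∩ (J ∪ S), b w := by
        symm
        refine Finset.sum_subset Finset.inter_subset_left fun w hw hw' => ?_
        rw [Finset.mem_inter, Finset.mem_union] at hw'
        exact hb w (by tauto) (by tauto)
    _ = ∑ w ∈ I ∩ J, b w + ∑ w ∈ I ∩ S, b w := by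
        rw [Finset.inter_union_distrib_left, Finset.sum_union]
        exact Finset.disjoint_of_subset_left Finset.inter_subset_right
          (Finset.disjoint_of_subset_right Finset.inter_subset_right hd)
    _ ≤ ∑ w ∈ nbr s t F (I ∩ J), b w + ∑ w ∈ nbr s t F (I ∩ S), b w := add_le_add hJ hS
    _ = ∑ w ∈ nbr s t F (I ∩ J) ∪ nbr s t F (I ∩ S), b w := by
        rw [Finset.sum_union]
        exact Finset.disjoint_of_subset_left (hNJ _ Finset.inter_subset_right)
          (Finset.disjoint_of_subset_right (hNS _ Finset.inter_subset_right) hd.symm)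
    _ ≤ _ := Finset.sum_le_sum_of_subset (Finset.union_subset
        (nbr_mono Finset.inter_subset_left) (nbr_mono Finset.inter_subset_left))

end Hall

section Single

variable {V E : Type} [Fintype V] [Fintype E] {s t : E → V}

theorem degL_single (w : V) (e : E) :
    degL s t w (Pi.single e 1) =
      (if s e = w then (1 : ℝ) else 0) + (if t e = w then 1 else 0) := by
  rw [degL_apply, Finset.sum_eq_single e]
  · simp
  · intro f _ hf
    simp [hf]
  · simp

theorem cutL_single (U : Finset V) (e : E) :
    cutL s t U (Pi.single e 1) = if (s e ∈ U ↔ t e ∈ U) then (0 : ℝ) else 1 := by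
  rw [cutL_apply, Finset.sum_eq_single e]
  · simp
  · intro f _ hf
    simp [hf]
  · simp

theorem sum_degL_single (I : Finset V) (e : E) :
    ∑ w ∈ I, degL s t w (Pi.single e 1) =
      (if s e ∈ I then (1 : ℝ) else 0) + (if t e ∈ I then 1 else 0) := by
  simp only [degL_single, Finset.sum_add_distrib, Finset.sum_ite_eq]

theorem ind_univ_erase (e : E) : ind (Finset.univ.erase e) = 1 - Pi.single e 1 := by
  ext f
  by_cases h : f = e
  · subst h; simp [ind]
  · simp [ind, h]

theorem ind_erase {F : Finset E} {e : E} (he : e ∈ F) :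
    ind (F.erase e) = ind F - Pi.single e 1 := by
  ext f
  by_cases h : f = e
  · subst h; simp [ind, he]
  · simp [ind, h]

theorem exists_nat_degL_ind (F : Finset E) (w : V) : ∃ k : ℕ, degL s t w (ind F) = k := by
  refine ⟨∑ e, ((if s e = w then 1 else 0) + (if t e = w then 1 else 0)) *
    (if e ∈ F then 1 else 0), ?_⟩
  rw [degL_apply]
  push_cast
  rfl

/-- Real-valued form of `exists_fractional_matching`. -/
theorem exists_fractional_matching' (F : Finset E) (b : V → ℝ) (hb : ∀ w, ∃ k : ℕ, b w = k)
    (h : ∀ I : Finset V, Disjoint I (nbr s t F I) → ∑ w ∈ I, b w ≤ ∑ w ∈ nbr s t F I, b w) :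
    ∃ τ : E → ℝ, (∀ e, 0 ≤ τ e) ∧ (∀ e ∉ F, τ e = 0) ∧ ∀ w, degL s t w τ = b w := by
  choose k hk using hb
  simp only [hk] at h ⊢
  exact exists_fractional_matching F k fun I hI => by exact_mod_cast h I hI

/-- Real-valued form of `exists_fractional_matching_bipartite`. -/
theorem exists_fractional_matching_bipartite' (F : Finset E) (b : V → ℝ)
    (hk : ∀ w, ∃ k : ℕ, b w = k) {J S : Finset V}
    (hd : Disjoint J S) (hF : ∀ e ∈ F, (s e ∈ J ∧ t e ∈ S) ∨ (s e ∈ S ∧ t e ∈ J))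
    (hb : ∀ w, w ∉ J → w ∉ S → b w = 0) (hJS : ∑ w ∈ J, b w = ∑ w ∈ S, b w)
    (h : ∀ I ⊆ J, ∑ w ∈ I, b w ≤ ∑ w ∈ nbr s t F I, b w) :
    ∃ τ : E → ℝ, (∀ e, 0 ≤ τ e) ∧ (∀ e ∉ F, τ e = 0) ∧ ∀ w, degL s t w τ = b w := by
  choose k hk using hk
  simp only [hk] at h hb hJS ⊢
  exact exists_fractional_matching_bipartite F k hd hF (fun w h1 h2 => by exact_mod_cast hb w h1 h2)
    (by exact_mod_cast hJS) fun I hI => by exact_mod_cast h I hI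

end Single

section Bipartite

variable {V E : Type} [Fintype V] [Fintype E] {s t : E → V}

theorem sum_degL_eq_of_support {J S : Finset V} (hd : Disjoint J S) {y : E → ℝ}
    (hy : ∀ e, y e ≠ 0 → (s e ∈ J → t e ∈ S) ∧ (t e ∈ J → s e ∈ S)) :
    ∑ w ∈ S, degL s t w y = ∑ w ∈ J, degL s t w y + btwL s t S S y + cutL s t (J ∪ S) y := by
  have hd' : ∀ w, w ∈ J → w ∉ S := fun w h1 h2 => Finset.disjoint_left.1 hd h1 h2
  simp only [degL_apply, btwL_apply, cutL_apply]
  rw [Finset.sum_comm, Finset.sum_comm (s := J), ← Finset.sum_add_distrib,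
    ← Finset.sum_add_distrib]
  refine Finset.sum_congr rfl fun e _ => ?_
  rw [← Finset.sum_mul, ← Finset.sum_mul]
  simp only [Finset.sum_add_distrib, Finset.sum_ite_eq, Finset.mem_union]
  by_cases h0 : y e = 0
  · simp [h0]
  obtain ⟨h1, h2⟩ := hy e h0
  have h3 := hd' (s e)
  have h4 := hd' (t e)
  by_cases a1 : s e ∈ J <;> by_cases a2 : t e ∈ J <;> by_cases a3 : s e ∈ S <;>
    by_cases a4 : t e ∈ S <;> simp_all <;> ring

theorem sum_degL_left {J S Y : Finset V} (hd : Disjoint J S) {y : E → ℝ}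
    (hJ : ∀ e, y e ≠ 0 → (s e ∈ J → t e ∈ S) ∧ (t e ∈ J → s e ∈ S)) :
    ∑ w ∈ Y ∩ J, degL s t w y = btwL s t (Y ∩ J) (Y ∩ S) y + btwL s t (Y ∩ J) Yᶜ y := by
  have hd' : ∀ w, w ∈ J → w ∉ S := fun w h1 h2 => Finset.disjoint_left.1 hd h1 h2
  simp only [degL_apply, btwL_apply]
  rw [Finset.sum_comm, ← Finset.sum_add_distrib]
  refine Finset.sum_congr rfl fun e _ => ?_
  rw [← Finset.sum_mul]
  simp only [Finset.sum_add_distrib, Finset.sum_ite_eq, Finset.mem_inter, Finset.mem_compl]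
  by_cases h0 : y e = 0
  · simp [h0]
  obtain ⟨h1, h2⟩ := hJ e h0
  have h3 := hd' (s e)
  have h4 := hd' (t e)
  by_cases a1 : s e ∈ J <;> by_cases a2 : t e ∈ J <;> by_cases a5 : s e ∈ Y <;>
    by_cases a6 : t e ∈ Y <;> simp_all

theorem sum_degL_right {J S Y : Finset V} (hY : Y ⊆ J ∪ S) (hd : Disjoint J S) {y : E → ℝ}
    (hJ : ∀ e, y e ≠ 0 → (s e ∈ J → t e ∈ S) ∧ (t e ∈ J → s e ∈ S))
    (hS : ∀ e, y e ≠ 0 → ¬ (s e ∈ S ∧ t e ∈ S)) :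
    ∑ w ∈ Y ∩ S, degL s t w y = btwL s t (Y ∩ J) (Y ∩ S) y + btwL s t (Y ∩ S) Yᶜ y := by
  have hd' : ∀ w, w ∈ J → w ∉ S := fun w h1 h2 => Finset.disjoint_left.1 hd h1 h2
  simp only [degL_apply, btwL_apply]
  rw [Finset.sum_comm, ← Finset.sum_add_distrib]
  refine Finset.sum_congr rfl fun e _ => ?_
  rw [← Finset.sum_mul]
  simp only [Finset.sum_add_distrib, Finset.sum_ite_eq, Finset.mem_inter, Finset.mem_compl]
  by_cases h0 : y e = 0
  · simp [h0]
  obtain ⟨h1, h2⟩ := hJ e h0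
  have h5 := hS e h0
  have h3 := hd' (s e)
  have h4 := hd' (t e)
  have h6 : s e ∈ Y → s e ∈ J ∨ s e ∈ S := fun h => Finset.mem_union.1 (hY h)
  have h7 : t e ∈ Y → t e ∈ J ∨ t e ∈ S := fun h => Finset.mem_union.1 (hY h)
  by_cases a1 : s e ∈ J <;> by_cases a2 : t e ∈ J <;> by_cases a5 : s e ∈ Y <;>
    by_cases a6 : t e ∈ Y <;> simp_all

theorem cutL_eq_of_subset {J S Y : Finset V} (hY : Y ⊆ J ∪ S) (hd : Disjoint J S) (y : E → ℝ) :
    cutL s t Y y = btwL s t (Y ∩ J) Yᶜ y + btwL s t (Y ∩ S) Yᶜ y := by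
  rw [← btwL_union, ← Finset.inter_union_distrib_left, Finset.inter_eq_left.2 hY, cutL_eq_btwL]
  exact Finset.disjoint_of_subset_left Finset.inter_subset_right
    (Finset.disjoint_of_subset_right Finset.inter_subset_right hd)

/-- Odd cuts inside a part of the graph whose weight is carried by edges leaving `S`. -/
theorem cut_of_subset_bipartite {J S Y : Finset V} (hY : Y ⊆ J ∪ S) (hd : Disjoint J S)
    {x : E → ℝ} (hx : ∀ e, 0 ≤ x e) (hdeg : ∀ w, degL s t w x = 1)
    (hJ : ∀ e, x e ≠ 0 → (s e ∈ J → t e ∈ S) ∧ (t e ∈ J → s e ∈ S))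
    (hS : ∀ e, x e ≠ 0 → ¬ (s e ∈ S ∧ t e ∈ S)) (hodd : Odd Y.card) :
    1 ≤ cutL s t Y x ∧ (cutL s t Y x = 1 → ∀ d : E → ℝ, (∀ w, degL s t w d = 0) →
      (∀ e, x e = 0 → d e = 0) → cutL s t Y d = 0) := by
  have h1 := sum_degL_left (Y := Y) hd hJ
  have h2 := sum_degL_right hY hd hJ hS
  have h3 := cutL_eq_of_subset (s := s) (t := t) hY hd x
  have hq := btwL_nonneg (s := s) (t := t) hx (Y ∩ J) Yᶜ
  have hr := btwL_nonneg (s := s) (t := t) hx (Y ∩ S) Yᶜ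
  simp only [hdeg, Finset.sum_const, nsmul_one] at h1 h2
  have hcard : (Y ∩ J).card + (Y ∩ S).card = Y.card := by
    rw [← Finset.card_union_of_disjoint, ← Finset.inter_union_distrib_left,
      Finset.inter_eq_left.2 hY]
    exact Finset.disjoint_of_subset_left Finset.inter_subset_right
      (Finset.disjoint_of_subset_right Finset.inter_subset_right hd)
  have hor : ((Y ∩ J).card : ℝ) + 1 ≤ (Y ∩ S).card ∨ ((Y ∩ S).card : ℝ) + 1 ≤ (Y ∩ J).card := by
    obtain ⟨k, hk⟩ := hodd
    rcases lt_trichotomy (Y ∩ J).card (Y ∩ S).card with h | h | h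
    · exact .inl (by exact_mod_cast h)
    · omega
    · exact .inr (by exact_mod_cast h)
  refine ⟨by rcases hor with h | h <;> linarith, fun htight d hd0 hds => ?_⟩
  have hdJ : ∀ e, d e ≠ 0 → (s e ∈ J → t e ∈ S) ∧ (t e ∈ J → s e ∈ S) :=
    fun e he => hJ e (mt (hds e) he)
  have hdS : ∀ e, d e ≠ 0 → ¬ (s e ∈ S ∧ t e ∈ S) := fun e he => hS e (mt (hds e) he)
  have g1 := sum_degL_left (Y := Y) hd hdJ
  have g2 := sum_degL_right hY hd hdJ hdS
  have g3 := cutL_eq_of_subset (s := s) (t := t) hY hd d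
  simp only [hd0, Finset.sum_const_zero] at g1 g2
  rcases hor with h | h
  · have hz : btwL s t (Y ∩ J) Yᶜ x = 0 := by linarith
    have : btwL s t (Y ∩ J) Yᶜ d = 0 :=
      btwL_eq_zero fun e he => hds e (eq_zero_of_btwL_eq_zero hx hz e he)
    linarith
  · have hz : btwL s t (Y ∩ S) Yᶜ x = 0 := by linarith
    have : btwL s t (Y ∩ S) Yᶜ d = 0 :=
      btwL_eq_zero fun e he => hds e (eq_zero_of_btwL_eq_zero hx hz e he)
    linarith

end Bipartite

section Cubic

variable {V E : Type} [Fintype V] [Fintype E] (s t : E → V)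

/-- The number of edges with exactly one end in `U`. -/
def cutCard (U : Finset V) : ℕ := (Finset.univ.filter fun e => ¬ (s e ∈ U ↔ t e ∈ U)).card

/-- Loopless cubic graphs all of whose cuts with at most four edges have a small side. -/
structure CubicSparse : Prop where
  loopless : ∀ e, s e ≠ t e
  cubic : ∀ w, degL s t w 1 = 3
  sparse : ∀ U : Finset V, cutCard s t U ≤ 4 →
    U = ∅ ∨ Uᶜ = ∅ ∨ U.card + 2 ≤ cutCard s t U ∨ Uᶜ.card + 2 ≤ cutCard s t U

variable {s t}

theorem cutL_one (U : Finset V) : cutL s t U 1 = cutCard s t U := by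
  rw [cutL_apply, cutCard, Finset.card_filter, Nat.cast_sum]
  refine Finset.sum_congr rfl fun e _ => ?_
  by_cases h : (s e ∈ U ↔ t e ∈ U) <;> simp [h]

theorem cutCard_compl (U : Finset V) : cutCard s t Uᶜ = cutCard s t U := by
  have := cutL_one (s := s) (t := t) Uᶜ
  rw [cutL_compl, cutL_one] at this
  exact_mod_cast this.symm

theorem three_mul_card_eq (hc : ∀ w, degL s t w 1 = 3) (U : Finset V) : 3 * U.card =
    2 * (Finset.univ.filter fun e => s e ∈ U ∧ t e ∈ U).card + cutCard s t U := by
  have h1 := sum_degL s t U 1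
  have h2 : btwL s t U U 1 = 2 * ((Finset.univ.filter fun e => s e ∈ U ∧ t e ∈ U).card : ℝ) := by
    rw [btwL_apply, Finset.card_filter, Nat.cast_sum, Finset.mul_sum]
    refine Finset.sum_congr rfl fun e _ => ?_
    by_cases h : s e ∈ U ∧ t e ∈ U
    · simp [h]
      norm_num
    · simp [h]
  rw [h2, cutL_one, Finset.sum_congr rfl fun w _ => hc w, Finset.sum_const,
    nsmul_eq_mul, mul_comm] at h1
  exact_mod_cast h1

namespace CubicSparse

theorem three_mul_card (hG : CubicSparse s t) (U : Finset V) :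
    ∃ k : ℕ, 3 * U.card = 2 * k + cutCard s t U :=
  ⟨_, three_mul_card_eq hG.cubic U⟩

theorem cutCard_eq_zero_or (hG : CubicSparse s t) (U : Finset V) :
    cutCard s t U = 0 ∨ 3 ≤ cutCard s t U := by
  by_contra h
  have h0 : ∀ U : Finset V, U ≠ ∅ → 1 ≤ U.card := fun U h =>
    Finset.card_pos.2 (Finset.nonempty_iff_ne_empty.2 h)
  rcases hG.sparse U (by omega) with rfl | h1 | h1 | h1
  · simp [cutCard] at h
  · rw [← cutCard_compl, h1] at h
    simp [cutCard] at h
  · have : U ≠ ∅ := by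
      rintro rfl
      simp [cutCard] at h
    have := h0 U this
    omega
  · have : Uᶜ ≠ ∅ := by
      intro h2
      rw [← cutCard_compl, h2] at h
      simp [cutCard] at h
    have := h0 _ this
    omega

theorem even_card (hG : CubicSparse s t) : Even (Fintype.card V) := by
  obtain ⟨k, hk⟩ := hG.three_mul_card Finset.univ
  simp only [cutCard, Finset.mem_univ, not_true, Finset.filter_false, Finset.card_empty,
    Finset.card_univ] at hk
  exact ⟨Fintype.card V / 2, by omega⟩

theorem odd_compl (hG : CubicSparse s t) {U : Finset V} (hU : Odd U.card) : Odd Uᶜ.card := by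
  obtain ⟨a, ha⟩ := hG.even_card
  have h1 := Finset.card_add_card_compl U
  rcases hU with ⟨b, hb⟩
  exact ⟨a - b - 1, by omega⟩

theorem five_le_cutCard (hG : CubicSparse s t) {U : Finset V} (hU : Odd U.card)
    (h1 : 1 < U.card) (h2 : 1 < Uᶜ.card) : 5 ≤ cutCard s t U := by
  by_contra h
  obtain ⟨k, hk⟩ := hG.three_mul_card U
  obtain ⟨a, ha⟩ := hU
  obtain ⟨b, hb⟩ := hG.odd_compl ⟨a, ha⟩
  rcases hG.sparse U (by omega) with rfl | h3 | h3 | h3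
  · simp at h1
  · rw [h3] at h2
    simp at h2
  · omega
  · omega

theorem cutL_singleton_one (hG : CubicSparse s t) {w : V} : cutCard s t {w} = 3 := by
  have := cutL_one (s := s) (t := t) {w}
  rw [cutL_singleton hG.loopless, hG.cubic] at this
  exact_mod_cast this.symm

theorem sum_degL_one (hG : CubicSparse s t) (I : Finset V) :
    ∑ w ∈ I, degL s t w 1 = 3 * I.card := by
  rw [Finset.sum_congr rfl fun w _ => hG.cubic w, Finset.sum_const, nsmul_eq_mul, mul_comm]

end CubicSparse

end Cubic

section Cases

variable {V E : Type} [Fintype V] [Fintype E] (s t : E → V)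

/-- A point of the polytope vanishing at `e₀` whose tangent directions are cut out by the degree
constraints, the vanishing at `e₀` and one more functional. -/
def HasGoodPoint (e₀ : E) : Prop :=
  ∃ (x : E → ℝ) (l : (E → ℝ) →ₗ[ℝ] ℝ), InQ s t x ∧ x e₀ = 0 ∧
    ∀ d : E → ℝ, (∀ w, degL s t w d = 0) → d e₀ = 0 → l d = 0 →
      (∀ e, x e = 0 → d e = 0) ∧ ∀ U : Finset V, Odd U.card → cutL s t U x = 1 → cutL s t U d = 0

variable {s t}

theorem CubicSparse.eq_univ_of_cutCard_eq_zero (hG : CubicSparse s t) {U : Finset V}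
    (hU : U.Nonempty) (h : cutCard s t U = 0) : U = Finset.univ := by
  rcases hG.sparse U (by omega) with rfl | h1 | h1 | h1
  · simp at hU
  · exact compl_eq_bot.1 h1
  · omega
  · omega

theorem sum_degL_ind_erase (hG : CubicSparse s t) (e₀ : E) (I : Finset V) :
    ∑ w ∈ I, degL s t w (ind (Finset.univ.erase e₀)) =
      3 * I.card - ((if s e₀ ∈ I then (1 : ℝ) else 0) + (if t e₀ ∈ I then 1 else 0)) := by
  rw [ind_univ_erase]
  simp only [map_sub, Finset.sum_sub_distrib, sum_degL_single, hG.sum_degL_one]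

theorem cutL_ind_erase (e₀ : E) (U : Finset V) :
    cutL s t U (ind (Finset.univ.erase e₀)) =
      cutCard s t U - if (s e₀ ∈ U ↔ t e₀ ∈ U) then (0 : ℝ) else 1 := by
  rw [ind_univ_erase, map_sub, cutL_single, cutL_one]

theorem ind_support_nbr {F : Finset E} {I : Finset V} (e : E) (he : ind F e ≠ 0) :
    (s e ∈ I → t e ∈ nbr s t F I) ∧ (t e ∈ I → s e ∈ nbr s t F I) := by
  have heF : e ∈ F := by
    by_contra h
    simp [ind, h] at he
  exact ⟨fun h => mem_nbr.2 ⟨e, heF, .inr ⟨rfl, h⟩⟩, fun h => mem_nbr.2 ⟨e, heF, .inl ⟨rfl, h⟩⟩⟩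

theorem card_nbr_identity (hG : CubicSparse s t) (e₀ : E) {I : Finset V}
    (hI : Disjoint I (nbr s t (Finset.univ.erase e₀) I)) :
    3 * ((nbr s t (Finset.univ.erase e₀) I).card : ℝ) -
        ((if s e₀ ∈ nbr s t (Finset.univ.erase e₀) I then (1 : ℝ) else 0) +
          (if t e₀ ∈ nbr s t (Finset.univ.erase e₀) I then 1 else 0)) =
      3 * I.card - ((if s e₀ ∈ I then (1 : ℝ) else 0) + (if t e₀ ∈ I then 1 else 0)) +
        btwL s t (nbr s t (Finset.univ.erase e₀) I) (nbr s t (Finset.univ.erase e₀) I)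
          (ind (Finset.univ.erase e₀)) +
        (cutCard s t (I ∪ nbr s t (Finset.univ.erase e₀) I) -
          if (s e₀ ∈ I ∪ nbr s t (Finset.univ.erase e₀) I ↔
            t e₀ ∈ I ∪ nbr s t (Finset.univ.erase e₀) I) then (0 : ℝ) else 1) := by
  rw [← sum_degL_ind_erase hG, ← sum_degL_ind_erase hG, ← cutL_ind_erase,
    sum_degL_eq_of_support hI fun e he => ind_support_nbr e he]

theorem btwL_self_ind (F : Finset E) (A : Finset V) :
    btwL s t A A (ind F) = 2 * ((F.filter fun e => s e ∈ A ∧ t e ∈ A).card : ℝ) := by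
  rw [btwL_apply, Finset.card_filter, Nat.cast_sum, Finset.mul_sum]
  rw [← Finset.sum_subset (Finset.subset_univ F)]
  · refine Finset.sum_congr rfl fun e he => ?_
    by_cases h : s e ∈ A ∧ t e ∈ A <;> simp [h, ind, he]
    norm_num
  · intro e _ he
    simp [ind, he]

theorem hall_or_exists_barrier (hG : CubicSparse s t) (e₀ : E) :
    (∀ I : Finset V, Disjoint I (nbr s t (Finset.univ.erase e₀) I) →
      (I.card : ℝ) + ((if s e₀ ∈ I then (1 : ℝ) else 0) + (if t e₀ ∈ I then 1 else 0)) ≤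
        (nbr s t (Finset.univ.erase e₀) I).card +
          ((if s e₀ ∈ nbr s t (Finset.univ.erase e₀) I then (1 : ℝ) else 0) +
            (if t e₀ ∈ nbr s t (Finset.univ.erase e₀) I then 1 else 0))) ∨
    ∃ J : Finset V, s e₀ ∈ J ∧ t e₀ ∈ J ∧ Disjoint J (nbr s t (Finset.univ.erase e₀) J) ∧
      ((nbr s t (Finset.univ.erase e₀) J).card = J.card ∨
        (nbr s t (Finset.univ.erase e₀) J).card = J.card + 1) := by
  by_contra! h
  obtain ⟨⟨I, hI, hlt⟩, h⟩ := h
  have h2 := h I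
  have hid := card_nbr_identity hG e₀ hI
  rw [btwL_self_ind] at hid
  have h3 := hG.cutCard_eq_zero_or (I ∪ nbr s t (Finset.univ.erase e₀) I)
  set N := nbr s t (Finset.univ.erase e₀) I with hN
  have h4 := hG.eq_univ_of_cutCard_eq_zero (U := I ∪ N)
  set c := cutCard s t (I ∪ N) with hc
  set k := ((Finset.univ.erase e₀).filter fun e => s e ∈ N ∧ t e ∈ N).card with hk
  have hd : ∀ w, w ∈ I → w ∉ N := fun w h1 h2 => Finset.disjoint_left.1 hI h1 h2
  have h4' : ∀ a b, a ∈ I → b ∉ I → b ∉ N → c ≠ 0 := by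
    intro a b ha hb hb' h0
    have := h4 ⟨a, Finset.mem_union_left _ ha⟩ h0
    have hb'' := Finset.mem_univ b
    rw [← this, Finset.mem_union] at hb''
    tauto
  have d1 := hd (s e₀)
  have d2 := hd (t e₀)
  have d3 := h4' (s e₀) (t e₀)
  have d4 := h4' (t e₀) (s e₀)
  simp only [Finset.mem_union] at hid
  have hidZ : 3 * (N.card : ℤ) -
      ((if s e₀ ∈ N then 1 else 0) + (if t e₀ ∈ N then 1 else 0)) =
      3 * I.card - ((if s e₀ ∈ I then 1 else 0) + (if t e₀ ∈ I then 1 else 0)) + 2 * k +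
        (c - if (s e₀ ∈ I ∨ s e₀ ∈ N ↔ t e₀ ∈ I ∨ t e₀ ∈ N) then 0 else 1) := by
    exact_mod_cast hid
  have hltZ : (N.card : ℤ) + ((if s e₀ ∈ N then 1 else 0) + (if t e₀ ∈ N then 1 else 0)) <
      I.card + ((if s e₀ ∈ I then 1 else 0) + (if t e₀ ∈ I then 1 else 0)) := by
    exact_mod_cast hlt
  clear hid hlt
  by_cases a1 : s e₀ ∈ I <;> by_cases a2 : t e₀ ∈ I <;> by_cases a3 : s e₀ ∈ N <;>
    by_cases a4 : t e₀ ∈ N <;>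
    simp only [a1, a2, a3, a4, hI, if_true, if_false, true_or, or_true, or_self, iff_self,
      iff_true, iff_false, not_true, not_false_iff, ne_eq,
      false_implies, implies_true, forall_const, add_zero, zero_add, sub_zero]
      at hidZ hltZ h2 d1 d2 d3 d4
  all_goals omega

end Cases

section BalancedBarrier

variable {V E : Type} [Fintype V] [Fintype E] {s t : E → V}

theorem exists_nat_ite (p : Prop) : ∃ k : ℕ, (if p then (1 : ℝ) else 0) = k :=
  ⟨if p then 1 else 0, by push_cast; rfl⟩

theorem exists_nat_add {a b : ℝ} (ha : ∃ k : ℕ, a = k) (hb : ∃ k : ℕ, b = k) :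
    ∃ k : ℕ, a + b = k := by
  obtain ⟨k, rfl⟩ := ha
  obtain ⟨m, rfl⟩ := hb
  exact ⟨k + m, by push_cast; rfl⟩

theorem exists_nat_degL_single (w : V) (e : E) :
    ∃ k : ℕ, degL s t w (Pi.single e 1) = k := by
  rw [degL_single]
  exact exists_nat_add (exists_nat_ite _) (exists_nat_ite _)

/-- Deficiency bound for subsets of a balanced or nearly balanced barrier. -/
theorem two_mul_card_le (hG : CubicSparse s t) {e₀ : E} {J I : Finset V}
    (hu : s e₀ ∈ J) (hv : t e₀ ∈ J)
    (hJ : Disjoint J (nbr s t (Finset.univ.erase e₀) J)) (hI : I ⊆ J)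
    (hIJ : I ∪ nbr s t (Finset.univ.erase e₀) I ≠ Finset.univ) :
    2 * (I.card : ℝ) + ((if s e₀ ∈ I then (1 : ℝ) else 0) + (if t e₀ ∈ I then 1 else 0)) ≤
      2 * (nbr s t (Finset.univ.erase e₀) I).card := by
  have hNJ : nbr s t (Finset.univ.erase e₀) I ⊆ nbr s t (Finset.univ.erase e₀) J := nbr_mono hI
  have hd : Disjoint I (nbr s t (Finset.univ.erase e₀) I) :=
    Finset.disjoint_of_subset_left hI (Finset.disjoint_of_subset_right hNJ hJ)
  have hid := card_nbr_identity hG e₀ hd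
  rw [btwL_self_ind] at hid
  have h3 := hG.cutCard_eq_zero_or (I ∪ nbr s t (Finset.univ.erase e₀) I)
  have h1 : s e₀ ∉ nbr s t (Finset.univ.erase e₀) I := fun h =>
    Finset.disjoint_left.1 hJ hu (hNJ h)
  have h2 : t e₀ ∉ nbr s t (Finset.univ.erase e₀) I := fun h =>
    Finset.disjoint_left.1 hJ hv (hNJ h)
  have h4 := hG.eq_univ_of_cutCard_eq_zero (U := I ∪ nbr s t (Finset.univ.erase e₀) I)
  set N := nbr s t (Finset.univ.erase e₀) I with hN
  set c := cutCard s t (I ∪ N) with hc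
  set k := ((Finset.univ.erase e₀).filter fun e => s e ∈ N ∧ t e ∈ N).card with hk
  rcases Finset.eq_empty_or_nonempty I with rfl | hne
  · simp
  have h0 : c ≠ 0 := fun h => hIJ (h4 (hne.mono Finset.subset_union_left) h)
  simp only [Finset.mem_union, h1, h2, or_false, if_false] at hid
  have hidZ : 3 * (N.card : ℤ) - (0 + 0) =
      3 * I.card - ((if s e₀ ∈ I then 1 else 0) + (if t e₀ ∈ I then 1 else 0)) + 2 * k +
        (c - if (s e₀ ∈ I ↔ t e₀ ∈ I) then 0 else 1) := by
    exact_mod_cast hid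
  have hgoal : 2 * (I.card : ℤ) + ((if s e₀ ∈ I then 1 else 0) + (if t e₀ ∈ I then 1 else 0)) ≤
      2 * N.card := by
    by_cases a1 : s e₀ ∈ I <;> by_cases a2 : t e₀ ∈ I <;> simp only [a1, a2, if_true, if_false,
      iff_true, iff_false, not_true] at hidZ ⊢ <;> omega
  exact_mod_cast hgoal

theorem hasGoodPoint_of_card_eq (hG : CubicSparse s t) {e₀ : E} {J : Finset V}
    (hu : s e₀ ∈ J) (hv : t e₀ ∈ J) (hJ : Disjoint J (nbr s t (Finset.univ.erase e₀) J))
    (hcard : (nbr s t (Finset.univ.erase e₀) J).card = J.card) : HasGoodPoint s t e₀ := by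
  have hid := card_nbr_identity hG e₀ hJ
  have h3 := hG.cutCard_eq_zero_or (J ∪ nbr s t (Finset.univ.erase e₀) J)
  have h4 := hG.eq_univ_of_cutCard_eq_zero (U := J ∪ nbr s t (Finset.univ.erase e₀) J)
    ⟨_, Finset.mem_union_left _ hu⟩
  have hud : ∀ w, w ∈ J → w ∉ nbr s t (Finset.univ.erase e₀) J := fun w h1 h2 =>
    Finset.disjoint_left.1 hJ h1 h2
  have hnb : ∀ e, e ≠ e₀ → (s e ∈ J → t e ∈ nbr s t (Finset.univ.erase e₀) J) ∧
      (t e ∈ J → s e ∈ nbr s t (Finset.univ.erase e₀) J) := fun e he =>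
    ind_support_nbr e (by simp [ind, he])
  rw [btwL_self_ind] at hid
  set S := nbr s t (Finset.univ.erase e₀) J with hS
  simp only [Finset.mem_union, hu, hv, hud _ hu, hud _ hv, if_true, if_false, or_false,
    iff_self, hcard] at hid
  set c := cutCard s t (J ∪ S) with hc
  set k := ((Finset.univ.erase e₀).filter fun e => s e ∈ S ∧ t e ∈ S).card with hk
  have hidZ : 2 * (k : ℤ) + c = 2 := by
    have : 2 * (k : ℝ) + c = 2 := by linarith
    exact_mod_cast this
  have huniv : J ∪ S = Finset.univ := h4 (by omega)
  obtain ⟨f, hf⟩ := Finset.card_eq_one.1 (show k = 1 by omega)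
  have hfm : f ∈ (Finset.univ.erase e₀).filter fun e => s e ∈ S ∧ t e ∈ S := by
    rw [hf]; exact Finset.mem_singleton_self f
  simp only [Finset.mem_filter, Finset.mem_erase, Finset.mem_univ, and_true] at hfm
  obtain ⟨hfe, hfs, hft⟩ := hfm
  have huq : ∀ e, e ≠ e₀ → e ≠ f → ¬ (s e ∈ S ∧ t e ∈ S) := by
    intro e he hef h
    have : e ∈ (Finset.univ.erase e₀).filter fun e => s e ∈ S ∧ t e ∈ S := by simp [he, h]
    rw [hf] at this
    exact hef (Finset.mem_singleton.1 this)
  have hcov : ∀ w, w ∈ J ∨ w ∈ S := fun w => by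
    rw [← Finset.mem_union, huniv]; exact Finset.mem_univ w
  have hF1 : ∀ e, e ≠ e₀ → e ≠ f → (s e ∈ J ∧ t e ∈ S) ∨ (s e ∈ S ∧ t e ∈ J) := by
    intro e he hef
    have := huq e he hef
    have := hnb e he
    have := hcov (s e)
    have := hcov (t e)
    tauto
  set F1 := (Finset.univ.erase e₀).erase f with hF1d
  have hmem : ∀ e, e ∈ F1 ↔ e ≠ f ∧ e ≠ e₀ := by simp [hF1d]
  have hind : ind F1 = 1 - Pi.single e₀ 1 - Pi.single f 1 := by
    rw [hF1d, ind_erase (by simp [hfe]), ind_univ_erase]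
  have hnbr : ∀ I ⊆ J, nbr s t F1 I = nbr s t (Finset.univ.erase e₀) I := by
    intro I hI
    ext w
    simp only [mem_nbr, hmem, Finset.mem_erase, Finset.mem_univ, and_true]
    constructor
    · rintro ⟨e, ⟨_, he⟩, h⟩
      exact ⟨e, he, h⟩
    · rintro ⟨e, he, h⟩
      refine ⟨e, ⟨?_, he⟩, h⟩
      rintro rfl
      rcases h with h | h
      · exact hud _ (hI h.2) hft
      · exact hud _ (hI h.2) hfs
  have hsumb : ∀ I : Finset V, ∑ w ∈ I, (2 + degL s t w (Pi.single e₀ 1) +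
      degL s t w (Pi.single f 1)) = 2 * I.card +
        ((if s e₀ ∈ I then (1 : ℝ) else 0) + (if t e₀ ∈ I then 1 else 0)) +
        ((if s f ∈ I then (1 : ℝ) else 0) + (if t f ∈ I then 1 else 0)) := by
    intro I
    simp only [Finset.sum_add_distrib (g := fun w => degL s t w (Pi.single f 1)),
      Finset.sum_add_distrib (g := fun w => degL s t w (Pi.single e₀ 1)), sum_degL_single,
      Finset.sum_const, nsmul_eq_mul]
    ring
  have hJf : s f ∉ J ∧ t f ∉ J := ⟨fun h => hud _ h hfs, fun h => hud _ h hft⟩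
  have hsumJ : ∀ I ⊆ J, ((if s f ∈ I then (1 : ℝ) else 0) + (if t f ∈ I then 1 else 0)) = 0 := by
    intro I hI
    rw [if_neg fun h => hJf.1 (hI h), if_neg fun h => hJf.2 (hI h), add_zero]
  have htot : ∑ w ∈ J, (2 + degL s t w (Pi.single e₀ 1) + degL s t w (Pi.single f 1)) =
      ∑ w ∈ S, (2 + degL s t w (Pi.single e₀ 1) + degL s t w (Pi.single f 1)) := by
    rw [hsumb, hsumb, hsumJ J subset_rfl, hcard]
    simp [hu, hv, hud _ hu, hud _ hv, hfs, hft]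
  obtain ⟨τ, hτ0, hτF, hτ⟩ := exists_fractional_matching_bipartite' F1
    (fun w => 2 + degL s t w (Pi.single e₀ 1) + degL s t w (Pi.single f 1))
    (fun w => exists_nat_add (exists_nat_add ⟨2, rfl⟩ (exists_nat_degL_single w e₀))
      (exists_nat_degL_single w f)) hJ (fun e he => hF1 e ((hmem e).1 he).2 ((hmem e).1 he).1)
    (fun w h1 h2 => absurd (hcov w) (by tauto)) htot (by
      intro I hI
      by_cases hIJ : I ∪ nbr s t (Finset.univ.erase e₀) I = Finset.univ
      · have : I = J := by
          refine hI.antisymm fun w hw => ?_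
          have hw' := Finset.mem_univ w
          rw [← hIJ, Finset.mem_union] at hw'
          exact hw'.resolve_right fun h => hud w hw (nbr_mono hI h)
        subst this
        rw [hnbr _ subset_rfl]
        exact htot.le
      · have := two_mul_card_le hG hu hv hJ hI hIJ
        rw [hnbr _ hI, hsumb, hsumb, hsumJ I hI]
        have p0 : (0 : ℝ) ≤ if s e₀ ∈ nbr s t (Finset.univ.erase e₀) I then 1 else 0 := by
          split_ifs <;> norm_num
        have p1 : (0 : ℝ) ≤ if t e₀ ∈ nbr s t (Finset.univ.erase e₀) I then 1 else 0 := by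
          split_ifs <;> norm_num
        have p2 : (0 : ℝ) ≤ if s f ∈ nbr s t (Finset.univ.erase e₀) I then 1 else 0 := by
          split_ifs <;> norm_num
        have p3 : (0 : ℝ) ≤ if t f ∈ nbr s t (Finset.univ.erase e₀) I then 1 else 0 := by
          split_ifs <;> norm_num
        linarith)
  have hxn : ∀ e, e ∉ F1 → ((5 : ℝ)⁻¹ • (ind F1 + τ)) e = 0 := by
    intro e he
    simp [ind, he, hτF e he]
  have hxp : ∀ e, ((5 : ℝ)⁻¹ • (ind F1 + τ)) e = 0 → e = e₀ ∨ e = f := by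
    intro e he
    by_contra! h
    have h1 : e ∈ F1 := (hmem e).2 ⟨h.2, h.1⟩
    have h2 := hτ0 e
    simp [ind, h1] at he
    linarith
  set x := (5 : ℝ)⁻¹ • (ind F1 + τ) with hx
  have hx0 : ∀ e, 0 ≤ x e := fun e => by
    have h1 := ind_nonneg F1 e
    have h2 := hτ0 e
    simp only [hx, Pi.smul_apply, Pi.add_apply, smul_eq_mul]
    positivity
  have hdeg : ∀ w, degL s t w x = 1 := by
    intro w
    have := hG.cubic w
    rw [hx, map_smul, map_add, hτ, hind, map_sub, map_sub, this, smul_eq_mul]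
    ring
  have hcut := fun U (hU : Odd U.card) => cut_of_subset_bipartite (s := s) (t := t)
    (Y := U) (by rw [huniv]; exact Finset.subset_univ U) hJ hx0 hdeg
    (fun e he => hnb e fun h => he (hxn e (by simp [hmem, h])))
    (fun e he => huq e (fun h => he (hxn e (by simp [hmem, h])))
      fun h => he (hxn e (by simp [hmem, h]))) hU
  refine ⟨x, LinearMap.proj f, ⟨hx0, hdeg, fun U hU => (hcut U hU).1⟩,
    hxn e₀ (by simp [hmem]), fun d hd hd0 hdf => ?_⟩
  have hdx : ∀ e, x e = 0 → d e = 0 := fun e he => by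
    rcases hxp e he with rfl | rfl
    · exact hd0
    · exact hdf
  exact ⟨hdx, fun U hU hU1 => (hcut U hU).2 hU1 d hd hdx⟩

end BalancedBarrier

section NearBarrier

variable {V E : Type} [Fintype V] [Fintype E] {s t : E → V}

theorem nbr_union (F : Finset E) (A B : Finset V) :
    nbr s t F (A ∪ B) = nbr s t F A ∪ nbr s t F B := by
  ext w
  simp only [mem_nbr, Finset.mem_union]
  constructor
  · rintro ⟨e, he, ⟨h1, h2 | h2⟩ | ⟨h1, h2 | h2⟩⟩
    · exact .inl ⟨e, he, .inl ⟨h1, h2⟩⟩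
    · exact .inr ⟨e, he, .inl ⟨h1, h2⟩⟩
    · exact .inl ⟨e, he, .inr ⟨h1, h2⟩⟩
    · exact .inr ⟨e, he, .inr ⟨h1, h2⟩⟩
  · rintro (⟨e, he, ⟨h1, h2⟩ | ⟨h1, h2⟩⟩ | ⟨e, he, ⟨h1, h2⟩ | ⟨h1, h2⟩⟩)
    · exact ⟨e, he, .inl ⟨h1, .inl h2⟩⟩
    · exact ⟨e, he, .inr ⟨h1, .inl h2⟩⟩
    · exact ⟨e, he, .inl ⟨h1, .inr h2⟩⟩
    · exact ⟨e, he, .inr ⟨h1, .inr h2⟩⟩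

/-- The counting identity for a set containing both ends of the removed edge. -/
theorem barrier_identity (hG : CubicSparse s t) {e₀ : E} {J : Finset V}
    (hu : s e₀ ∈ J) (hv : t e₀ ∈ J) (hJ : Disjoint J (nbr s t (Finset.univ.erase e₀) J)) :
    3 * (nbr s t (Finset.univ.erase e₀) J).card + 2 = 3 * J.card +
      2 * ((Finset.univ.erase e₀).filter fun e =>
        s e ∈ nbr s t (Finset.univ.erase e₀) J ∧ t e ∈ nbr s t (Finset.univ.erase e₀) J).card +
      cutCard s t (J ∪ nbr s t (Finset.univ.erase e₀) J) := by
  have hid := card_nbr_identity hG e₀ hJ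
  have hud : ∀ w, w ∈ J → w ∉ nbr s t (Finset.univ.erase e₀) J := fun w h1 h2 =>
    Finset.disjoint_left.1 hJ h1 h2
  rw [btwL_self_ind] at hid
  simp only [Finset.mem_union, hu, hv, hud _ hu, hud _ hv, if_true, if_false, or_false,
    iff_self] at hid
  rify
  linarith

theorem near_barrier_structure (hG : CubicSparse s t) {e₀ : E} {J : Finset V}
    (hu : s e₀ ∈ J) (hv : t e₀ ∈ J) (hJ : Disjoint J (nbr s t (Finset.univ.erase e₀) J))
    (hcard : (nbr s t (Finset.univ.erase e₀) J).card = J.card + 1)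
    (hno : ∀ J' : Finset V, s e₀ ∈ J' → t e₀ ∈ J' →
      Disjoint J' (nbr s t (Finset.univ.erase e₀) J') →
      (nbr s t (Finset.univ.erase e₀) J').card ≠ J'.card) :
    Odd (J ∪ nbr s t (Finset.univ.erase e₀) J)ᶜ.card ∧
    1 < (J ∪ nbr s t (Finset.univ.erase e₀) J)ᶜ.card ∧
    cutCard s t (J ∪ nbr s t (Finset.univ.erase e₀) J)ᶜ = 5 ∧
    ∀ e, e ≠ e₀ → ¬ (s e ∈ nbr s t (Finset.univ.erase e₀) J ∧
      t e ∈ nbr s t (Finset.univ.erase e₀) J) := by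
  have hid := barrier_identity hG hu hv hJ
  have hnb : ∀ e, e ≠ e₀ → (s e ∈ J → t e ∈ nbr s t (Finset.univ.erase e₀) J) ∧
      (t e ∈ J → s e ∈ nbr s t (Finset.univ.erase e₀) J) := fun e he =>
    ind_support_nbr e (by simp [ind, he])
  have hJS := Finset.card_union_of_disjoint hJ
  set S := nbr s t (Finset.univ.erase e₀) J with hS
  have hodd : Odd (J ∪ S)ᶜ.card := hG.odd_compl ⟨J.card, by omega⟩
  have hJpos : 0 < J.card := Finset.card_pos.2 ⟨_, hu⟩
  have h1 : (J ∪ S)ᶜ.card ≠ 1 := by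
    intro h1
    obtain ⟨w, hw⟩ := Finset.card_eq_one.1 h1
    have hwK : w ∉ J ∧ w ∉ S := by
      have : w ∈ (J ∪ S)ᶜ := by rw [hw]; exact Finset.mem_singleton_self w
      simpa using this
    have hwn : nbr s t (Finset.univ.erase e₀) {w} ⊆ S := by
      intro a ha
      rw [mem_nbr] at ha
      obtain ⟨e, he, h⟩ := ha
      have hne : e ≠ e₀ := Finset.ne_of_mem_erase he
      simp only [Finset.mem_singleton] at h
      have hloop := hG.loopless e
      have haw : a ≠ w := by
        rintro rfl
        rcases h with h | h
        · exact hloop (h.1.trans h.2.symm)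
        · exact hloop (h.2.trans h.1.symm)
      have haJ : a ∉ J := by
        intro haJ
        rcases h with ⟨rfl, h⟩ | ⟨rfl, h⟩
        · exact hwK.2 (h ▸ (hnb e hne).1 haJ)
        · exact hwK.2 (h ▸ (hnb e hne).2 haJ)
      by_contra haS
      have : a ∈ (J ∪ S)ᶜ := by simp [haJ, haS]
      rw [hw] at this
      exact haw (Finset.mem_singleton.1 this)
    have hN : nbr s t (Finset.univ.erase e₀) (J ∪ {w}) = S := by
      rw [nbr_union, ← hS]
      exact Finset.union_eq_left.2 hwn
    refine hno (J ∪ {w}) (Finset.mem_union_left _ hu) (Finset.mem_union_left _ hv) ?_ ?_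
    · rw [hN, Finset.disjoint_union_left]
      exact ⟨hJ, Finset.disjoint_singleton_left.2 hwK.2⟩
    · rw [hN, Finset.card_union_of_disjoint (Finset.disjoint_singleton_right.2 hwK.1),
        Finset.card_singleton]
      exact hcard
  have hpos : 0 < (J ∪ S)ᶜ.card := hodd.pos
  have hc5 : 5 ≤ cutCard s t (J ∪ S)ᶜ := by
    refine hG.five_le_cutCard hodd (by omega) ?_
    rw [compl_compl]
    omega
  rw [cutCard_compl] at hc5
  refine ⟨hodd, by omega, ?_, ?_⟩
  · rw [cutCard_compl]; omega
  · intro e he h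
    have h0 : ((Finset.univ.erase e₀).filter fun e => s e ∈ S ∧ t e ∈ S).card = 0 := by omega
    rw [Finset.card_eq_zero] at h0
    have : e ∈ (Finset.univ.erase e₀).filter fun e => s e ∈ S ∧ t e ∈ S := by simp [he, h]
    rw [h0] at this
    simp at this

/-- Tight odd cuts of a weight that is bipartite outside an odd set with cut value one. -/
theorem near_barrier_cut (hG : CubicSparse s t) {e₀ : E} {J S : Finset V} (hJS : Disjoint J S)
    (hu : s e₀ ∈ J) (hv : t e₀ ∈ J)
    (hnb : ∀ e, e ≠ e₀ → (s e ∈ J → t e ∈ S) ∧ (t e ∈ J → s e ∈ S))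
    (hSS : ∀ e, e ≠ e₀ → ¬ (s e ∈ S ∧ t e ∈ S))
    (hodd : Odd (J ∪ S)ᶜ.card) (hc : cutCard s t (J ∪ S)ᶜ = 5)
    {x : E → ℝ} (hx0 : x e₀ = 0) (hx : ∀ e, e ≠ e₀ → 1 / 5 ≤ x e)
    (hxK : ∀ e, s e ∈ (J ∪ S)ᶜ → t e ∈ (J ∪ S)ᶜ → 1 / 4 ≤ x e)
    (hxc : ∀ e, ¬ (s e ∈ (J ∪ S)ᶜ ↔ t e ∈ (J ∪ S)ᶜ) → x e = 1 / 5)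
    (hdeg : ∀ w, degL s t w x = 1) {U : Finset V} (hU : Odd U.card) :
    1 ≤ cutL s t U x ∧ (cutL s t U x = 1 → ∀ d : E → ℝ, (∀ w, degL s t w d = 0) → d e₀ = 0 →
      cutL s t U d = 0) := by
  have hud : ∀ w, w ∈ J → w ∉ S := fun w h1 h2 => Finset.disjoint_left.1 hJS h1 h2
  have hKJ : ∀ w, w ∈ (J ∪ S)ᶜ ↔ w ∉ J ∧ w ∉ S := fun w => by simp
  have hSJ : ((J ∪ S)ᶜ)ᶜ = J ∪ S := compl_compl _
  set K := (J ∪ S)ᶜ with hK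
  have hxn : ∀ e, 0 ≤ x e := fun e => by
    by_cases h : e = e₀
    · rw [h, hx0]
    · linarith [hx e h]
  have hxz : ∀ e, x e ≠ 0 → e ≠ e₀ := fun e he h => he (h ▸ hx0)
  have hxe : ∀ e, x e = 0 → e = e₀ := fun e he => by
    by_contra h
    linarith [hx e h]
  have hcutK : cutL s t K x = 1 := by
    have : cutL s t K x = cutL s t K ((1 / 5 : ℝ) • (1 : E → ℝ)) :=
      cutL_congr fun e he => by simp [hxc e he]
    rw [this, map_smul, cutL_one, hc]
    norm_num
  have hdK : ∀ d : E → ℝ, (∀ w, degL s t w d = 0) → d e₀ = 0 → cutL s t K d = 0 := by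
    intro d hd hd0
    have h := sum_degL_eq_of_support (s := s) (t := t) hJS (y := d)
      fun e he => hnb e fun h => he (h ▸ hd0)
    rw [btwL_eq_zero (A := S) (B := S), ← hSJ, cutL_compl] at h
    · simp only [hd, Finset.sum_const_zero] at h
      linarith
    · intro e he
      by_cases h : e = e₀
      · rw [h, hd0]
      · exact absurd (by tauto) (hSS e h)
  -- odd subsets of `K`
  have hsub : ∀ W : Finset V, W ⊆ K → Odd W.card → 1 ≤ cutL s t W x ∧ (cutL s t W x = 1 →
      ∀ d : E → ℝ, (∀ w, degL s t w d = 0) → d e₀ = 0 → cutL s t W d = 0) := by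
    intro W hWK hW
    by_cases hWe : W = K
    · subst hWe
      exact ⟨hcutK.ge, fun _ d hd hd0 => hdK d hd hd0⟩
    by_cases hW1 : W.card = 1
    · obtain ⟨w, rfl⟩ := Finset.card_eq_one.1 hW1
      exact ⟨by rw [cutL_singleton hG.loopless, hdeg], fun _ d hd _ => by
        rw [cutL_singleton hG.loopless, hd]⟩
    have hW3 : 1 < W.card := by have := hW.pos; omega
    have hWc : 1 < Wᶜ.card := by
      refine Finset.one_lt_card.2 ⟨s e₀, ?_, t e₀, ?_, hG.loopless e₀⟩
      · exact Finset.mem_compl.2 fun h => ((hKJ _).1 (hWK h)).1 hu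
      · exact Finset.mem_compl.2 fun h => ((hKJ _).1 (hWK h)).1 hv
    have h5 := hG.five_le_cutCard hW hW3 hWc
    have hdisj : Disjoint W (K \ W) := Finset.disjoint_sdiff
    have hun : W ∪ K \ W = K := Finset.union_sdiff_of_subset hWK
    have hKW : 3 ≤ cutCard s t (K \ W) := by
      refine (hG.cutCard_eq_zero_or _).resolve_left fun h => ?_
      have hne : (K \ W).Nonempty := by
        rw [Finset.sdiff_nonempty]
        exact fun h => hWe (hWK.antisymm h)
      have := hG.eq_univ_of_cutCard_eq_zero hne h
      have h1 := Finset.mem_univ (s e₀)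
      rw [← this, Finset.mem_sdiff, hKJ] at h1
      exact h1.1.1 hu
    have hbt : 0 < btwL s t W (K \ W) 1 := by
      have h := cutL_union (s := s) (t := t) hdisj 1
      rw [hun, cutL_one, cutL_one, cutL_one, hc] at h
      have h1 : (5 : ℝ) ≤ cutCard s t W := by exact_mod_cast h5
      have h2 : (3 : ℝ) ≤ cutCard s t (K \ W) := by exact_mod_cast hKW
      push_cast at h
      linarith
    have hlt : 1 < cutL s t W x := by
      set z : E → ℝ := fun e => if (s e ∈ W ∧ t e ∈ K \ W) ∨ (s e ∈ K \ W ∧ t e ∈ W) then 1 else 0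
        with hz
      have hz0 : ∀ e, 0 ≤ z e := fun e => by simp only [hz]; split_ifs <;> norm_num
      have hle : ∀ e, ((1 / 5 : ℝ) • (1 - Pi.single e₀ 1) + (1 / 20 : ℝ) • z : E → ℝ) e ≤ x e := by
        intro e
        by_cases h : e = e₀
        · subst h
          have : z e = 0 := by
            simp only [hz]
            rw [if_neg]
            rintro (h | h)
            · exact ((hKJ _).1 (hWK h.1)).1 hu
            · exact ((hKJ _).1 (hWK h.2)).1 hv
          simp [this, hx0]
        · have h1 := hx e h
          simp only [Pi.add_apply, Pi.smul_apply, Pi.sub_apply, Pi.one_apply, smul_eq_mul,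
            Pi.single_eq_of_ne h, hz]
          split_ifs with h2
          · have h3 : 1 / 4 ≤ x e := by
              rcases h2 with h2 | h2
              · exact hxK e (hWK h2.1) (Finset.mem_sdiff.1 h2.2).1
              · exact hxK e (Finset.mem_sdiff.1 h2.1).1 (hWK h2.2)
            linarith
          · linarith
      have hm := cutL_mono (s := s) (t := t) hle W
      have hs : cutL s t W (Pi.single e₀ 1) = 0 := by
        rw [cutL_single, if_pos]
        exact iff_of_false (fun h => ((hKJ _).1 (hWK h)).1 hu) fun h => ((hKJ _).1 (hWK h)).1 hv
      rw [map_add, map_smul, map_smul, map_sub, cutL_one, hs, smul_eq_mul, smul_eq_mul] at hm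
      have h1 : (5 : ℝ) ≤ cutCard s t W := by exact_mod_cast h5
      have hzpos : 0 < cutL s t W z := by
        have h2 := cutL_union (s := s) (t := t) hdisj z
        have h3 : btwL s t W (K \ W) z = btwL s t W (K \ W) 1 := by
          rw [← sub_eq_zero, ← map_sub]
          refine btwL_eq_zero fun e he => ?_
          simp only [Pi.sub_apply, hz, Pi.one_apply]
          rw [if_pos he, sub_self]
        have h4 : cutL s t (K \ W) z = cutL s t W z := by
          simp only [cutL_apply]
          refine Finset.sum_congr rfl fun e _ => ?_
          by_cases h : (s e ∈ W ∧ t e ∈ K \ W) ∨ (s e ∈ K \ W ∧ t e ∈ W)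
          · have : (s e ∈ K \ W ↔ t e ∈ K \ W) ↔ (s e ∈ W ↔ t e ∈ W) := by
              simp only [Finset.mem_sdiff] at h ⊢
              tauto
            simp only [this]
          · have : z e = 0 := by simp only [hz]; rw [if_neg h]
            simp [this]
        have h5 := cutL_nonneg (s := s) (t := t) hz0 (W ∪ K \ W)
        linarith
      linarith
    exact ⟨hlt.le, fun h => absurd h hlt.ne'⟩
  -- odd sets meeting `K` in an odd set
  have main : ∀ U : Finset V, Odd U.card → Odd (U ∩ K).card → 1 ≤ cutL s t U x ∧
      (cutL s t U x = 1 →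
        ∀ d : E → ℝ, (∀ w, degL s t w d = 0) → d e₀ = 0 → cutL s t U d = 0) := by
    intro U hU hUK
    have hid := cutL_inter_add_union (s := s) (t := t) U K
    obtain ⟨ha, ha'⟩ := hsub (U ∩ K) Finset.inter_subset_right hUK
    have hY : (U ∪ K)ᶜ ⊆ J ∪ S := by
      rw [← hSJ]
      exact Finset.compl_subset_compl.2 Finset.subset_union_right
    have hYodd : Odd (U ∪ K)ᶜ.card := by
      refine hG.odd_compl ?_
      have := Finset.card_union_add_card_inter U K
      obtain ⟨a, h1⟩ := hU
      obtain ⟨b, h2⟩ := hodd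
      obtain ⟨c, h3⟩ := hUK
      exact ⟨a + b - c, by omega⟩
    obtain ⟨hb, hb'⟩ := cut_of_subset_bipartite (s := s) (t := t) hY hJS hxn hdeg
      (fun e he => hnb e (hxz e he)) (fun e he => hSS e (hxz e he)) hYodd
    rw [cutL_compl] at hb hb'
    have hbt := btwL_nonneg (s := s) (t := t) hxn (U \ K) (K \ U)
    have hidx := hid x
    refine ⟨by linarith, fun h1 d hd hd0 => ?_⟩
    have h2 : btwL s t (U \ K) (K \ U) d = 0 := btwL_eq_zero fun e he => by
      rw [hxe e (eq_zero_of_btwL_eq_zero hxn (by linarith) e he), hd0]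
    have hidd := hid d
    rw [ha' (by linarith) d hd hd0, hb' (by linarith) d hd fun e he => by rw [hxe e he, hd0],
      hdK d hd hd0, h2] at hidd
    linarith
  by_cases h : Odd (U ∩ K).card
  · exact main U hU h
  · have := main Uᶜ (hG.odd_compl hU) (by
      have h1 : (Uᶜ ∩ K).card + (U ∩ K).card = K.card := by
        rw [Finset.inter_comm Uᶜ, Finset.inter_comm U, ← Finset.sdiff_eq_inter_compl,
          Finset.card_sdiff_add_card_inter]
      obtain ⟨a, ha⟩ := hodd
      obtain ⟨b, hb⟩ := Nat.not_odd_iff_even.1 h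
      exact ⟨a - b, by omega⟩)
    rwa [cutL_compl] at this

end NearBarrier

section NearBarrierPoint

variable {V E : Type} [Fintype V] [Fintype E] {s t : E → V}

theorem ind_apply (F : Finset E) (e : E) : ind F e = if e ∈ F then (1 : ℝ) else 0 := rfl

theorem exists_outer_matching (hG : CubicSparse s t) {e₀ : E} {J S : Finset V}
    (hu : s e₀ ∈ J) (hv : t e₀ ∈ J) (hS : nbr s t (Finset.univ.erase e₀) J = S)
    (hJ : Disjoint J S) (hcard : S.card = J.card + 1) (hne : J ∪ S ≠ Finset.univ) (F : Finset E)
    (hF : ∀ e, e ∈ F ↔ e ≠ e₀ ∧ (s e ∈ J ∨ t e ∈ J)) :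
    ∃ τ : E → ℝ, (∀ e, 0 ≤ τ e) ∧ (∀ e ∉ F, τ e = 0) ∧
      ∀ w, degL s t w τ = if w ∈ J ∪ S then 2 + degL s t w (Pi.single e₀ 1) else 0 := by
  have hnb : ∀ e, e ≠ e₀ → (s e ∈ J → t e ∈ S) ∧ (t e ∈ J → s e ∈ S) := fun e he => by
    rw [← hS]
    exact ind_support_nbr e (by simp [ind, he])
  have hud : ∀ w, w ∈ J → w ∉ S := fun w h1 h2 => Finset.disjoint_left.1 hJ h1 h2
  have hnbr : ∀ I ⊆ J, nbr s t F I = nbr s t (Finset.univ.erase e₀) I := by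
    intro I hI
    ext w
    simp only [mem_nbr, hF, Finset.mem_erase, Finset.mem_univ, and_true]
    constructor
    · rintro ⟨e, ⟨he, _⟩, h⟩
      exact ⟨e, he, h⟩
    · rintro ⟨e, he, h⟩
      refine ⟨e, ⟨he, ?_⟩, h⟩
      rcases h with h | h
      · exact .inr (hI h.2)
      · exact .inl (hI h.2)
  have hsumb : ∀ I ⊆ J ∪ S, ∑ w ∈ I, (if w ∈ J ∪ S then 2 + degL s t w (Pi.single e₀ 1) else 0) =
      2 * I.card + ((if s e₀ ∈ I then (1 : ℝ) else 0) + (if t e₀ ∈ I then 1 else 0)) := by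
    intro I hI
    rw [Finset.sum_congr rfl fun w hw => if_pos (hI hw), Finset.sum_add_distrib, sum_degL_single,
      Finset.sum_const, nsmul_eq_mul]
    ring
  refine exists_fractional_matching_bipartite' F _ (fun w => ?_) hJ (fun e he => ?_)
    (fun w h1 h2 => by simp [h1, h2]) ?_ fun I hI => ?_
  · split_ifs
    · exact exists_nat_add ⟨2, rfl⟩ (exists_nat_degL_single w e₀)
    · exact ⟨0, by simp⟩
  · rw [hF] at he
    have := hnb e he.1
    tauto
  · rw [hsumb J Finset.subset_union_left, hsumb S Finset.subset_union_right, hcard]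
    simp only [hu, hv, hud _ hu, hud _ hv, if_true, if_false]
    push_cast
    ring
  · have hsub : nbr s t (Finset.univ.erase e₀) I ⊆ S := by
      rw [← hS]
      exact nbr_mono hI
    have h := two_mul_card_le hG hu hv (by rw [hS]; exact hJ) hI (fun h => hne (by
      rw [← Finset.univ_subset_iff, ← h]
      exact Finset.union_subset_union hI hsub))
    rw [hnbr I hI, hsumb I (hI.trans Finset.subset_union_left),
      hsumb _ (hsub.trans Finset.subset_union_right),
      if_neg fun h => hud _ hu (hsub h), if_neg fun h => hud _ hv (hsub h)]
    linarith

theorem exists_inner_matching (hG : CubicSparse s t) {e₀ : E} {J S : Finset V}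
    (hu : s e₀ ∈ J) (hv : t e₀ ∈ J) (hS : nbr s t (Finset.univ.erase e₀) J = S)
    (hJ : Disjoint J S) (hcard : S.card = J.card + 1)
    (hno : ∀ J' : Finset V, s e₀ ∈ J' → t e₀ ∈ J' →
      Disjoint J' (nbr s t (Finset.univ.erase e₀) J') →
      (nbr s t (Finset.univ.erase e₀) J').card ≠ J'.card)
    (hmax : ∀ J' : Finset V, s e₀ ∈ J' → t e₀ ∈ J' →
      Disjoint J' (nbr s t (Finset.univ.erase e₀) J') →
      (nbr s t (Finset.univ.erase e₀) J').card = J'.card + 1 → J'.card ≤ J.card)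
    (F : Finset E) (hF : ∀ e, e ∈ F ↔ s e ∈ (J ∪ S)ᶜ ∧ t e ∈ (J ∪ S)ᶜ)
    (F' : Finset E) (hF' : ∑ w ∈ (J ∪ S)ᶜ, degL s t w (ind F') = 5) :
    ∃ τ : E → ℝ, (∀ e, 0 ≤ τ e) ∧ (∀ e ∉ F, τ e = 0) ∧
      ∀ w, degL s t w τ = if w ∈ (J ∪ S)ᶜ then 5 + degL s t w (ind F') else 0 := by
  have hnb : ∀ e, e ≠ e₀ → (s e ∈ J → t e ∈ S) ∧ (t e ∈ J → s e ∈ S) := fun e he => by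
    rw [← hS]
    exact ind_support_nbr e (by simp [ind, he])
  have hud : ∀ w, w ∈ J → w ∉ S := fun w h1 h2 => Finset.disjoint_left.1 hJ h1 h2
  have hKJ : ∀ w, w ∈ (J ∪ S)ᶜ ↔ w ∉ J ∧ w ∉ S := fun w => by simp
  set K := (J ∪ S)ᶜ with hK
  have hk0 : ∀ w, 0 ≤ degL s t w (ind F') := fun w => degL_nonneg (ind_nonneg F') w
  refine exists_fractional_matching' F _ (fun w => ?_) fun I hI => ?_
  · split_ifs
    · exact exists_nat_add ⟨5, rfl⟩ (exists_nat_degL_ind F' w)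
    · exact ⟨0, by simp⟩
  have hsum : ∀ I : Finset V, ∑ w ∈ I, (if w ∈ K then 5 + degL s t w (ind F') else 0) =
      5 * (I ∩ K).card + ∑ w ∈ I ∩ K, degL s t w (ind F') := by
    intro I
    rw [← Finset.sum_filter, Finset.filter_mem_eq_inter, Finset.sum_add_distrib,
      Finset.sum_const, nsmul_eq_mul]
    ring
  rcases Finset.eq_empty_or_nonempty (I ∩ K) with hIe | hIne
  · rw [hsum I, hIe]
    simp only [Finset.card_empty, Nat.cast_zero, mul_zero, Finset.sum_empty, add_zero]
    exact Finset.sum_nonneg fun w _ => by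
      split_ifs
      · linarith [hk0 w]
      · exact le_rfl
  have hle : ∑ w ∈ I ∩ K, degL s t w (ind F') ≤ 5 := by
    rw [← hF']
    exact Finset.sum_le_sum_of_subset_of_nonneg Finset.inter_subset_right fun w _ _ => hk0 w
  have hge : 0 ≤ ∑ w ∈ nbr s t F I ∩ K, degL s t w (ind F') := Finset.sum_nonneg fun w _ => hk0 w
  have hcard2 : (I ∩ K).card + 1 ≤ (nbr s t F I ∩ K).card := by
    by_contra hlt
    have hIK : ∀ w, w ∈ I ∩ K → w ∈ I ∧ w ∉ J ∧ w ∉ S := fun w hw => by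
      rw [Finset.mem_inter, hKJ] at hw
      exact hw
    have hsub : nbr s t (Finset.univ.erase e₀) (J ∪ (I ∩ K)) ⊆ S ∪ (nbr s t F I ∩ K) := by
      rw [nbr_union, hS]
      refine Finset.union_subset_union subset_rfl ?_ |>.trans
        (Finset.union_subset Finset.subset_union_left subset_rfl)
      intro a ha
      obtain ⟨e, he, h⟩ := mem_nbr.1 ha
      have hne : e ≠ e₀ := Finset.ne_of_mem_erase he
      by_cases haS : a ∈ S
      · exact Finset.mem_union_left _ haS
      have haK : a ∈ K := by
        rw [hKJ]
        refine ⟨fun haJ => ?_, haS⟩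
        rcases h with ⟨rfl, h⟩ | ⟨rfl, h⟩
        · exact (hIK _ h).2.2 ((hnb e hne).1 haJ)
        · exact (hIK _ h).2.2 ((hnb e hne).2 haJ)
      refine Finset.mem_union_right _ (Finset.mem_inter.2 ⟨mem_nbr.2 ⟨e, ?_, ?_⟩, haK⟩)
      · rw [hF]
        rcases h with ⟨rfl, h⟩ | ⟨rfl, h⟩
        · exact ⟨haK, (Finset.mem_inter.1 h).2⟩
        · exact ⟨(Finset.mem_inter.1 h).2, haK⟩
      · rcases h with ⟨h1, h⟩ | ⟨h1, h⟩
        · exact .inl ⟨h1, (hIK _ h).1⟩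
        · exact .inr ⟨h1, (hIK _ h).1⟩
    have hu' : s e₀ ∈ J ∪ (I ∩ K) := Finset.mem_union_left _ hu
    have hv' : t e₀ ∈ J ∪ (I ∩ K) := Finset.mem_union_left _ hv
    have hd' : Disjoint (J ∪ (I ∩ K)) (nbr s t (Finset.univ.erase e₀) (J ∪ (I ∩ K))) := by
      refine Finset.disjoint_of_subset_right hsub ?_
      rw [Finset.disjoint_left]
      intro w hw hw'
      rw [Finset.mem_union] at hw hw'
      rcases hw with hw | hw
      · rcases hw' with hw' | hw'
        · exact hud w hw hw'
        · exact ((hKJ w).1 (Finset.mem_inter.1 hw').2).1 hw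
      · rcases hw' with hw' | hw'
        · exact (hIK w hw).2.2 hw'
        · exact Finset.disjoint_left.1 hI (hIK w hw).1 (Finset.mem_inter.1 hw').1
    have hdJ : Disjoint J (I ∩ K) := Finset.disjoint_left.2 fun w h1 h2 => (hIK w h2).2.1 h1
    have h1 := barrier_identity hG hu' hv' hd'
    have h2 := hno _ hu' hv' hd'
    have h3 := hmax _ hu' hv' hd'
    have h4 := (Finset.card_le_card hsub).trans (Finset.card_union_le _ _)
    rw [Finset.card_union_of_disjoint hdJ] at h1 h2 h3
    have h5 := hIne.card_pos
    omega
  refine le_trans (hsum I).le (le_trans ?_ (hsum (nbr s t F I)).ge)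
  have : ((I ∩ K).card : ℝ) + 1 ≤ (nbr s t F I ∩ K).card := by exact_mod_cast hcard2
  linarith

set_option maxHeartbeats 1000000 in
theorem hasGoodPoint_of_near_barrier (hG : CubicSparse s t) {e₀ : E} {J : Finset V}
    (hu : s e₀ ∈ J) (hv : t e₀ ∈ J) (hJ : Disjoint J (nbr s t (Finset.univ.erase e₀) J))
    (hcard : (nbr s t (Finset.univ.erase e₀) J).card = J.card + 1)
    (hno : ∀ J' : Finset V, s e₀ ∈ J' → t e₀ ∈ J' →
      Disjoint J' (nbr s t (Finset.univ.erase e₀) J') →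
      (nbr s t (Finset.univ.erase e₀) J').card ≠ J'.card)
    (hmax : ∀ J' : Finset V, s e₀ ∈ J' → t e₀ ∈ J' →
      Disjoint J' (nbr s t (Finset.univ.erase e₀) J') →
      (nbr s t (Finset.univ.erase e₀) J').card = J'.card + 1 → J'.card ≤ J.card) :
    HasGoodPoint s t e₀ := by
  obtain ⟨hKodd, hK1, hKc, hSS⟩ := near_barrier_structure hG hu hv hJ hcard hno
  obtain ⟨S, hS⟩ : ∃ S, nbr s t (Finset.univ.erase e₀) J = S := ⟨_, rfl⟩
  rw [hS] at hKodd hK1 hKc hSS hJ hcard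
  have hnb : ∀ e, e ≠ e₀ → (s e ∈ J → t e ∈ S) ∧ (t e ∈ J → s e ∈ S) := fun e he => by
    rw [← hS]
    exact ind_support_nbr e (by simp [ind, he])
  have hud : ∀ w, w ∈ J → w ∉ S := fun w h1 h2 => Finset.disjoint_left.1 hJ h1 h2
  have hne : J ∪ S ≠ Finset.univ := fun h => by
    rw [h] at hK1
    simp at hK1
  have hKJ : ∀ w, w ∈ (J ∪ S)ᶜ ↔ w ∉ J ∧ w ∉ S := fun w => by simp
  set FO : Finset E := Finset.univ.filter fun e => e ≠ e₀ ∧ (s e ∈ J ∨ t e ∈ J) with hFO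
  set FK : Finset E := Finset.univ.filter fun e => s e ∈ (J ∪ S)ᶜ ∧ t e ∈ (J ∪ S)ᶜ with hFK
  set FC : Finset E := Finset.univ.filter fun e => ¬ (s e ∈ (J ∪ S)ᶜ ↔ t e ∈ (J ∪ S)ᶜ) with hFC
  have hmO : ∀ e, e ∈ FO ↔ e ≠ e₀ ∧ (s e ∈ J ∨ t e ∈ J) := by simp [hFO]
  have hmK : ∀ e, e ∈ FK ↔ s e ∈ (J ∪ S)ᶜ ∧ t e ∈ (J ∪ S)ᶜ := by
    intro e; rw [hFK, Finset.mem_filter]; simp only [Finset.mem_univ, true_and]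
  have hmC : ∀ e, e ∈ FC ↔ ¬ (s e ∈ (J ∪ S)ᶜ ↔ t e ∈ (J ∪ S)ᶜ) := by
    intro e; rw [hFC, Finset.mem_filter]; simp only [Finset.mem_univ, true_and]
  -- the three classes partition the edges other than `e₀`
  have hpart : ∀ e, e ≠ e₀ → (e ∈ FO ∧ e ∉ FK ∧ e ∉ FC) ∨ (e ∉ FO ∧ e ∈ FK ∧ e ∉ FC) ∨
      (e ∉ FO ∧ e ∉ FK ∧ e ∈ FC) := by
    intro e he
    have h1 := hnb e he
    have h2 := hSS e he
    have h3 := hud (s e)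
    have h4 := hud (t e)
    rw [hmO, hmK, hmC, hKJ, hKJ]
    by_cases a1 : s e ∈ J <;> by_cases a2 : s e ∈ S <;> by_cases a3 : t e ∈ J <;>
      by_cases a4 : t e ∈ S <;> simp [a1, a2, a3, a4, he] at h1 h2 h3 h4 ⊢
  have he0 : e₀ ∉ FO ∧ e₀ ∉ FK ∧ e₀ ∉ FC := by
    rw [hmO, hmK, hmC, hKJ, hKJ]
    tauto
  have hsum : ind FO + ind FK + ind FC = 1 - Pi.single e₀ 1 := by
    rw [← ind_univ_erase]
    ext e
    by_cases he : e = e₀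
    · subst he
      simp [ind_apply, he0]
    · rcases hpart e he with h | h | h <;> simp [ind_apply, h, he]
  have hCsum : ∑ w ∈ (J ∪ S)ᶜ, degL s t w (ind FC) = 5 := by
    rw [sum_degL, btwL_eq_zero, zero_add]
    · have : cutL s t (J ∪ S)ᶜ (ind FC) = cutL s t (J ∪ S)ᶜ 1 := cutL_congr fun e he => by
        rw [ind_apply, if_pos ((hmC e).2 he), Pi.one_apply]
      rw [this, cutL_one, hKc]
      norm_num
    · intro e he
      rw [ind_apply, if_neg]
      rw [hmC]
      tauto
  obtain ⟨τ₁, hτ₁0, hτ₁F, hτ₁⟩ := exists_outer_matching hG hu hv hS hJ hcard hne FO hmO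
  obtain ⟨τ₂, hτ₂0, hτ₂F, hτ₂⟩ :=
    exists_inner_matching hG hu hv hS hJ hcard hno hmax FK hmK FC hCsum
  have hd : ∀ w, degL s t w (ind FO) + degL s t w (ind FK) + degL s t w (ind FC) =
      3 - degL s t w (Pi.single e₀ 1) := fun w => by
    rw [← map_add, ← map_add, hsum, map_sub, hG.cubic]
  obtain ⟨x, hx⟩ : ∃ x : E → ℝ, x = (1 / 5 : ℝ) • ind FC + (1 / 5 : ℝ) • (ind FO + τ₁) +
    (1 / 20 : ℝ) • ((5 : ℝ) • ind FK + τ₂) := ⟨_, rfl⟩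
  have hxe : ∀ e, x e = 1 / 5 * ind FC e + 1 / 5 * (ind FO e + τ₁ e) +
    1 / 20 * (5 * ind FK e + τ₂ e) := fun e => by
      rw [hx]; simp only [Pi.add_apply, Pi.smul_apply, smul_eq_mul]
  have hx0 : x e₀ = 0 := by
    rw [hxe]
    simp [ind_apply, he0, hτ₁F e₀ he0.1, hτ₂F e₀ he0.2.1]
  have hx5 : ∀ e, e ≠ e₀ → 1 / 5 ≤ x e := by
    intro e he
    have h1 := hτ₁0 e
    have h2 := hτ₂0 e
    rw [hxe]
    rcases hpart e he with h | h | h <;> simp only [ind_apply, h, if_true, if_false] <;> linarith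
  have hxK : ∀ e, s e ∈ (J ∪ S)ᶜ → t e ∈ (J ∪ S)ᶜ → 1 / 4 ≤ x e := by
    intro e h1 h2
    have hK := (hmK e).2 ⟨h1, h2⟩
    have h3 := hτ₁0 e
    have h4 := hτ₂0 e
    have h5 := ind_nonneg FC e
    have h6 := ind_nonneg FO e
    rw [hxe, ind_apply FK, if_pos hK]
    linarith
  have hxc : ∀ e, ¬ (s e ∈ (J ∪ S)ᶜ ↔ t e ∈ (J ∪ S)ᶜ) → x e = 1 / 5 := by
    intro e he
    have hC := (hmC e).2 he
    have hne : e ≠ e₀ := fun h => he0.2.2 (h ▸ hC)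
    have h : e ∉ FO ∧ e ∉ FK := by have := hpart e hne; tauto
    rw [hxe, hτ₁F e h.1, hτ₂F e h.2]
    simp [ind_apply, h, hC]
  have hdeg : ∀ w, degL s t w x = 1 := by
    intro w
    have h := hd w
    rw [hx]
    simp only [map_add, map_smul, smul_eq_mul, hτ₁, hτ₂]
    by_cases hw : w ∈ (J ∪ S)ᶜ
    · have hw' : w ∉ J ∪ S := Finset.mem_compl.1 hw
      rw [if_neg hw', if_pos hw]
      have hwJ := (hKJ w).1 hw
      have h1 : degL s t w (ind FO) = 0 := by
        have : degL s t w (ind FO) = degL s t w 0 := degL_congr fun e he => by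
          rw [ind_apply, if_neg, Pi.zero_apply]
          rw [hmO]
          rintro ⟨h1, h2⟩
          have := hnb e h1
          rcases he with rfl | rfl <;> tauto
        rw [this, map_zero]
      have h2 : degL s t w (Pi.single e₀ 1) = 0 := by
        rw [degL_single, if_neg (by rintro rfl; exact hwJ.1 hu),
          if_neg (by rintro rfl; exact hwJ.1 hv), add_zero]
      rw [h1, h2] at h
      rw [h1]
      linarith
    · have hw' : w ∈ J ∪ S := by
        by_contra h'
        exact hw (Finset.mem_compl.2 h')
      rw [if_pos hw', if_neg hw]
      have h1 : degL s t w (ind FK) = 0 := by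
        have : degL s t w (ind FK) = degL s t w 0 := degL_congr fun e he => by
          rw [ind_apply, if_neg, Pi.zero_apply]
          rw [hmK]
          rintro ⟨h1, h2⟩
          rcases he with rfl | rfl
          · exact hw h1
          · exact hw h2
        rw [this, map_zero]
      rw [h1] at h ⊢
      linarith
  have hcut := fun U (hU : Odd U.card) =>
    near_barrier_cut hG hJ hu hv hnb hSS hKodd hKc hx0 hx5 hxK hxc hdeg (U := U) hU
  refine ⟨x, 0, ⟨fun e => ?_, hdeg, fun U hU => (hcut U hU).1⟩, hx0, fun d hd hd0 _ =>
    ⟨fun e he => ?_, fun U hU hU1 => (hcut U hU).2 hU1 d hd hd0⟩⟩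
  · by_cases h : e = e₀
    · rw [h, hx0]
    · linarith [hx5 e h]
  · by_cases h : e = e₀
    · rw [h, hd0]
    · linarith [hx5 e h]

/-- A barrier around both ends of `e₀` yields a good point. -/
theorem hasGoodPoint_of_barrier (hG : CubicSparse s t) {e₀ : E}
    (h : ∃ J : Finset V, s e₀ ∈ J ∧ t e₀ ∈ J ∧ Disjoint J (nbr s t (Finset.univ.erase e₀) J) ∧
      ((nbr s t (Finset.univ.erase e₀) J).card = J.card ∨
        (nbr s t (Finset.univ.erase e₀) J).card = J.card + 1)) : HasGoodPoint s t e₀ := by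
  by_cases hb : ∃ J : Finset V, s e₀ ∈ J ∧ t e₀ ∈ J ∧
      Disjoint J (nbr s t (Finset.univ.erase e₀) J) ∧
      (nbr s t (Finset.univ.erase e₀) J).card = J.card
  · obtain ⟨J, hu, hv, hJ, hc⟩ := hb
    exact hasGoodPoint_of_card_eq hG hu hv hJ hc
  · push Not at hb
    obtain ⟨J₀, hu₀, hv₀, hJ₀, hc₀⟩ := h
    obtain ⟨J, hJ, hmax⟩ := Finset.exists_max_image
      (Finset.univ.filter fun J : Finset V => s e₀ ∈ J ∧ t e₀ ∈ J ∧
        Disjoint J (nbr s t (Finset.univ.erase e₀) J) ∧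
        (nbr s t (Finset.univ.erase e₀) J).card = J.card + 1) Finset.card
      ⟨J₀, Finset.mem_filter.2 ⟨Finset.mem_univ _, hu₀, hv₀, hJ₀,
        hc₀.resolve_left (hb J₀ hu₀ hv₀ hJ₀)⟩⟩
    obtain ⟨-, hu, hv, hJd, hc⟩ := Finset.mem_filter.1 hJ
    exact hasGoodPoint_of_near_barrier hG hu hv hJd hc hb fun J' h1 h2 h3 h4 =>
      hmax J' (Finset.mem_filter.2 ⟨Finset.mem_univ _, h1, h2, h3, h4⟩)

end NearBarrierPoint

section Base

variable {V E : Type} [Fintype V] [Fintype E] {s t : E → V}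

variable (s t) in
/-- The cut function of `U` vanishes on the directions allowed by the degrees and `e₀`. -/
def Implied (e₀ : E) (U : Finset V) : Prop :=
  ∀ d : E → ℝ, (∀ w, degL s t w d = 0) → d e₀ = 0 → cutL s t U d = 0

theorem implied_of_card_eq_one (hl : ∀ e, s e ≠ t e) {e₀ : E} {U : Finset V}
    (h : U.card = 1 ∨ Uᶜ.card = 1) : Implied s t e₀ U := by
  intro d hd _
  rcases h with h | h
  · obtain ⟨w, rfl⟩ := Finset.card_eq_one.1 h
    rw [cutL_singleton hl, hd]
  · obtain ⟨w, hw⟩ := Finset.card_eq_one.1 h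
    rw [← cutL_compl, hw, cutL_singleton hl, hd]

/-- Under the Hall-type condition there is a point with all weights off `e₀` at least `1/4`. -/
theorem exists_base_point (hG : CubicSparse s t) (e₀ : E)
    (h : ∀ I : Finset V, Disjoint I (nbr s t (Finset.univ.erase e₀) I) →
      (I.card : ℝ) + ((if s e₀ ∈ I then (1 : ℝ) else 0) + (if t e₀ ∈ I then 1 else 0)) ≤
        (nbr s t (Finset.univ.erase e₀) I).card +
          ((if s e₀ ∈ nbr s t (Finset.univ.erase e₀) I then (1 : ℝ) else 0) +
            (if t e₀ ∈ nbr s t (Finset.univ.erase e₀) I then 1 else 0))) :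
    ∃ x : E → ℝ, InQ s t x ∧ x e₀ = 0 ∧ (∀ e, e ≠ e₀ → 1 / 4 ≤ x e) ∧
      ∀ U : Finset V, Odd U.card → cutL s t U x = 1 → U.card = 1 ∨ Uᶜ.card = 1 ∨
        (¬ (s e₀ ∈ U ↔ t e₀ ∈ U) ∧ cutCard s t U = 5 ∧
          ∀ e, ¬ (s e ∈ U ↔ t e ∈ U) → e ≠ e₀ → x e = 1 / 4) := by
  have hsum : ∀ I : Finset V, ∑ w ∈ I, (1 + degL s t w (Pi.single e₀ 1)) =
      I.card + ((if s e₀ ∈ I then (1 : ℝ) else 0) + (if t e₀ ∈ I then 1 else 0)) := by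
    intro I
    rw [Finset.sum_add_distrib, sum_degL_single, Finset.sum_const, nsmul_eq_mul, mul_one]
  obtain ⟨τ, hτ0, hτF, hτ⟩ := exists_fractional_matching' (s := s) (t := t) (Finset.univ.erase e₀)
    (fun w => 1 + degL s t w (Pi.single e₀ 1))
    (fun w => exists_nat_add ⟨1, by simp⟩ (exists_nat_degL_single w e₀))
    (fun I hI => by rw [hsum, hsum]; exact h I hI)
  obtain ⟨x, hx⟩ : ∃ x : E → ℝ, x = (1 / 4 : ℝ) • ((1 - Pi.single e₀ 1) + τ) := ⟨_, rfl⟩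
  have hxe : ∀ e, e ≠ e₀ → x e = 1 / 4 * (1 + τ e) := fun e he => by
    rw [hx]; simp [he]
  have hx0 : x e₀ = 0 := by
    rw [hx]; simp [hτF e₀ (by simp)]
  have hx4 : ∀ e, e ≠ e₀ → 1 / 4 ≤ x e := fun e he => by
    have := hτ0 e
    rw [hxe e he]; linarith
  have hnn : ∀ e, 0 ≤ x e := fun e => by
    by_cases he : e = e₀
    · rw [he, hx0]
    · linarith [hx4 e he]
  have hdeg : ∀ w, degL s t w x = 1 := fun w => by
    rw [hx, map_smul, map_add, map_sub, hτ, hG.cubic, smul_eq_mul]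
    ring
  have hcutx : ∀ U : Finset V, cutL s t U x = 1 / 4 * (cutCard s t U -
      (if (s e₀ ∈ U ↔ t e₀ ∈ U) then (0 : ℝ) else 1) + cutL s t U τ) := fun U => by
    rw [hx, map_smul, map_add, map_sub, cutL_one, cutL_single, smul_eq_mul]
  have hodd : ∀ U : Finset V, Odd U.card → U.card ≠ 1 → Uᶜ.card ≠ 1 →
      (5 : ℝ) ≤ cutCard s t U := by
    intro U hU h1 h2
    have h3 := hU.pos
    have h4 := (hG.odd_compl hU).pos
    exact_mod_cast hG.five_le_cutCard hU (by omega) (by omega)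
  have hsing : ∀ U : Finset V, U.card = 1 ∨ Uᶜ.card = 1 → cutL s t U x = 1 := by
    rintro U (h | h)
    · obtain ⟨w, rfl⟩ := Finset.card_eq_one.1 h
      rw [cutL_singleton hG.loopless, hdeg]
    · obtain ⟨w, hw⟩ := Finset.card_eq_one.1 h
      rw [← cutL_compl, hw, cutL_singleton hG.loopless, hdeg]
  refine ⟨x, ⟨hnn, hdeg, fun U hU => ?_⟩, hx0, hx4, fun U hU hU1 => ?_⟩
  · by_cases h1 : U.card = 1 ∨ Uᶜ.card = 1
    · rw [hsing U h1]
    · rw [not_or] at h1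
      have h5 := hodd U hU h1.1 h1.2
      have hτU := cutL_nonneg (s := s) (t := t) hτ0 U
      rw [hcutx]
      split_ifs <;> linarith
  · by_cases h1 : U.card = 1
    · exact .inl h1
    by_cases h2 : Uᶜ.card = 1
    · exact .inr (.inl h2)
    have h5 := hodd U hU h1 h2
    have hτU := cutL_nonneg (s := s) (t := t) hτ0 U
    rw [hcutx] at hU1
    refine .inr (.inr ?_)
    split_ifs at hU1 with hs
    · linarith
    · have hτz : cutL s t U τ = 0 := by linarith
      refine ⟨hs, ?_, fun e he he0 => ?_⟩
      · have : (cutCard s t U : ℝ) = 5 := by linarith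
        exact_mod_cast this
      · rw [cutL_eq_btwL] at hτz
        have := eq_zero_of_btwL_eq_zero hτ0 hτz e (by simp only [Finset.mem_compl]; tauto)
        rw [hxe e he0, this]
        norm_num

/-- Inside a non-implied tight cut one can route a unit of degree to the end of `e₀`. -/
theorem exists_unit_flow (hG : CubicSparse s t) {e₀ : E} {x : E → ℝ}
    (hdeg : ∀ w, degL s t w x = 1) (hx0 : x e₀ = 0) {U : Finset V} (hc : cutCard s t U = 5)
    (hxU : ∀ e, ¬ (s e ∈ U ↔ t e ∈ U) → e ≠ e₀ → x e = 1 / 4) (hU : ¬ Implied s t e₀ U) {a : V}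
    (ha : a ∈ U) (hae : (s e₀ = a ∧ t e₀ ∉ U) ∨ (t e₀ = a ∧ s e₀ ∉ U)) :
    ∃ z : E → ℝ, (∀ e, z e ≠ 0 → s e ∈ U ∧ t e ∈ U) ∧
      ∀ w, degL s t w z = if w = a then 1 else 0 := by
  by_contra hno
  set D : (E → ℝ) →ₗ[ℝ] (V → ℝ) := LinearMap.pi fun w => degL s t w with hD
  set W : Submodule ℝ (E → ℝ) :=
    { carrier := {z | ∀ e, ¬ (s e ∈ U ∧ t e ∈ U) → z e = 0}
      add_mem' := fun {y z} hy hz e he => by simp [hy e he, hz e he]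
      zero_mem' := fun e _ => rfl
      smul_mem' := fun c z hz e he => by simp [hz e he] } with hW
  have hmem : (Pi.single a 1 : V → ℝ) ∉ W.map D := by
    rintro ⟨z, hz, hza⟩
    refine hno ⟨z, fun e he => ?_, fun w => ?_⟩
    · by_contra h
      exact he (hz e h)
    · have := congrFun hza w
      rw [Pi.single_apply] at this
      exact this
  obtain ⟨φ, hφa, hφ⟩ := Submodule.exists_le_ker_of_notMem hmem
  obtain ⟨q₀, hq₀⟩ : ∃ q₀ : V → ℝ, q₀ = fun w => -φ (Pi.single w 1) / φ (Pi.single a 1) := ⟨_, rfl⟩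
  have hq₀a : q₀ a = -1 := by rw [hq₀]; field_simp
  have hq₀e : ∀ e, s e ∈ U → t e ∈ U → q₀ (s e) = - q₀ (t e) := by
    intro e h1 h2
    have h3 : D (Pi.single e 1) ∈ W.map D := by
      refine ⟨_, fun f hf => ?_, rfl⟩
      rw [Pi.single_eq_of_ne]
      rintro rfl
      exact hf ⟨h1, h2⟩
    have h4 : D (Pi.single e 1) = Pi.single (s e) 1 + Pi.single (t e) 1 := by
      ext w
      simp only [hD, LinearMap.pi_apply, degL_single, Pi.add_apply, Pi.single_apply, eq_comm]
    have h5 : φ (D (Pi.single e 1)) = 0 := hφ h3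
    rw [h4, map_add] at h5
    rw [hq₀]
    simp only
    field_simp
    linarith
  -- truncate the potential
  obtain ⟨q, hq⟩ : ∃ q : V → ℝ, q = fun w => max (-1) (min 1 (q₀ w)) := ⟨_, rfl⟩
  have hqa : q a = -1 := by rw [hq]; simp [hq₀a]
  have hq1 : ∀ w, q w ≤ 1 := fun w => by rw [hq]; simp
  have hqe : ∀ e, s e ∈ U → t e ∈ U → q (s e) + q (t e) = 0 := by
    intro e h1 h2
    rw [hq]
    simp only
    rw [hq₀e e h1 h2]
    rcases le_total (-1) (q₀ (t e)) with h3 | h3 <;> rcases le_total (q₀ (t e)) 1 with h4 | h4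
    · rw [min_eq_right (by linarith), max_eq_right (by linarith), min_eq_right h4,
        max_eq_right h3]
      ring
    · rw [min_eq_right (by linarith), max_eq_left (by linarith), min_eq_left h4,
        max_eq_right (by norm_num)]
      ring
    · rw [min_eq_left (by linarith), max_eq_right (by norm_num), min_eq_right h4,
        max_eq_left h3]
      ring
    · linarith
  obtain ⟨r, hr⟩ : ∃ r : E → ℝ, r = fun e =>
      (if s e ∈ U then q (s e) else 0) + (if t e ∈ U then q (t e) else 0) := ⟨_, rfl⟩
  have hrsum : ∀ y : E → ℝ, ∑ w ∈ U, q w * degL s t w y = ∑ e, r e * y e := by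
    intro y
    simp only [degL_apply, Finset.mul_sum]
    rw [Finset.sum_comm]
    refine Finset.sum_congr rfl fun e _ => ?_
    simp only [← mul_assoc]
    rw [← Finset.sum_mul]
    congr 1
    simp only [mul_add, Finset.sum_add_distrib, mul_ite, mul_one, mul_zero, Finset.sum_ite_eq, hr]
  have hr0 : ∀ e, (s e ∈ U ↔ t e ∈ U) → r e = 0 := by
    intro e he
    rw [hr]
    simp only
    by_cases h1 : s e ∈ U
    · rw [if_pos h1, if_pos (he.1 h1), hqe e h1 (he.1 h1)]
    · rw [if_neg h1, if_neg fun h => h1 (he.2 h), add_zero]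
  have hr1 : ∀ e, r e ≤ if (s e ∈ U ↔ t e ∈ U) then (0 : ℝ) else 1 := by
    intro e
    by_cases he : (s e ∈ U ↔ t e ∈ U)
    · rw [if_pos he, hr0 e he]
    · rw [if_neg he, hr]
      simp only
      by_cases h1 : s e ∈ U
      · rw [if_pos h1, if_neg fun h => he (by tauto), add_zero]
        exact hq1 _
      · rw [if_neg h1, zero_add, if_pos (by tauto)]
        exact hq1 _
  have hre : r e₀ = -1 := by
    rw [hr]
    rcases hae with ⟨h1, h2⟩ | ⟨h1, h2⟩ <;> simp [h1, h2, ha, hqa]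
  have hsep : ¬ (s e₀ ∈ U ↔ t e₀ ∈ U) := by
    rcases hae with ⟨rfl, h2⟩ | ⟨rfl, h2⟩ <;> tauto
  have hX := hrsum x
  have hO := hrsum 1
  simp only [hdeg, hG.cubic, mul_one, Pi.one_apply] at hX hO
  rw [← Finset.sum_mul] at hO
  have hX4 : 4 * ∑ e, r e * x e = ∑ e, r e + 1 := by
    have : ∑ e, r e * (4 * x e - 1) = 1 := by
      rw [Finset.sum_eq_single e₀]
      · rw [hre, hx0]; norm_num
      · intro e _ he
        by_cases h : (s e ∈ U ↔ t e ∈ U)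
        · rw [hr0 e h, zero_mul]
        · rw [hxU e h he]; norm_num
      · simp
    rw [Finset.mul_sum, ← sub_eq_iff_eq_add', ← Finset.sum_sub_distrib, ← this]
    exact Finset.sum_congr rfl fun e _ => by ring
  have hc' := cutL_one (s := s) (t := t) U
  rw [hc, cutL_apply] at hc'
  simp only [Pi.one_apply, mul_one] at hc'
  have hrest : ∑ e ∈ Finset.univ.erase e₀,
      ((if (s e ∈ U ↔ t e ∈ U) then (0 : ℝ) else 1) - r e) = 0 := by
    have := Finset.add_sum_erase Finset.univ
      (fun e => (if (s e ∈ U ↔ t e ∈ U) then (0 : ℝ) else 1) - r e) (Finset.mem_univ e₀)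
    have htot : ∑ e, ((if (s e ∈ U ↔ t e ∈ U) then (0 : ℝ) else 1) - r e) = 5 - ∑ e, r e := by
      rw [Finset.sum_sub_distrib, hc']
      norm_num
    rw [htot, if_neg hsep, hre] at this
    linarith
  rw [Finset.sum_eq_zero_iff_of_nonneg fun e _ => sub_nonneg.2 (hr1 e)] at hrest
  refine hU fun d hd hd0 => ?_
  have h1 := hrsum d
  simp only [hd, mul_zero, Finset.sum_const_zero] at h1
  rw [cutL_apply]
  refine Eq.trans (Finset.sum_congr rfl fun e _ => ?_) h1.symm
  by_cases he : e = e₀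
  · rw [he, hd0, mul_zero, mul_zero]
  · rw [sub_eq_zero.1 (hrest e (by simp [he]))]

end Base

section Extremal

variable {V E : Type} [Fintype V] [Fintype E] {s t : E → V}

variable (s t) in
/-- The odd tight cuts through `e₀` that are not implied. -/
def tightSets (e₀ : E) (x : E → ℝ) : Finset (Finset V) :=
  Finset.univ.filter fun U =>
    Odd U.card ∧ s e₀ ∈ U ∧ t e₀ ∉ U ∧ cutL s t U x = 1 ∧ ¬ Implied s t e₀ U

theorem mem_tightSets {e₀ : E} {x : E → ℝ} {U : Finset V} : U ∈ tightSets s t e₀ x ↔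
    Odd U.card ∧ s e₀ ∈ U ∧ t e₀ ∉ U ∧ cutL s t U x = 1 ∧ ¬ Implied s t e₀ U := by
  simp [tightSets]

theorem implied_compl {e₀ : E} {U : Finset V} : Implied s t e₀ Uᶜ ↔ Implied s t e₀ U := by
  unfold Implied
  rw [cutL_compl]

variable (s t) in
/-- Points positive off `e₀` whose non-trivial tight odd cuts are `5`-cuts through `e₀`. -/
structure IsStructured (e₀ : E) (x : E → ℝ) : Prop where
  inQ : InQ s t x
  zero : x e₀ = 0
  pos : ∀ e, e ≠ e₀ → 0 < x e
  tight : ∀ U : Finset V, Odd U.card → cutL s t U x = 1 → U.card = 1 ∨ Uᶜ.card = 1 ∨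
    (¬ (s e₀ ∈ U ↔ t e₀ ∈ U) ∧ cutCard s t U = 5)

theorem IsStructured.tight_cases {e₀ : E} {x : E → ℝ} (hx : IsStructured s t e₀ x)
    (hl : ∀ e, s e ≠ t e) {U : Finset V} (hU : Odd U.card) (h1 : cutL s t U x = 1) :
    Implied s t e₀ U ∨ U ∈ tightSets s t e₀ x ∨ Uᶜ ∈ tightSets s t e₀ x := by
  by_cases hi : Implied s t e₀ U
  · exact .inl hi
  rcases hx.tight U hU h1 with h | h | ⟨h, -⟩
  · exact .inl (implied_of_card_eq_one hl (.inl h))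
  · exact .inl (implied_of_card_eq_one hl (.inr h))
  · simp only [mem_tightSets, Finset.mem_compl, not_not, cutL_compl, implied_compl]
    have := hx.inQ.odd_compl hU
    by_cases h2 : s e₀ ∈ U
    · exact .inr (.inl ⟨hU, h2, by tauto, h1, hi⟩)
    · exact .inr (.inr ⟨this, h2, by tauto, h1, hi⟩)

theorem IsStructured.cutCard_eq {e₀ : E} {x : E → ℝ} (hx : IsStructured s t e₀ x)
    (hl : ∀ e, s e ≠ t e) {U : Finset V} (hU : U ∈ tightSets s t e₀ x) : cutCard s t U = 5 := by
  obtain ⟨h1, h2, h3, h4, h5⟩ := mem_tightSets.1 hU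
  rcases hx.tight U h1 h4 with h | h | h
  · exact absurd (implied_of_card_eq_one hl (.inl h)) h5
  · exact absurd (implied_of_card_eq_one hl (.inr h)) h5
  · exact h.2

variable (s t) in
/-- Structured points whose non-implied tight cuts cannot be relaxed. -/
structure IsExtremal (e₀ : E) (x : E → ℝ) : Prop extends IsStructured s t e₀ x where
  rigid : ∀ y : E → ℝ, (∀ w, degL s t w y = 1) → y e₀ = 0 →
    (∀ U ∈ tightSets s t e₀ x, 1 ≤ cutL s t U y) → ∀ U ∈ tightSets s t e₀ x, cutL s t U y = 1

theorem IsStructured.exists_fewer_tight {e₀ : E} {x y : E → ℝ} (hx : IsStructured s t e₀ x)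
    (hl : ∀ e, s e ≠ t e) (hy : ∀ w, degL s t w y = 1) (hy0 : y e₀ = 0)
    (hyU : ∀ U ∈ tightSets s t e₀ x, 1 ≤ cutL s t U y) {U₀ : Finset V}
    (hU₀ : U₀ ∈ tightSets s t e₀ x) (hne : cutL s t U₀ y ≠ 1) :
    ∃ z : E → ℝ, InQ s t z ∧ z e₀ = 0 ∧ (∀ e, e ≠ e₀ → 0 < z e) ∧
      tightSets s t e₀ z ⊂ tightSets s t e₀ x := by
  have hd : ∀ w, degL s t w (y - x) = 0 := fun w => by rw [map_sub, hy, hx.inQ.deg, sub_self]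
  have hd0 : (y - x) e₀ = 0 := by rw [Pi.sub_apply, hy0, hx.zero, sub_self]
  obtain ⟨ε, he, -, hc⟩ := exists_pos_step (ι := E ⊕ Finset V)
    (Sum.elim x fun U => if Odd U.card then cutL s t U x - 1 else 0)
    (Sum.elim (y - x) fun U => if Odd U.card then cutL s t U (y - x) else 0) (by
      rintro (e | U)
      · simp only [Sum.elim_inl]
        by_cases h : e = e₀
        · rw [h, hd0]
          exact .inr ⟨hx.zero, le_rfl⟩
        · exact .inl (hx.pos e h)
      · simp only [Sum.elim_inr]
        by_cases hU : Odd U.card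
        · simp only [if_pos hU]
          rcases (hx.inQ.cut U hU).lt_or_eq with h | h
          · exact .inl (by linarith)
          · refine .inr ⟨by linarith, ?_⟩
            rcases hx.tight_cases hl hU h.symm with h1 | h1 | h1
            · rw [h1 _ hd hd0]
            · have := hyU _ h1
              rw [map_sub]
              linarith
            · have := hyU _ h1
              rw [cutL_compl] at this
              rw [map_sub]
              linarith
        · simp [hU])
  have hcut : ∀ U : Finset V, Odd U.card → 0 ≤ cutL s t U x - 1 + ε * cutL s t U (y - x) ∧
      (0 < cutL s t U x - 1 → 0 < cutL s t U x - 1 + ε * cutL s t U (y - x)) := by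
    intro U hU
    have := hc (Sum.inr U)
    simpa only [Sum.elim_inr, if_pos hU] using this
  have hz : ∀ U, cutL s t U (x + ε • (y - x)) = cutL s t U x + ε * cutL s t U (y - x) := by
    intro U
    rw [map_add, map_smul, smul_eq_mul]
  refine ⟨x + ε • (y - x), ⟨fun e => by simpa using (hc (Sum.inl e)).1, fun w => ?_, fun U hU => ?_⟩,
    ?_, fun e hne => by simpa using (hc (Sum.inl e)).2 (by simpa using hx.pos e hne), ?_⟩
  · rw [map_add, map_smul, hd, hx.inQ.deg, smul_zero, add_zero]
  · rw [hz]
    linarith [(hcut U hU).1]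
  · rw [Pi.add_apply, Pi.smul_apply, hd0, hx.zero, smul_zero, add_zero]
  · refine Finset.ssubset_iff_of_subset (fun U hU => ?_) |>.2 ⟨U₀, hU₀, fun h => ?_⟩
    · obtain ⟨h1, h2, h3, h4, h5⟩ := mem_tightSets.1 hU
      refine mem_tightSets.2 ⟨h1, h2, h3, ?_, h5⟩
      by_contra h6
      have h7 := (hcut U h1).2 (by
        have := (hx.inQ.cut U h1).lt_of_ne' h6
        linarith)
      rw [hz] at h4
      linarith
    · obtain ⟨-, -, -, h4, -⟩ := mem_tightSets.1 h
      obtain ⟨-, -, -, h5, -⟩ := mem_tightSets.1 hU₀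
      rw [hz, map_sub, h5] at h4
      have : ε * (cutL s t U₀ y - 1) = 0 := by linarith
      rcases mul_eq_zero.1 this with h6 | h6
      · exact he.ne' h6
      · exact hne (by linarith)

/-- The Hall-type condition gives an extremal point, with a base point to compare it to. -/
theorem exists_extremal (hG : CubicSparse s t) (e₀ : E)
    (h : ∀ I : Finset V, Disjoint I (nbr s t (Finset.univ.erase e₀) I) →
      (I.card : ℝ) + ((if s e₀ ∈ I then (1 : ℝ) else 0) + (if t e₀ ∈ I then 1 else 0)) ≤
        (nbr s t (Finset.univ.erase e₀) I).card +
          ((if s e₀ ∈ nbr s t (Finset.univ.erase e₀) I then (1 : ℝ) else 0) +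
            (if t e₀ ∈ nbr s t (Finset.univ.erase e₀) I then 1 else 0))) :
    ∃ x x₀ : E → ℝ, IsExtremal s t e₀ x ∧ (∀ w, degL s t w x₀ = 1) ∧ x₀ e₀ = 0 ∧
      ∀ U ∈ tightSets s t e₀ x, ∀ e, ¬ (s e ∈ U ↔ t e ∈ U) → e ≠ e₀ → x₀ e = 1 / 4 := by
  obtain ⟨x₀, hQ, h0, hpos, htight⟩ := exists_base_point hG e₀ h
  obtain ⟨x₁, ⟨hQ₁, h0₁, hpos₁⟩, hmin⟩ :=
    (measure fun x : E → ℝ => (tightSets s t e₀ x).card).wf.has_min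
      {x | InQ s t x ∧ x e₀ = 0 ∧ ∀ e, e ≠ e₀ → 0 < x e}
      ⟨x₀, hQ, h0, fun e he => lt_of_lt_of_le (by norm_num) (hpos e he)⟩
  obtain ⟨x, hx⟩ : ∃ x : E → ℝ, x = (1 / 2 : ℝ) • (x₀ + x₁) := ⟨_, rfl⟩
  have hxe : ∀ e, x e = 1 / 2 * (x₀ e + x₁ e) := fun e => by rw [hx]; simp
  have hxU : ∀ U, cutL s t U x = 1 / 2 * (cutL s t U x₀ + cutL s t U x₁) := fun U => by
    rw [hx, map_smul, map_add, smul_eq_mul]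
  have hxT : ∀ U, Odd U.card → cutL s t U x = 1 → cutL s t U x₀ = 1 ∧ cutL s t U x₁ = 1 := by
    intro U hU h1
    rw [hxU] at h1
    have h2 := hQ.cut U hU
    have h3 := hQ₁.cut U hU
    constructor <;> linarith
  have hst : IsStructured s t e₀ x := by
    refine ⟨⟨fun e => ?_, fun w => ?_, fun U hU => ?_⟩, ?_, fun e he => ?_, fun U hU h1 => ?_⟩
    · rw [hxe]
      linarith [hQ.nonneg e, hQ₁.nonneg e]
    · rw [hx, map_smul, map_add, hQ.deg, hQ₁.deg, smul_eq_mul]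
      norm_num
    · rw [hxU]
      linarith [hQ.cut U hU, hQ₁.cut U hU]
    · rw [hxe, h0, h0₁]
      norm_num
    · rw [hxe]
      linarith [hpos e he, hpos₁ e he]
    · rcases htight U hU (hxT U hU h1).1 with h2 | h2 | ⟨h2, h3, -⟩
      · exact .inl h2
      · exact .inr (.inl h2)
      · exact .inr (.inr ⟨h2, h3⟩)
  have hsub : tightSets s t e₀ x ⊆ tightSets s t e₀ x₁ := by
    intro U hU
    obtain ⟨h1, h2, h3, h4, h5⟩ := mem_tightSets.1 hU
    exact mem_tightSets.2 ⟨h1, h2, h3, (hxT U h1 h4).2, h5⟩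
  refine ⟨x, x₀, ⟨hst, fun y hy hy0 hyU U hU => ?_⟩, hQ.deg, h0, fun U hU e he hne => ?_⟩
  · by_contra hne
    obtain ⟨z, hz, hz0, hzpos, hlt⟩ :=
      hst.exists_fewer_tight hG.loopless hy hy0 hyU hU hne
    exact hmin z ⟨hz, hz0, hzpos⟩ (Finset.card_lt_card (hlt.trans_subset hsub))
  · obtain ⟨h1, h2, h3, h4, h5⟩ := mem_tightSets.1 hU
    rcases htight U h1 (hxT U h1 h4).1 with h6 | h6 | ⟨-, -, h6⟩
    · exact absurd (implied_of_card_eq_one hG.loopless (.inl h6)) h5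
    · exact absurd (implied_of_card_eq_one hG.loopless (.inr h6)) h5
    · exact h6 e he hne

end Extremal

section Uncross

variable {V E : Type} [Fintype V] [Fintype E] {s t : E → V}

theorem btwL_single {A B : Finset V} (h : Disjoint A B) {e₀ : E} (hs : s e₀ ∈ A) (ht : t e₀ ∈ B) :
    btwL s t A B (Pi.single e₀ 1) = 1 := by
  have hs' : s e₀ ∉ B := Finset.disjoint_left.1 h hs
  rw [btwL_apply, Finset.sum_eq_single e₀]
  · simp [hs, ht, hs']
  · intro e _ he
    rw [Pi.single_eq_of_ne he, mul_zero]
  · simp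

theorem CubicSparse.even_cutCard (hG : CubicSparse s t) {U : Finset V} (hU : Even U.card) :
    Even (cutCard s t U) := by
  obtain ⟨k, hk⟩ := hG.three_mul_card U
  obtain ⟨a, ha⟩ := hU
  exact ⟨3 * a - k, by omega⟩

theorem CubicSparse.cutCard_eq_three (hG : CubicSparse s t) {U : Finset V}
    (h : U.card = 1 ∨ Uᶜ.card = 1) : cutCard s t U = 3 := by
  rcases h with h | h
  · obtain ⟨w, rfl⟩ := Finset.card_eq_one.1 h
    exact hG.cutL_singleton_one
  · obtain ⟨w, hw⟩ := Finset.card_eq_one.1 h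
    rw [← cutCard_compl, hw]
    exact hG.cutL_singleton_one

theorem IsStructured.cutCard_le {e₀ : E} {x : E → ℝ} (hx : IsStructured s t e₀ x)
    (hG : CubicSparse s t) {U : Finset V} (hU : Odd U.card) (h1 : cutL s t U x = 1) :
    cutCard s t U ≤ 5 := by
  rcases hx.tight U hU h1 with h | h | h
  · rw [hG.cutCard_eq_three (.inl h)]
    norm_num
  · rw [hG.cutCard_eq_three (.inr h)]
    norm_num
  · exact h.2.le

theorem IsStructured.card_eq_one {e₀ : E} {x : E → ℝ} (hx : IsStructured s t e₀ x)
    (hl : ∀ e, s e ≠ t e) {U : Finset V} (hU : Odd U.card) (h1 : cutL s t U x = 1)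
    (hs : s e₀ ∉ U) (ht : t e₀ ∉ U) : U.card = 1 := by
  rcases hx.tight U hU h1 with h | h | h
  · exact h
  · obtain ⟨w, hw⟩ := Finset.card_eq_one.1 h
    have h2 : s e₀ ∈ Uᶜ := Finset.mem_compl.2 hs
    have h3 : t e₀ ∈ Uᶜ := Finset.mem_compl.2 ht
    rw [hw, Finset.mem_singleton] at h2 h3
    exact absurd (h2.trans h3.symm) (hl e₀)
  · tauto

/-- Uncrossing two tight `5`-cuts through `e₀`. -/
theorem IsStructured.uncross {e₀ : E} {x : E → ℝ} (hx : IsStructured s t e₀ x)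
    (hG : CubicSparse s t) {U W : Finset V} (hU : U ∈ tightSets s t e₀ x)
    (hW : W ∈ tightSets s t e₀ x) :
    Odd (U ∩ W).card ∧ Odd (U ∪ W).card ∧ cutL s t (U ∩ W) x = 1 ∧ cutL s t (U ∪ W) x = 1 ∧
      ∀ d, cutL s t U d + cutL s t W d = cutL s t (U ∩ W) d + cutL s t (U ∪ W) d := by
  have hcU := hx.cutCard_eq hG.loopless hU
  have hcW := hx.cutCard_eq hG.loopless hW
  obtain ⟨hU1, hU2, hU3, hU4, -⟩ := mem_tightSets.1 hU
  obtain ⟨hW1, hW2, hW3, hW4, -⟩ := mem_tightSets.1 hW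
  have k1 := Finset.card_inter_add_card_sdiff U W
  have k2 := Finset.card_inter_add_card_sdiff W U
  have k3 := Finset.card_union_add_card_inter U W
  rw [Finset.inter_comm] at k2
  have hodd : Odd (U ∩ W).card := by
    by_contra h
    rw [Nat.not_odd_iff_even] at h
    have o1 : Odd (U \ W).card := by
      rw [← k1] at hU1
      exact (Nat.odd_add'.1 hU1).2 h
    have o2 : Odd (W \ U).card := by
      rw [← k2] at hW1
      exact (Nat.odd_add'.1 hW1).2 h
    have i1 := cutL_sdiff_add_sdiff s t U W x
    have i2 := hx.inQ.cut _ o1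
    have i3 := hx.inQ.cut _ o2
    have i4 := btwL_nonneg (s := s) (t := t) hx.inQ.nonneg (U ∩ W) (U ∪ W)ᶜ
    have c1 := hG.cutCard_eq_three (.inl (hx.card_eq_one hG.loopless o1 (by linarith)
      (by simp [hW2]) (by simp [hU3])))
    have c2 := hG.cutCard_eq_three (.inl (hx.card_eq_one hG.loopless o2 (by linarith)
      (by simp [hU2]) (by simp [hW3])))
    have i5 : btwL s t (U ∩ W) (U ∪ W)ᶜ x = 0 := by linarith
    have i6 : btwL s t (U ∩ W) (U ∪ W)ᶜ (1 - Pi.single e₀ 1) = 0 := by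
      refine btwL_eq_zero fun e he => ?_
      have := eq_zero_of_btwL_eq_zero hx.inQ.nonneg i5 e he
      have he0 : e = e₀ := by
        by_contra hne
        exact (hx.pos e hne).ne' this
      rw [he0]
      simp
    rw [map_sub, btwL_single (by
      rw [Finset.disjoint_left]
      intro w hw
      simp only [Finset.mem_inter] at hw
      simp [hw.1]) (by simp [hU2, hW2]) (by simp [hU3, hW3]), sub_eq_zero] at i6
    have i7 := cutL_sdiff_add_sdiff s t U W 1
    rw [i6, cutL_one, cutL_one, cutL_one, cutL_one, hcU, hcW, c1, c2] at i7
    norm_num at i7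
  have hodd' : Odd (U ∪ W).card := by
    obtain ⟨a, ha⟩ := hU1
    obtain ⟨b, hb⟩ := hW1
    obtain ⟨c, hc⟩ := hodd
    exact ⟨a + b - c, by omega⟩
  have i1 := cutL_inter_add_union s t U W x
  have i2 := hx.inQ.cut _ hodd
  have i3 := hx.inQ.cut _ hodd'
  have i4 := btwL_nonneg (s := s) (t := t) hx.inQ.nonneg (U \ W) (W \ U)
  refine ⟨hodd, hodd', by linarith, by linarith, fun d => ?_⟩
  rw [cutL_inter_add_union, btwL_eq_zero, mul_zero, add_zero]
  intro e he
  have := eq_zero_of_btwL_eq_zero hx.inQ.nonneg (by linarith) e he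
  by_cases hne : e = e₀
  · rw [hne] at he
    simp [hU2, hU3, hW2, hW3] at he
  · exact absurd this (hx.pos e hne).ne'

theorem IsStructured.card_sdiff_eq_two {e₀ : E} {x : E → ℝ} (hx : IsStructured s t e₀ x)
    (hG : CubicSparse s t) {U W : Finset V} (hU : U ∈ tightSets s t e₀ x)
    (hW : W ∈ tightSets s t e₀ x) (h1 : ¬ U ⊆ W) (h2 : ¬ W ⊆ U) :
    (U \ W).card = 2 ∧ (W \ U).card = 2 := by
  obtain ⟨hodd, hodd', t1, t2, hid⟩ := hx.uncross hG hU hW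
  have hcU := hx.cutCard_eq hG.loopless hU
  have hcW := hx.cutCard_eq hG.loopless hW
  obtain ⟨hU1, hU2, hU3, hU4, -⟩ := mem_tightSets.1 hU
  obtain ⟨hW1, hW2, hW3, hW4, -⟩ := mem_tightSets.1 hW
  have k1 := Finset.card_inter_add_card_sdiff U W
  have k2 := Finset.card_inter_add_card_sdiff W U
  rw [Finset.inter_comm] at k2
  have hle : cutCard s t (U \ W) + cutCard s t (W \ U) ≤ 8 := by
    have i7 := cutL_sdiff_add_sdiff s t U W 1
    have i8 := btwL_mono (s := s) (t := t) (x := Pi.single e₀ 1) (y := 1) (fun e => by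
      rw [Pi.single_apply]
      split_ifs <;> simp) (U ∩ W) (U ∪ W)ᶜ
    rw [btwL_single (by
      rw [Finset.disjoint_left]
      intro w hw
      simp only [Finset.mem_inter] at hw
      simp [hw.1]) (by simp [hU2, hW2]) (by simp [hU3, hW3])] at i8
    rw [cutL_one, cutL_one, cutL_one, cutL_one, hcU, hcW] at i7
    have : (cutCard s t (U \ W) : ℝ) + cutCard s t (W \ U) ≤ 8 := by
      push_cast at i7
      linarith
    exact_mod_cast this
  obtain ⟨p, hp⟩ := Finset.not_subset.1 h1
  obtain ⟨q, hq⟩ := Finset.not_subset.1 h2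
  have key : ∀ A : Finset V, A.Nonempty → Even A.card → s e₀ ∉ A → t e₀ ∉ A →
      (∃ r, r ∉ A ∧ r ≠ s e₀ ∧ r ≠ t e₀) →
      4 ≤ cutCard s t A ∧ (cutCard s t A ≤ 4 → A.card = 2) := by
    intro A hA hev hs ht ⟨r, hr, hrs, hrt⟩
    have h4 : 4 ≤ cutCard s t A := by
      obtain ⟨k, hk⟩ := hG.even_cutCard hev
      rcases hG.cutCard_eq_zero_or A with h0 | h0
      · rw [hG.eq_univ_of_cutCard_eq_zero hA h0] at hs
        simp at hs
      · omega
    refine ⟨h4, fun hle => ?_⟩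
    have hcard : 3 ≤ Aᶜ.card := by
      have hsub : ({r, s e₀, t e₀} : Finset V) ⊆ Aᶜ := by
        intro w hw
        simp only [Finset.mem_insert, Finset.mem_singleton] at hw
        rcases hw with rfl | rfl | rfl <;> simpa
      have := Finset.card_le_card hsub
      rwa [Finset.card_eq_three.2 ⟨r, s e₀, t e₀, hrs, hrt, hG.loopless e₀, rfl⟩] at this
    have hpos := hA.card_pos
    obtain ⟨k, hk⟩ := hev
    rcases hG.sparse A hle with h | h | h | h
    · simp [h] at hpos
    · simp [h] at hcard
    · omega
    · omega
  have e1 : Even (U \ W).card := by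
    rw [← k1, Nat.odd_add] at hU1
    exact hU1.1 hodd
  have e2 : Even (W \ U).card := by
    rw [← k2, Nat.odd_add] at hW1
    exact hW1.1 hodd
  obtain ⟨a1, a2⟩ := key (U \ W) ⟨p, by simpa using hp⟩ e1 (by simp [hW2]) (by simp [hU3])
    ⟨q, by simp [hq.1], by rintro rfl; exact hq.2 hU2, by rintro rfl; exact hW3 hq.1⟩
  obtain ⟨b1, b2⟩ := key (W \ U) ⟨q, by simpa using hq⟩ e2 (by simp [hU2]) (by simp [hW3])
    ⟨p, by simp [hp.1], by rintro rfl; exact hp.2 hW2, by rintro rfl; exact hU3 hp.1⟩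
  exact ⟨a2 (by omega), b2 (by omega)⟩

end Uncross

section Antichain

variable {V E : Type} [Fintype V] [Fintype E] {s t : E → V}

theorem cutL_eq_zero_of_support {z : E → ℝ} {A U : Finset V}
    (hz : ∀ e, z e ≠ 0 → s e ∈ A ∧ t e ∈ A) (h : A ⊆ U ∨ Disjoint A U) : cutL s t U z = 0 := by
  rw [← map_zero (cutL s t U)]
  refine cutL_congr fun e he => ?_
  by_contra hne
  obtain ⟨h1, h2⟩ := hz e hne
  rcases h with h | h
  · exact he (iff_of_true (h h1) (h h2))
  · exact he (iff_of_false (Finset.disjoint_left.1 h h1) (Finset.disjoint_left.1 h h2))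

theorem IsStructured.inter_implied {e₀ : E} {x : E → ℝ} (hx : IsStructured s t e₀ x)
    (hG : CubicSparse s t) {U W : Finset V} (hU : U ∈ tightSets s t e₀ x)
    (hW : W ∈ tightSets s t e₀ x) (h : U ∩ W ∉ tightSets s t e₀ x) : Implied s t e₀ (U ∩ W) := by
  obtain ⟨h1, -, h3, -, -⟩ := hx.uncross hG hU hW
  obtain ⟨-, hU2, -⟩ := mem_tightSets.1 hU
  obtain ⟨-, hW2, -⟩ := mem_tightSets.1 hW
  rcases hx.tight_cases hG.loopless h1 h3 with h4 | h4 | h4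
  · exact h4
  · exact absurd h4 h
  · exact absurd (mem_tightSets.1 h4).2.1 (by simp [hU2, hW2])

theorem IsStructured.union_implied {e₀ : E} {x : E → ℝ} (hx : IsStructured s t e₀ x)
    (hG : CubicSparse s t) {U W : Finset V} (hU : U ∈ tightSets s t e₀ x)
    (hW : W ∈ tightSets s t e₀ x) (h : U ∪ W ∉ tightSets s t e₀ x) : Implied s t e₀ (U ∪ W) := by
  obtain ⟨-, h2, -, h3, -⟩ := hx.uncross hG hU hW
  obtain ⟨-, hU2, -⟩ := mem_tightSets.1 hU
  rcases hx.tight_cases hG.loopless h2 h3 with h4 | h4 | h4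
  · exact h4
  · exact absurd h4 h
  · exact absurd (mem_tightSets.1 h4).2.1 (by simp [hU2])

theorem IsStructured.cutCard_inter_union {e₀ : E} {x : E → ℝ} (hx : IsStructured s t e₀ x)
    (hG : CubicSparse s t) {U W : Finset V} (hU : U ∈ tightSets s t e₀ x)
    (hW : W ∈ tightSets s t e₀ x) : cutCard s t (U ∩ W) = 5 ∧ cutCard s t (U ∪ W) = 5 := by
  obtain ⟨h1, h2, h3, h4, h5⟩ := hx.uncross hG hU hW
  have h6 := hx.cutCard_le hG h1 h3
  have h7 := hx.cutCard_le hG h2 h4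
  have h8 := h5 1
  simp only [cutL_one] at h8
  rw [hx.cutCard_eq hG.loopless hU, hx.cutCard_eq hG.loopless hW] at h8
  have : 5 + 5 = cutCard s t (U ∩ W) + cutCard s t (U ∪ W) := by exact_mod_cast h8
  omega

/-- The non-implied tight cuts of an extremal point form an antichain. -/
theorem IsExtremal.antichain {e₀ : E} {x x₀ : E → ℝ} (hx : IsExtremal s t e₀ x)
    (hG : CubicSparse s t) (hdeg : ∀ w, degL s t w x₀ = 1) (hx₀ : x₀ e₀ = 0)
    (hbase : ∀ U ∈ tightSets s t e₀ x, ∀ e, ¬ (s e ∈ U ↔ t e ∈ U) → e ≠ e₀ → x₀ e = 1 / 4)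
    {U₀ W₀ : Finset V} (hU₀ : U₀ ∈ tightSets s t e₀ x) (hW₀ : W₀ ∈ tightSets s t e₀ x)
    (hsub₀ : U₀ ⊆ W₀) : U₀ = W₀ := by
  by_contra hne₀
  have hst := hx.toIsStructured
  obtain ⟨⟨U, W⟩, ⟨hU, hW, hUW⟩, hmin⟩ :=
    (measure fun p : Finset V × Finset V => p.1.card + p.2ᶜ.card).wf.has_min
      {p | p.1 ∈ tightSets s t e₀ x ∧ p.2 ∈ tightSets s t e₀ x ∧ p.1 ⊂ p.2}
      ⟨(U₀, W₀), hU₀, hW₀, hsub₀.ssubset_of_ne hne₀⟩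
  simp only at hU hW hUW
  have hcU := hst.cutCard_eq hG.loopless hU
  have hcW := hst.cutCard_eq hG.loopless hW
  obtain ⟨hU1, hU2, hU3, hU4, hU5⟩ := mem_tightSets.1 hU
  obtain ⟨hW1, hW2, hW3, hW4, hW5⟩ := mem_tightSets.1 hW
  obtain ⟨zu, hzu, hzud⟩ := exists_unit_flow hG hdeg hx₀ hcU (hbase U hU) hU5 hU2
    (.inl ⟨rfl, hU3⟩)
  obtain ⟨zv, hzv, hzvd⟩ := exists_unit_flow hG hdeg hx₀ (U := Wᶜ) (a := t e₀)
    (by rw [cutCard_compl, hcW])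
    (fun e he => hbase W hW e (by simp only [Finset.mem_compl] at he; tauto))
    (by rwa [implied_compl]) (by simpa using hW3) (.inr ⟨rfl, by simpa using hW2⟩)
  obtain ⟨y, hy⟩ : ∃ y : E → ℝ, y = (1 / 3 : ℝ) • (1 - Pi.single e₀ 1 + zu + zv) := ⟨_, rfl⟩
  have hyd : ∀ w, degL s t w y = 1 := by
    intro w
    rw [hy, map_smul, map_add, map_add, map_sub, hG.cubic, degL_single, hzud, hzvd, smul_eq_mul]
    simp only [eq_comm (a := w)]
    ring
  have hy0 : y e₀ = 0 := by
    have h1 : zu e₀ = 0 := by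
      by_contra h
      exact hU3 (hzu e₀ h).2
    have h2 : zv e₀ = 0 := by
      by_contra h
      have := (hzv e₀ h).1
      simp [hW2] at this
    rw [hy]
    simp [h1, h2]
  have hycut : ∀ A : Finset V, s e₀ ∈ A → t e₀ ∉ A → cutCard s t A = 5 →
      cutL s t A y = (4 + cutL s t A zu + cutL s t A zv) / 3 := by
    intro A h1 h2 h3
    rw [hy, map_smul, map_add, map_add, map_sub, cutL_one, h3, cutL_single, if_neg (by tauto),
      smul_eq_mul]
    ring
  have hyi : ∀ A : Finset V, Implied s t e₀ A → cutL s t A x = 1 → cutL s t A y = 1 := by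
    intro A hA h1
    have := hA (y - x) (fun w => by rw [map_sub, hyd, hst.inQ.deg, sub_self])
      (by rw [Pi.sub_apply, hy0, hst.zero, sub_self])
    rw [map_sub, h1] at this
    linarith
  have hzuU : ∀ A, U ⊆ A → cutL s t A zu = 0 := fun A h => cutL_eq_zero_of_support hzu (.inl h)
  have hzvW : ∀ A, A ⊆ W → cutL s t A zv = 0 := fun A h =>
    cutL_eq_zero_of_support hzv (.inr (disjoint_compl_left.mono_right h))
  have hu : ∀ A ∈ tightSets s t e₀ x, ¬ U ⊆ A → cutL s t A zu = -1 := by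
    intro A hA h
    obtain ⟨-, -, h3, -, h5⟩ := hst.uncross hG hU hA
    obtain ⟨-, hA2, hA3, -⟩ := mem_tightSets.1 hA
    have h6 : Implied s t e₀ (U ∩ A) := by
      refine hst.inter_implied hG hU hA fun h6 => ?_
      have hlt : U ∩ A ⊂ U := Finset.inter_subset_left.ssubset_of_ne fun h7 =>
        h (Finset.inter_eq_left.1 h7)
      exact hmin (U ∩ A, W) ⟨h6, hW, hlt.trans hUW⟩
        (Nat.add_lt_add_right (Finset.card_lt_card hlt) _)
    have h7 := hyi _ h6 h3
    rw [hycut _ (by simp [hU2, hA2]) (by simp [hU3]) (hst.cutCard_inter_union hG hU hA).1,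
      hzvW _ (Finset.inter_subset_left.trans hUW.subset)] at h7
    have h8 := h5 zu
    rw [hzuU _ subset_rfl, hzuU _ Finset.subset_union_left] at h8
    linarith
  have hv : ∀ A ∈ tightSets s t e₀ x, ¬ A ⊆ W → cutL s t A zv = -1 := by
    intro A hA h
    obtain ⟨-, -, -, h3, h5⟩ := hst.uncross hG hW hA
    obtain ⟨-, hA2, hA3, -⟩ := mem_tightSets.1 hA
    have h6 : Implied s t e₀ (W ∪ A) := by
      refine hst.union_implied hG hW hA fun h6 => ?_
      have hlt : W ⊂ W ∪ A := Finset.subset_union_left.ssubset_of_ne fun h7 =>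
        h (Finset.union_eq_left.1 h7.symm)
      exact hmin (U, W ∪ A) ⟨hU, h6, hUW.trans hlt⟩
        (Nat.add_lt_add_left (Finset.card_lt_card (Finset.compl_ssubset_compl.2 hlt)) _)
    have h7 := hyi _ h6 h3
    rw [hycut _ (by simp [hW2]) (by simp [hW3, hA3]) (hst.cutCard_inter_union hG hW hA).2,
      hzuU _ (hUW.subset.trans Finset.subset_union_left)] at h7
    have h8 := h5 zv
    rw [hzvW _ subset_rfl, hzvW _ Finset.inter_subset_left] at h8
    linarith
  have hge : ∀ A ∈ tightSets s t e₀ x, 1 ≤ cutL s t A y := by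
    intro A hA
    have hA' := mem_tightSets.1 hA
    rw [hycut A hA'.2.1 hA'.2.2.1 (hst.cutCard_eq hG.loopless hA)]
    by_cases h1 : U ⊆ A
    · rw [hzuU A h1]
      by_cases h2 : A ⊆ W
      · rw [hzvW A h2]
        norm_num
      · rw [hv A hA h2]
        norm_num
    · by_cases h2 : A ⊆ W
      · rw [hzvW A h2, hu A hA h1]
        norm_num
      · exfalso
        obtain ⟨a1, a2⟩ := hst.card_sdiff_eq_two hG hU hA h1 fun h => h2 (h.trans hUW.subset)
        obtain ⟨b1, b2⟩ := hst.card_sdiff_eq_two hG hW hA (fun h => h1 (hUW.subset.trans h)) h2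
        have e1 : U \ A = W \ A := Finset.eq_of_subset_of_card_le
          (Finset.sdiff_subset_sdiff hUW.subset subset_rfl) (by rw [a1, b1])
        have e2 : A \ W = A \ U := Finset.eq_of_subset_of_card_le
          (Finset.sdiff_subset_sdiff subset_rfl hUW.subset) (by rw [a2, b2])
        obtain ⟨w, hw, hwU⟩ := Finset.exists_of_ssubset hUW
        by_cases hwA : w ∈ A
        · have : w ∈ A \ W := by
            rw [e2]
            simp [hwA, hwU]
          simp [hw] at this
        · have : w ∈ U \ A := by
            rw [e1]
            simp [hwA, hw]
          simp [hwU] at this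
  have hfin := hx.rigid y hyd hy0 hge U hU
  rw [hycut U hU2 hU3 hcU, hzuU U subset_rfl, hzvW U hUW.subset] at hfin
  norm_num at hfin

theorem hasGoodPoint_of_hall (hG : CubicSparse s t) (e₀ : E)
    (h : ∀ I : Finset V, Disjoint I (nbr s t (Finset.univ.erase e₀) I) →
      (I.card : ℝ) + ((if s e₀ ∈ I then (1 : ℝ) else 0) + (if t e₀ ∈ I then 1 else 0)) ≤
        (nbr s t (Finset.univ.erase e₀) I).card +
          ((if s e₀ ∈ nbr s t (Finset.univ.erase e₀) I then (1 : ℝ) else 0) +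
            (if t e₀ ∈ nbr s t (Finset.univ.erase e₀) I then 1 else 0))) :
    HasGoodPoint s t e₀ := by
  obtain ⟨x, x₀, hx, hdeg, hx₀, hbase⟩ := exists_extremal hG e₀ h
  have hst := hx.toIsStructured
  have hsupp : ∀ d : E → ℝ, d e₀ = 0 → ∀ e, x e = 0 → d e = 0 := by
    intro d hd e he
    by_cases hne : e = e₀
    · rw [hne, hd]
    · exact absurd he (hst.pos e hne).ne'
  obtain ⟨l, hl⟩ : ∃ l : (E → ℝ) →ₗ[ℝ] ℝ, ∀ d : E → ℝ, (∀ w, degL s t w d = 0) → d e₀ = 0 →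
      l d = 0 → ∀ U ∈ tightSets s t e₀ x, cutL s t U d = 0 := by
    rcases (tightSets s t e₀ x).eq_empty_or_nonempty with h0 | ⟨U, hU⟩
    · exact ⟨0, fun d _ _ _ U hU => by simp [h0] at hU⟩
    · refine ⟨cutL s t U, fun d hd hd0 hdU A hA => ?_⟩
      by_cases hAU : A = U
      · rw [hAU, hdU]
      have hanti := fun {B C : Finset V} (hB : B ∈ tightSets s t e₀ x) hC hBC =>
        hx.antichain hG hdeg hx₀ hbase (U₀ := B) (W₀ := C) hB hC hBC
      have h1 := hst.inter_implied hG hU hA fun h1 =>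
        hAU (((hanti h1 hA Finset.inter_subset_right).symm.trans
          (hanti h1 hU Finset.inter_subset_left)))
      have h2 := hst.union_implied hG hU hA fun h1 =>
        hAU ((hanti hA h1 Finset.subset_union_right).trans
          (hanti hU h1 Finset.subset_union_left).symm)
      have h3 := (hst.uncross hG hU hA).2.2.2.2 d
      rw [h1 d hd hd0, h2 d hd hd0, hdU] at h3
      linarith
  refine ⟨x, l, hst.inQ, hst.zero, fun d hd hd0 hld => ⟨hsupp d hd0, fun U hU h1 => ?_⟩⟩
  rcases hst.tight_cases hG.loopless hU h1 with h2 | h2 | h2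
  · exact h2 d hd hd0
  · exact hl d hd hd0 hld U h2
  · rw [← cutL_compl]
    exact hl d hd hd0 hld _ h2

theorem hasGoodPoint (hG : CubicSparse s t) (e₀ : E) : HasGoodPoint s t e₀ := by
  rcases hall_or_exists_barrier hG e₀ with h | h
  · exact hasGoodPoint_of_hall hG e₀ h
  · exact hasGoodPoint_of_barrier hG h

end Antichain

section Count

variable {V E : Type} [Fintype V] [Fintype E] {s t : E → V}

theorem CubicSparse.two_mul_card_edges (hG : CubicSparse s t) :
    2 * (Fintype.card E : ℝ) = 3 * Fintype.card V := by
  have h := sum_degL_univ s t 1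
  rw [hG.sum_degL_one] at h
  simp only [Finset.card_univ, Pi.one_apply, Finset.sum_const, nsmul_eq_mul, mul_one] at h
  exact h.symm

theorem IsPM.two_mul_card {M : Finset E} (hM : IsPM s t M) :
    2 * (M.card : ℝ) = Fintype.card V := by
  have h := sum_degL_univ s t (ind M)
  rw [Finset.sum_congr rfl fun w _ => hM w] at h
  simpa [ind] using h.symm

theorem sum_card_avoiding (hG : CubicSparse s t) :
    ∑ e : E, (Nat.card {M : Finset E // IsPM s t M ∧ e ∉ M} : ℝ) =
      Nat.card {M : Finset E // IsPM s t M} * Fintype.card V := by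
  have h1 : ∀ e : E, (Nat.card {M : Finset E // IsPM s t M ∧ e ∉ M} : ℝ) =
      ∑ M ∈ Finset.univ.filter (IsPM s t), if e ∉ M then (1 : ℝ) else 0 := by
    intro e
    rw [Nat.card_eq_fintype_card, Fintype.card_subtype, ← Finset.filter_filter,
      Finset.card_filter, Nat.cast_sum]
    exact Finset.sum_congr rfl fun M _ => by split_ifs <;> simp
  simp only [h1]
  rw [Finset.sum_comm, Nat.card_eq_fintype_card, Fintype.card_subtype, ← nsmul_eq_mul]
  refine Finset.sum_eq_card_nsmul fun M hM => ?_
  have hM' := IsPM.two_mul_card (Finset.mem_filter.1 hM).2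
  have h2 := hG.two_mul_card_edges
  have h3 : ∀ e, (if e ∉ M then (1 : ℝ) else 0) = 1 - if e ∈ M then 1 else 0 := fun e => by
    split_ifs <;> simp_all
  simp only [h3, Finset.sum_sub_distrib, Finset.sum_const, Finset.card_univ, nsmul_eq_mul, mul_one,
    Finset.sum_ite_mem, Finset.univ_inter]
  linarith

theorem CubicSparse.le_card_isPM (hG : CubicSparse s t) :
    3 * (Fintype.card V : ℝ) / 4 - 3 / 2 ≤ Nat.card {M : Finset E // IsPM s t M} := by
  rcases isEmpty_or_nonempty V with hV | hV
  · simp only [Fintype.card_eq_zero]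
    refine le_trans ?_ (Nat.cast_nonneg _)
    norm_num
  have h1 : ∀ e : E, (Fintype.card E : ℝ) - Fintype.card V - 1 ≤
      Nat.card {M : Finset E // IsPM s t M ∧ e ∉ M} := by
    intro e
    obtain ⟨x, l, hx, hx0, hl⟩ := hasGoodPoint hG e
    have h := hx.card_le hx0 l hl
    have : (Fintype.card E : ℝ) ≤
        Nat.card {M : Finset E // IsPM s t M ∧ e ∉ M} + Fintype.card V + 1 := by
      exact_mod_cast h
    linarith
  have h2 := Finset.sum_le_sum fun e (_ : e ∈ Finset.univ) => h1 e
  rw [sum_card_avoiding hG, Finset.sum_const, Finset.card_univ, nsmul_eq_mul] at h2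
  have h3 := hG.two_mul_card_edges
  have h4 : (0 : ℝ) < Fintype.card V := by exact_mod_cast Fintype.card_pos
  rw [show (Fintype.card E : ℝ) = 3 / 2 * Fintype.card V by linarith] at h2
  refine le_of_mul_le_mul_right ?_ h4
  linarith

end Count

end EdgeWeight

namespace Multigraph

section Translation

variable {G : Multigraph} {s t : G.E → G.V}

open EdgeWeight

theorem inc_eq (h : ∀ e, G.ends e = s(s e, t e)) (w : G.V) (e : G.E) :
    G.inc w e = (if s e = w then 1 else 0) + (if t e = w then 1 else 0) := by
  unfold inc
  simp only [h, Sym2.diag, Sym2.mem_iff]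
  by_cases h1 : s e = w <;> by_cases h2 : t e = w <;>
    simp [h1, h2, eq_comm (a := w)]

theorem degL_one_eq (h : ∀ e, G.ends e = s(s e, t e)) (w : G.V) :
    degL s t w 1 = G.degree w := by
  rw [degL_apply, degree, Nat.cast_sum]
  refine Finset.sum_congr rfl fun e _ => ?_
  rw [inc_eq h]
  push_cast
  simp

theorem ncard_cutEdges (h : ∀ e, G.ends e = s(s e, t e)) (U : Finset G.V) :
    (G.cutEdges U).ncard = cutCard s t U := by
  rw [cutCard, ← Set.ncard_coe_finset]
  congr 1
  ext e
  simp only [cutEdges, h, Set.mem_ofPred_eq, Finset.mem_coe, Finset.coe_filter, Finset.mem_univ,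
    true_and, Sym2.eq_iff]
  constructor
  · rintro ⟨u, v, ⟨rfl, rfl⟩ | ⟨rfl, rfl⟩, h1, h2⟩ <;> tauto
  · intro h1
    by_cases h2 : s e ∈ U
    · exact ⟨_, _, .inl ⟨rfl, rfl⟩, h2, by tauto⟩
    · exact ⟨_, _, .inr ⟨rfl, rfl⟩, by tauto, h2⟩

theorem hasCycleWithin_of_card_le (h : ∀ e, G.ends e = s(s e, t e)) (A : Finset G.V)
    (hA : A.Nonempty)
    (hcard : A.card ≤ (Finset.univ.filter fun e => s e ∈ A ∧ t e ∈ A).card) :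
    G.HasCycleWithin A := by
  induction A using Finset.strongInduction with
  | H A ih =>
    have hin : ∀ e ∈ Finset.univ.filter (fun e => s e ∈ A ∧ t e ∈ A), ∀ v ∈ G.ends e, v ∈ A := by
      intro e he v hv
      rw [h, Sym2.mem_iff] at hv
      rw [Finset.mem_filter] at he
      rcases hv with rfl | rfl
      · exact he.2.1
      · exact he.2.2
    have hne : (Finset.univ.filter fun e => s e ∈ A ∧ t e ∈ A).Nonempty :=
      Finset.card_pos.1 (lt_of_lt_of_le hA.card_pos hcard)
    by_cases hall : ∀ v, ∑ e ∈ Finset.univ.filter (fun e => s e ∈ A ∧ t e ∈ A), G.inc v e ≠ 1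
    · exact ⟨_, hne, hin, hall⟩
    push Not at hall
    obtain ⟨v, hv⟩ := hall
    have hvA : v ∈ A := by
      by_contra hvA
      rw [Finset.sum_eq_zero] at hv
      · norm_num at hv
      · intro e he
        rw [Finset.mem_filter] at he
        rw [inc_eq h, if_neg (by rintro rfl; exact hvA he.2.1),
          if_neg (by rintro rfl; exact hvA he.2.2), add_zero]
    have hA' : (A.erase v).Nonempty := by
      by_contra hA'
      rw [Finset.not_nonempty_iff_eq_empty, Finset.erase_eq_empty_iff] at hA'
      rcases hA' with rfl | rfl
      · simp at hvA
      · obtain ⟨e, he⟩ := hne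
        have h1 := Finset.single_le_sum (f := fun e => G.inc v e) (fun _ _ => Nat.zero_le _) he
        simp only [Finset.mem_filter, Finset.mem_singleton] at he
        rw [inc_eq h, if_pos he.2.1, if_pos he.2.2, hv] at h1
        norm_num at h1
    have hsub : (Finset.univ.filter fun e => s e ∈ A ∧ t e ∈ A).card ≤
        (Finset.univ.filter fun e => s e ∈ A.erase v ∧ t e ∈ A.erase v).card +
          ∑ e ∈ Finset.univ.filter (fun e => s e ∈ A ∧ t e ∈ A), G.inc v e := by
      rw [Finset.card_filter, Finset.card_filter, Finset.sum_filter, ← Finset.sum_add_distrib]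
      refine Finset.sum_le_sum fun e _ => ?_
      rw [inc_eq h]
      by_cases h1 : s e = v <;> by_cases h2 : t e = v <;> by_cases h3 : s e ∈ A <;>
        by_cases h4 : t e ∈ A <;> simp_all
    obtain ⟨F, hF, hF1, hF2⟩ := ih _ (Finset.erase_ssubset hvA) hA' (by
      rw [Finset.card_erase_of_mem hvA]
      omega)
    exact ⟨F, hF, fun e he w hw => Finset.mem_of_mem_erase (hF1 e he w hw), hF2⟩

theorem cubicSparse (h : ∀ e, G.ends e = s(s e, t e)) (hcubic : G.IsCubic)
    (h5 : G.CyclicallyEdgeConnected 5) : CubicSparse s t := by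
  have hdeg : ∀ w, degL s t w 1 = 3 := fun w => by
    rw [degL_one_eq h, hcubic]
    norm_num
  have hsparse : ∀ U : Finset G.V, cutCard s t U ≤ 4 →
      U = ∅ ∨ Uᶜ = ∅ ∨ U.card + 2 ≤ cutCard s t U ∨ Uᶜ.card + 2 ≤ cutCard s t U := by
    intro U hU
    by_contra hcon
    simp only [not_or] at hcon
    obtain ⟨h1, h2, h3, h4⟩ := hcon
    have k1 := three_mul_card_eq hdeg U
    have k2 := three_mul_card_eq hdeg Uᶜ
    rw [cutCard_compl] at k2
    have c1 := hasCycleWithin_of_card_le h U (Finset.nonempty_iff_ne_empty.2 h1) (by omega)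
    have c2 := hasCycleWithin_of_card_le h Uᶜ (Finset.nonempty_iff_ne_empty.2 h2) (by omega)
    rw [Finset.coe_compl] at c2
    have := h5 U ⟨c1, c2⟩
    rw [ncard_cutEdges h] at this
    omega
  refine ⟨fun e he => ?_, hdeg, hsparse⟩
  have k1 := three_mul_card_eq hdeg {s e}
  have k2 : 0 < (Finset.univ.filter fun f => s f ∈ ({s e} : Finset G.V) ∧
      t f ∈ ({s e} : Finset G.V)).card := Finset.card_pos.2 ⟨e, by simp [he]⟩
  rw [Finset.card_singleton] at k1
  rcases hsparse {s e} (by omega) with h1 | h1 | h1 | h1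
  · simp at h1
  · rw [← cutCard_compl, h1] at k1
    simp only [cutCard, Finset.notMem_empty, not_true, Finset.filter_false,
      Finset.card_empty] at k1
    omega
  · rw [Finset.card_singleton] at h1
    omega
  · omega

theorem isPM_iff (h : ∀ e, G.ends e = s(s e, t e)) (hl : ∀ e, s e ≠ t e) (M : Finset G.E) :
    IsPM s t M ↔ G.IsPerfectMatching M := by
  have hdiag : ∀ e ∈ M, ¬ (G.ends e).IsDiag := fun e _ => by
    rw [h, Sym2.mk_isDiag_iff]
    exact hl e
  have hdeg : ∀ w, degL s t w (ind M) = (Finset.univ.filter fun e => e ∈ M ∧ w ∈ G.ends e).card := by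
    intro w
    rw [degL_apply, Finset.card_filter, Nat.cast_sum]
    refine Finset.sum_congr rfl fun e _ => ?_
    have := hl e
    simp only [h, Sym2.mem_iff, ind]
    by_cases h1 : s e = w <;> by_cases h2 : t e = w <;> by_cases h3 : e ∈ M <;>
      simp_all [eq_comm (a := w)]
  unfold IsPM IsPerfectMatching
  rw [and_iff_right hdiag]
  refine forall_congr' fun w => ?_
  rw [hdeg, Nat.cast_eq_one, Finset.card_eq_one]
  simp only [Finset.eq_singleton_iff_unique_mem, Finset.mem_filter, Finset.mem_univ, true_and,
    ExistsUnique]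

end Translation

end Multigraph

open Multigraph
/-- Every cyclically 5-edge-connected cubic graph of order `n`
has at least `3n/4 - 3/2` perfect matchings. -/
theorem cyclically5ec_many_perfect_matchings (G : Multigraph)
    (hcubic : G.IsCubic) (h5 : G.CyclicallyEdgeConnected 5) :
    3 * (Fintype.card G.V : ℝ) / 4 - 3 / 2 ≤ (G.pmCount : ℝ) := by
  have hex : ∀ e, ∃ p : G.V × G.V, G.ends e = s(p.1, p.2) := fun e => by
    induction G.ends e using Sym2.ind with
    | _ x y => exact ⟨(x, y), rfl⟩
  choose p hp using hex
  have hG := cubicSparse hp hcubic h5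
  have h := hG.le_card_isPM
  rwa [Nat.card_congr (Equiv.subtypeEquivRight (isPM_iff hp hG.loopless))] at h
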